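/- Let (E, L, τ) and (F, M, υ) be orthogonal isodual Euclidean lattices such that |s(b_τ)·s(b_υ)| ≥ (dim E)·(dim F) − 8, where s denotes the signature. Then H_min of the tensor product of (E, L) and (F, M) equals H_min(E, L)·H_min(F, M). -/

import Mathlib

open Module

noncomputable section

namespace EucLat

variable {E : Type*} [NormedAddCommGroup E] [InnerProductSpace ℝ E]

/-- The covolume of a `ℤ`-submodule of a real inner product space: the square root of the
Gram determinant of a `ℤ`-basis (junk value `0` if no finite basis exists). -/
def covol (L : Submodule ℤ E) : ℝ :=
  @dite _ (∃ n : ℕ, Nonempty (Basis (Fin n) ℤ L)) (Classical.propDecidable _)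
    (fun h => Real.sqrt (Matrix.det (Matrix.of fun i j =>
      (inner ℝ ((h.choose_spec.some i : L) : E) ((h.choose_spec.some j : L) : E) : ℝ))))
    (fun _ => 0)

/-- The reduced height `covol(L)^(1/dim E)` of a full lattice. -/
def redH (L : Submodule ℤ E) : ℝ := covol L ^ ((finrank ℝ E : ℝ)⁻¹)

/-- The lattice `L ∩ F` induced on a subspace `F`. -/
def latIn (L : Submodule ℤ E) (F : Submodule ℝ E) : Submodule ℤ F :=
  L.comap (F.subtype.restrictScalars ℤ)

/-- The reduced height of a subspace: `covol(F ∩ L)^(1/dim F)`. -/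
def Hr (L : Submodule ℤ E) (F : Submodule ℝ E) : ℝ := redH (latIn L F)

/-- A subspace is rational if it is spanned by its intersection with the lattice. -/
def IsRational (L : Submodule ℤ E) (F : Submodule ℝ E) : Prop :=
  Submodule.span ℝ ((L : Set E) ∩ (F : Set E)) = F

/-- `(E, L)` is a Euclidean lattice: `L` is discrete and spans `E` over `ℝ`. -/
def IsLat (L : Submodule ℤ E) : Prop :=
  DiscreteTopology L ∧ Submodule.span ℝ (L : Set E) = ⊤

/-- Minimal reduced height: infimum of reduced heights of nonzero rational subspaces. -/
def Hmin (L : Submodule ℤ E) : ℝ :=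
  sInf {h : ℝ | ∃ F : Submodule ℝ E, F ≠ ⊥ ∧ IsRational L F ∧ h = Hr L F}

/-- Semistability of a Euclidean lattice. -/
def Semistable (L : Submodule ℤ E) : Prop :=
  ∀ F : Submodule ℝ E, F ≠ ⊥ → IsRational L F → redH L ≤ Hr L F

/-- Stability of a Euclidean lattice. -/
def Stable (L : Submodule ℤ E) : Prop :=
  Semistable L ∧ ∀ F : Submodule ℝ E, F ≠ ⊥ → F ≠ ⊤ → IsRational L F → redH L < Hr L F

/-- The quotient lattice of `(E, L)` by a subspace `F`: the image of `L` under the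
orthogonal projection of `E` onto `Fᗮ`. -/
def quotLat [FiniteDimensional ℝ E] (L : Submodule ℤ E) (F : Submodule ℝ E) :
    Submodule ℤ Fᗮ :=
  L.map ((Submodule.orthogonalProjectionOnto Fᗮ : E →ₗ[ℝ] Fᗮ).restrictScalars ℤ)

/-- For subspaces `F ≤ F'`, the successive quotient lattice: the image of `F' ∩ L` under the
orthogonal projection of `F'` onto the orthogonal complement of `F` inside `F'`. -/
def succQuot [FiniteDimensional ℝ E] (L : Submodule ℤ E) (F F' : Submodule ℝ E) :
    Submodule ℤ ((F.comap F'.subtype)ᗮ) :=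
  quotLat (latIn L F') (F.comap F'.subtype)

/-- A GS-flag of `(E, L)`. -/
def IsGSFlag [FiniteDimensional ℝ E] (L : Submodule ℤ E) {ℓ : ℕ}
    (C : Fin (ℓ + 1) → Submodule ℝ E) : Prop :=
  C 0 = ⊥ ∧ C (Fin.last ℓ) = ⊤ ∧
  (∀ i : Fin ℓ, C i.castSucc < C i.succ) ∧
  (∀ i, IsRational L (C i)) ∧
  (∀ i : Fin ℓ, Semistable (succQuot L (C i.castSucc) (C i.succ))) ∧
  (∀ i j : Fin ℓ, i < j →
    redH (succQuot L (C i.castSucc) (C i.succ)) < redH (succQuot L (C j.castSucc) (C j.succ)))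

/-- The dual lattice `L* = {y : ⟪x, y⟫ ∈ ℤ for all x ∈ L}`. -/
def dualLat (L : Submodule ℤ E) : Submodule ℤ E where
  carrier := {y | ∀ x ∈ L, ∃ n : ℤ, (inner ℝ x y : ℝ) = n}
  zero_mem' := fun x _ => ⟨0, by simp⟩
  add_mem' := by
    intro a b ha hb x hx
    obtain ⟨m, hm⟩ := ha x hx
    obtain ⟨n, hn⟩ := hb x hx
    exact ⟨m + n, by rw [inner_add_right, hm, hn]; push_cast; ring⟩
  smul_mem' := by
    intro z y hy x hx
    obtain ⟨n, hn⟩ := hy x hx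
    refine ⟨z * n, ?_⟩
    rw [← Int.cast_smul_eq_zsmul ℝ, real_inner_smul_right, hn]
    push_cast; ring

/-- `(E, L)` is isodual via the similarity `τ`. -/
def IsIsodual (L : Submodule ℤ E) (τ : E →ₗ[ℝ] E) : Prop :=
  (∃ α : ℝ, 0 < α ∧ ∀ x y : E, (inner ℝ (τ x) (τ y) : ℝ) = α * inner ℝ x y) ∧
  L.map (τ.restrictScalars ℤ) = dualLat L

/-- The bilinear form `b_τ(x, y) = ⟪τ x, y⟫` associated with an isoduality. -/
def bform (τ : E →ₗ[ℝ] E) (x y : E) : ℝ := inner ℝ (τ x) y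

/-- `b` has signature `s`: there is a `b`-orthogonal basis with `p - q = s`. -/
def HasSignature (b : E → E → ℝ) (s : ℤ) : Prop :=
  ∃ (n : ℕ) (v : Basis (Fin n) ℝ E),
    (∀ i j, i ≠ j → b (v i) (v j) = 0) ∧
    s = ((Finset.univ.filter fun i => 0 < b (v i) (v i)).card : ℤ) -
        ((Finset.univ.filter fun i => b (v i) (v i) < 0).card : ℤ)

/-- The destabilizing subspace of `(E, L)`. -/
def IsDestabilizing (L : Submodule ℤ E) (F : Submodule ℝ E) : Prop :=
  F ≠ ⊥ ∧ IsRational L F ∧ Hr L F = Hmin L ∧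
  ∀ F' : Submodule ℝ E, F' ≠ ⊥ → IsRational L F' → Hr L F' = Hmin L → F' ≤ F

/-- `(G, t)` is a realization of the tensor product of the inner product spaces `E` and `F`:
`t` induces a linear isomorphism `E ⊗ F ≃ G` and
`⟪t x y, t x' y'⟫ = ⟪x, x'⟫ * ⟪y, y'⟫` on pure tensors. -/
def IsTensor {F G : Type*} [NormedAddCommGroup F] [InnerProductSpace ℝ F]
    [NormedAddCommGroup G] [InnerProductSpace ℝ G] (t : E →ₗ[ℝ] F →ₗ[ℝ] G) : Prop :=
  Function.Bijective (TensorProduct.lift t) ∧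
  ∀ (x x' : E) (y y' : F),
    (inner ℝ (t x y) (t x' y') : ℝ) = (inner ℝ x x' : ℝ) * (inner ℝ y y' : ℝ)

/-- The tensor product lattice `L·M`: the additive subgroup generated by pure tensors. -/
def tensorLat {F G : Type*} [NormedAddCommGroup F] [InnerProductSpace ℝ F]
    [NormedAddCommGroup G] [InnerProductSpace ℝ G] (t : E →ₗ[ℝ] F →ₗ[ℝ] G)
    (L : Submodule ℤ E) (M : Submodule ℤ F) : Submodule ℤ G :=
  Submodule.span ℤ (Set.image2 (fun x y => t x y) (L : Set E) (M : Set F))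

/-- `g` is an automorphism of the Euclidean lattice `(E, L)`. -/
def IsAut (L : Submodule ℤ E) (g : E ≃ₗ[ℝ] E) : Prop :=
  (∀ x, x ∈ L ↔ g x ∈ L) ∧ ∀ x y : E, (inner ℝ (g x) (g y) : ℝ) = inner ℝ x y

/-- The direct product lattice `L × L'` inside `WithLp 2 (E × E')`. -/
def prodLat {E' : Type*} [NormedAddCommGroup E'] [InnerProductSpace ℝ E']
    (L : Submodule ℤ E) (L' : Submodule ℤ E') : Submodule ℤ (WithLp 2 (E × E')) :=
  (L.prod L').comap (((WithLp.linearEquiv 2 ℝ (E × E')).restrictScalars ℤ) : WithLp 2 (E × E') →ₗ[ℤ] E × E')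


set_option linter.all false
section P1

/-! ### Linear algebra of Gram determinants -/

theorem det_one_add_ge {n : Type*} [Fintype n] [DecidableEq n] (S : Matrix n n ℝ)
    (hS : S.PosSemidef) : 1 ≤ (1 + S).det := by
  have hH : (1 + S).IsHermitian := Matrix.isHermitian_one.add hS.1
  rw [hH.det_eq_prod_eigenvalues]
  have h1 : ∀ i, 1 ≤ hH.eigenvalues i := by
    intro i
    have h := hH.eigenvalues_eq i
    rw [h, Matrix.add_mulVec, Matrix.one_mulVec, dotProduct_add]
    have h2 := hS.dotProduct_mulVec_nonneg (hH.eigenvectorBasis i).ofLp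
    have h3 : star (hH.eigenvectorBasis i).ofLp ⬝ᵥ (hH.eigenvectorBasis i).ofLp = 1 := by
      have := hH.eigenvectorBasis.orthonormal.1 i
      have h4 : inner ℝ (hH.eigenvectorBasis i) (hH.eigenvectorBasis i) = (1:ℝ) := by
        rw [real_inner_self_eq_norm_sq, this]; norm_num
      rw [← h4, PiLp.inner_apply]
      simp [dotProduct, sq]
    rw [h3]
    simp only [RCLike.re_to_real]
    linarith
  simp only [RCLike.ofReal_real_eq_id, id]
  exact Finset.one_le_prod (fun i _ => h1 i)

open scoped MatrixOrder in
theorem det_mono {n : Type*} [Fintype n] [DecidableEq n] (P Q : Matrix n n ℝ)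
    (hP : P.PosSemidef) (hQ : (Q - P).PosSemidef) : P.det ≤ Q.det := by
  by_cases h : P.det = 0
  · rw [h]
    have : Q.PosSemidef := by simpa using hP.add hQ
    exact this.det_nonneg
  obtain ⟨B, rfl⟩ : ∃ B : Matrix n n ℝ, P = B.conjTranspose * B := by
    refine ⟨CFC.sqrt P, ?_⟩
    have h1 : (CFC.sqrt P).conjTranspose = CFC.sqrt P := (Matrix.nonneg_iff_posSemidef.1 (CFC.sqrt_nonneg P)).1
    rw [h1, CFC.sqrt_mul_sqrt_self P hP.nonneg]
  have hB : IsUnit B.det := by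
    rw [Matrix.det_mul] at h
    exact (right_ne_zero_of_mul h).isUnit
  set R := Q - B.conjTranspose * B with hR
  have key : Q = B.conjTranspose * (1 + (B⁻¹).conjTranspose * R * B⁻¹) * B := by
    rw [mul_add, add_mul, mul_one]
    have e1 : B.conjTranspose * ((B⁻¹).conjTranspose * R * B⁻¹) * B = R := by
      have e2 : B.conjTranspose * (B⁻¹).conjTranspose = 1 := by
        rw [← Matrix.conjTranspose_mul, Matrix.nonsing_inv_mul _ hB, Matrix.conjTranspose_one]
      calc _ = (B.conjTranspose * (B⁻¹).conjTranspose) * R * (B⁻¹ * B) := by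
            simp only [Matrix.mul_assoc]
        _ = R := by rw [e2, Matrix.nonsing_inv_mul _ hB]; simp
    rw [e1, hR]; abel
  have h1 := det_one_add_ge ((B⁻¹).conjTranspose * R * B⁻¹) (hQ.conjTranspose_mul_mul_same _)
  rw [key, Matrix.det_mul, Matrix.det_mul, Matrix.det_mul]
  have h2 : 0 ≤ B.conjTranspose.det * B.det := by
    rw [← Matrix.det_mul]; exact hP.det_nonneg
  nlinarith

variable {V W : Type*} [NormedAddCommGroup V] [InnerProductSpace ℝ V]
  [NormedAddCommGroup W] [InnerProductSpace ℝ W]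

/-- Gram determinant. -/
def gdet {ι : Type*} [Fintype ι] [DecidableEq ι] (v : ι → V) : ℝ := (Matrix.gram ℝ v).det

theorem gdet_nonneg {ι : Type*} [Fintype ι] [DecidableEq ι] (v : ι → V) : 0 ≤ gdet v :=
  (Matrix.posSemidef_gram ℝ v).det_nonneg

theorem gdet_reindex {ι κ : Type*} [Fintype ι] [DecidableEq ι] [Fintype κ] [DecidableEq κ]
    (v : ι → V) (e : κ ≃ ι) : gdet (v ∘ e) = gdet v := by
  unfold gdet
  rw [← Matrix.det_submatrix_equiv_self e]; rfl

theorem gdet_pos {ι : Type*} [Fintype ι] [DecidableEq ι] {v : ι → V}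
    (h : LinearIndependent ℝ v) : 0 < gdet v :=
  (gdet_nonneg v).lt_of_ne' (Matrix.det_gram_ne_zero_iff_linearIndependent.2 h)

theorem linInd_of_gdet {ι : Type*} [Fintype ι] [DecidableEq ι] {v : ι → V}
    (h : gdet v ≠ 0) : LinearIndependent ℝ v :=
  Matrix.det_gram_ne_zero_iff_linearIndependent.1 h

theorem gram_dot {ι : Type*} [Fintype ι] (v : ι → V) (x : ι → ℝ) :
    star x ⬝ᵥ (Matrix.gram ℝ v).mulVec x = ‖∑ i, x i • v i‖ ^ 2 := by
  rw [Matrix.star_dotProduct_gram_mulVec, real_inner_self_eq_norm_sq]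

theorem gdet_combo {ι : Type*} [Fintype ι] [DecidableEq ι] (v w : ι → V) (C : Matrix ι ι ℝ)
    (h : ∀ i, w i = ∑ j, C i j • v j) : gdet w = C.det ^ 2 * gdet v := by
  have : Matrix.gram ℝ w = C * Matrix.gram ℝ v * C.transpose := by
    ext i j
    simp only [Matrix.gram_apply, h, Matrix.mul_apply, sum_inner, inner_sum, real_inner_smul_left,
      real_inner_smul_right, Matrix.transpose_apply, Finset.sum_mul]
    refine Finset.sum_congr rfl fun k _ => Finset.sum_congr rfl fun l _ => ?_
    ring
  rw [gdet, this, Matrix.det_mul, Matrix.det_mul, Matrix.det_transpose, gdet]; ring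

theorem gdet_schur {ι κ : Type*} [Fintype ι] [DecidableEq ι] [Fintype κ] [DecidableEq κ]
    (v : ι → V) (u : κ → V) (w : κ → W)
    (h : ∀ (c : ι → ℝ) (d : κ → ℝ), ‖∑ j, d j • w j‖ ≤ ‖∑ i, c i • v i + ∑ j, d j • u j‖) :
    gdet v * gdet w ≤ gdet (Sum.elim v u) := by
  by_cases h0 : gdet v = 0
  · rw [h0, zero_mul]; exact gdet_nonneg _
  have hli := linInd_of_gdet h0
  have hA : (Matrix.gram ℝ v).PosDef := Matrix.posDef_gram_of_linearIndependent hli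
  have : Invertible (Matrix.gram ℝ v) := Matrix.invertibleOfIsUnitDet _ (Ne.isUnit h0)
  set A := Matrix.gram ℝ v
  set B : Matrix ι κ ℝ := Matrix.of fun i j => inner ℝ (v i) (u j) with hB
  set D := Matrix.gram ℝ u
  have hg : Matrix.gram ℝ (Sum.elim v u) = Matrix.fromBlocks A B B.conjTranspose D := by
    ext i j
    rcases i with i | i <;> rcases j with j | j <;>
      simp [A, B, D, Matrix.gram_apply, real_inner_comm]
  have hpsd : (Matrix.fromBlocks A B B.conjTranspose (D - Matrix.gram ℝ w)).PosSemidef := by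
    have e : Matrix.fromBlocks A B B.conjTranspose (D - Matrix.gram ℝ w) =
        Matrix.gram ℝ (Sum.elim v u) - Matrix.gram ℝ (Sum.elim (fun _ => (0:W)) w) := by
      rw [hg]
      ext i j
      rcases i with i | i <;> rcases j with j | j <;> simp [Matrix.gram_apply]
    rw [e]
    refine Matrix.PosSemidef.of_dotProduct_mulVec_nonneg
      ((Matrix.isHermitian_gram ℝ _).sub (Matrix.isHermitian_gram ℝ _)) fun x => ?_
    rw [Matrix.sub_mulVec, dotProduct_sub, gram_dot, gram_dot]
    have := h (fun i => x (Sum.inl i)) (fun i => x (Sum.inr i))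
    simp only [Fintype.sum_sum_type, Sum.elim_inl, Sum.elim_inr, smul_zero, Finset.sum_const_zero,
      zero_add]
    have h3 := pow_le_pow_left₀ (norm_nonneg _) this 2
    linarith
  rw [Matrix.PosDef.fromBlocks₁₁ B _ hA] at hpsd
  have hm : (Matrix.gram ℝ w).det ≤ (D - B.conjTranspose * A⁻¹ * B).det := by
    apply det_mono _ _ (Matrix.posSemidef_gram ℝ w)
    rwa [sub_right_comm] at hpsd
  have : gdet (Sum.elim v u) = A.det * (D - B.conjTranspose * A⁻¹ * B).det := by
    rw [gdet, hg, Matrix.det_fromBlocks₁₁, Matrix.invOf_eq_nonsing_inv]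
  rw [this]
  exact mul_le_mul_of_nonneg_left hm (gdet_nonneg v)

theorem gdet_orth {ι κ : Type*} [Fintype ι] [DecidableEq ι] [Fintype κ] [DecidableEq κ]
    (v : ι → V) (u p : κ → V) (C : Matrix κ ι ℝ)
    (hu : ∀ k, u k = p k + ∑ i, C k i • v i) (hp : ∀ i k, inner ℝ (v i) (p k) = (0:ℝ)) :
    gdet (Sum.elim v u) = gdet v * gdet p := by
  have h1 := gdet_combo (Sum.elim v p) (Sum.elim v u) (Matrix.fromBlocks 1 0 C 1) (by
    rintro (i | i)
    · simp [Matrix.one_apply]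
    · simp [Matrix.one_apply, hu, add_comm])
  rw [Matrix.det_fromBlocks_one₁₁] at h1
  rw [Matrix.mul_zero, sub_zero, Matrix.det_one, one_pow, one_mul] at h1
  rw [h1]
  have hg : Matrix.gram ℝ (Sum.elim v p) =
      Matrix.fromBlocks (Matrix.gram ℝ v) 0 0 (Matrix.gram ℝ p) := by
    ext i j
    rcases i with i | i <;> rcases j with j | j <;>
      simp [hp, real_inner_comm]
  rw [gdet, hg, Matrix.det_fromBlocks_zero₂₁]; rfl

end P1


section P2
variable {V W : Type*} [NormedAddCommGroup V] [InnerProductSpace ℝ V]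
  [NormedAddCommGroup W] [InnerProductSpace ℝ W]

/-! ### Covolumes -/

/-- Image of a `ℤ`-submodule under a real linear map. -/
def mapZ (T : V →ₗ[ℝ] W) (X : Submodule ℤ V) : Submodule ℤ W := X.map (T.restrictScalars ℤ)
/-- Kernel of a real linear map, as a `ℤ`-submodule. -/
def kerZ (T : V →ₗ[ℝ] W) : Submodule ℤ V := LinearMap.ker (T.restrictScalars ℤ)
/-- Rank of a `ℤ`-submodule. -/
abbrev rk (X : Submodule ℤ V) : ℕ := finrank ℤ X

theorem mem_mapZ {T : V →ₗ[ℝ] W} {X : Submodule ℤ V} {w : W} :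
    w ∈ mapZ T X ↔ ∃ v ∈ X, T v = w := Iff.rfl

theorem mem_kerZ {T : V →ₗ[ℝ] W} {v : V} : v ∈ kerZ T ↔ T v = 0 := Iff.rfl

theorem zsmul_eq (n : ℤ) (v : V) : n • v = (n : ℝ) • v := (Int.cast_smul_eq_zsmul ℝ n v).symm

theorem exists_basis {X : Submodule ℤ V} (h : X.FG) : Nonempty (Basis (Fin (rk X)) ℤ X) := by
  haveI : Module.Finite ℤ X := Module.Finite.iff_fg.2 h
  haveI : Module.IsTorsionFree ℤ V := Module.IsTorsionFree.trans_faithfulSMul ℤ ℝ V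
  exact ⟨Module.finBasis ℤ X⟩

theorem repr_sum {X : Submodule ℤ V} {ι : Type*} [Fintype ι] (b : Basis ι ℤ X) (x : X) :
    (x : V) = ∑ i, ((b.repr x i : ℤ) : ℝ) • (b i : V) := by
  conv_lhs => rw [← b.sum_repr x]
  rw [Submodule.coe_sum]
  refine Finset.sum_congr rfl fun i _ => ?_
  rw [Submodule.coe_smul, zsmul_eq]

theorem gdet_basis_eq {X : Submodule ℤ V} {ι κ : Type*} [Fintype ι] [DecidableEq ι] [Fintype κ]
    [DecidableEq κ] (b : Basis ι ℤ X) (c : Basis κ ℤ X) :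
    gdet (fun i => (b i : V)) = gdet (fun i => (c i : V)) := by
  let e := b.indexEquiv c
  rw [← gdet_reindex (fun i => (c i : V)) e]
  set c' := c.reindex e.symm with hc'
  have h1 : ((fun i => (c i : V)) ∘ e) = fun i => (c' i : V) := by
    ext i; simp [hc']
  rw [h1]
  have h2 := gdet_combo (fun i => (c' i : V)) (fun i => (b i : V))
    (Matrix.of fun i j => ((c'.repr (b i) j : ℤ) : ℝ)) (fun i => repr_sum c' (b i))
  rw [h2]
  have h3 : (c'.toMatrix b).det ^ 2 = 1 := by
    have := c'.toMatrix_mul_toMatrix_flip b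
    have h4 : (c'.toMatrix b).det * (b.toMatrix c').det = 1 := by
      rw [← Matrix.det_mul, this, Matrix.det_one]
    rcases Int.eq_one_or_neg_one_of_mul_eq_one h4 with h | h <;> rw [h] <;> norm_num
  have h5 : (Matrix.of fun i j => ((c'.repr (b i) j : ℤ) : ℝ)) =
      ((c'.toMatrix b).transpose).map (Int.castRingHom ℝ) := by
    ext i j; simp [Basis.toMatrix_apply]
  have h6 : (Matrix.of fun i j => ((c'.repr (b i) j : ℤ) : ℝ)).det ^ 2 = 1 := by
    rw [h5]
    have := (RingHom.map_det (Int.castRingHom ℝ) (c'.toMatrix b).transpose)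
    rw [RingHom.mapMatrix_apply] at this
    rw [← this, Matrix.det_transpose, ← map_pow, h3]; simp
  rw [h6, one_mul]

theorem covol_eq {X : Submodule ℤ V} {ι : Type*} [Fintype ι] [DecidableEq ι] (b : Basis ι ℤ X) :
    covol X = Real.sqrt (gdet fun i => (b i : V)) := by
  have h : ∃ n : ℕ, Nonempty (Basis (Fin n) ℤ X) :=
    ⟨_, ⟨b.reindex (Fintype.equivFin ι)⟩⟩
  unfold covol
  rw [dif_pos h, gdet_basis_eq b h.choose_spec.some]
  rfl

theorem covol_nonneg (X : Submodule ℤ V) : 0 ≤ covol X := by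
  unfold covol
  split_ifs
  · exact Real.sqrt_nonneg _
  · exact le_rfl

theorem covol_sq {X : Submodule ℤ V} {ι : Type*} [Fintype ι] [DecidableEq ι] (b : Basis ι ℤ X) :
    covol X ^ 2 = gdet fun i => (b i : V) := by
  rw [covol_eq b, Real.sq_sqrt (gdet_nonneg _)]

theorem rk_eq_card {X : Submodule ℤ V} {ι : Type*} [Fintype ι] (b : Basis ι ℤ X) :
    rk X = Fintype.card ι := finrank_eq_card_basis b

theorem covol_bot : covol (⊥ : Submodule ℤ V) = 1 := by
  rw [covol_eq (Basis.empty (⊥ : Submodule ℤ V) (ι := Fin 0))]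
  simp [gdet]

theorem rk_bot : rk (⊥ : Submodule ℤ V) = 0 := finrank_bot ℤ V

theorem eq_bot_of_rk {X : Submodule ℤ V} (h : X.FG) (h0 : rk X = 0) : X = ⊥ := by
  obtain ⟨b⟩ := exists_basis h
  rw [h0] at b
  rw [eq_bot_iff]
  intro x hx
  have := repr_sum b ⟨x, hx⟩
  simpa using this

theorem rk_mono {X Y : Submodule ℤ V} (hY : Y.FG) (h : X ≤ Y) : rk X ≤ rk Y := by
  haveI : Module.Finite ℤ Y := Module.Finite.iff_fg.2 hY
  exact Submodule.finrank_mono h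

theorem covol_anti {X Y : Submodule ℤ V} (hY : Y.FG) (h : X ≤ Y) (hr : rk X = rk Y) :
    covol Y ≤ covol X := by
  obtain ⟨b⟩ := exists_basis hY
  obtain ⟨c⟩ := exists_basis (hY.of_le h)
  rw [hr] at c
  set A : Matrix (Fin (rk Y)) (Fin (rk Y)) ℤ := Matrix.of fun i j => b.repr ⟨c i, h (c i).2⟩ j
    with hA
  have h2 := gdet_combo (fun i => (b i : V)) (fun i => (c i : V))
    (A.map (Int.castRingHom ℝ)) (fun i => repr_sum b ⟨c i, h (c i).2⟩)
  have hdet : A.det ≠ 0 := by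
    intro h0
    obtain ⟨v, hv, hv0⟩ := Matrix.exists_vecMul_eq_zero_iff.2 h0
    apply hv
    have hli := Fintype.linearIndependent_iff.1 c.linearIndependent v
    ext i
    refine hli ?_ i
    apply Subtype.ext
    have h5 : ∀ i, c i = ∑ j, (A i j) • (⟨b j, (b j).2⟩ : Y).1 := by
      intro i
      rw [repr_sum b ⟨c i, h (c i).2⟩]
      refine Finset.sum_congr rfl fun j _ => ?_
      rw [zsmul_eq]; rfl
    rw [Submodule.coe_sum]
    simp only [Submodule.coe_smul, h5, Finset.smul_sum, smul_smul]
    rw [Finset.sum_comm]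
    simp only [← Finset.sum_smul]
    have h6 : ∀ j, ∑ i, v i * A i j = 0 := fun j => congrFun hv0 j
    simp [h6]
  rw [covol_eq b, covol_eq c]
  apply Real.sqrt_le_sqrt
  rw [h2, ← RingHom.mapMatrix_apply, ← RingHom.map_det, ← map_pow]
  have h7 : (1:ℤ) ≤ A.det ^ 2 := by
    have := sq_pos_of_ne_zero hdet
    omega
  have h8 : (1:ℝ) ≤ Int.castRingHom ℝ (A.det ^ 2) := by
    simp only [eq_intCast]; exact_mod_cast h7
  have := gdet_nonneg (fun i => (b i : V))
  nlinarith

theorem fg_mapZ {X : Submodule ℤ V} (h : X.FG) (T : V →ₗ[ℝ] W) : (mapZ T X).FG :=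
  h.map (T.restrictScalars ℤ)

/-- An adapted basis for `Λ → TΛ`. -/
theorem adapted_basis {Λ : Submodule ℤ V} (h : Λ.FG) (T : V →ₗ[ℝ] W) :
    ∃ (b1 : Basis (Fin (rk (Λ ⊓ kerZ T))) ℤ (Λ ⊓ kerZ T : Submodule ℤ V))
      (b2 : Basis (Fin (rk (mapZ T Λ))) ℤ (mapZ T Λ))
      (b : Basis (Fin (rk (Λ ⊓ kerZ T)) ⊕ Fin (rk (mapZ T Λ))) ℤ Λ),
      (∀ i, (b (Sum.inl i) : V) = b1 i) ∧ ∀ i, T (b (Sum.inr i)) = b2 i := by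
  obtain ⟨b1⟩ := exists_basis (h.of_le (inf_le_left : Λ ⊓ kerZ T ≤ Λ))
  obtain ⟨b2⟩ := exists_basis (fg_mapZ h T)
  have hs : ∀ i, ∃ v : Λ, T v = b2 i := by
    intro i
    obtain ⟨v, hv, e⟩ := (b2 i).2
    exact ⟨⟨v, hv⟩, e⟩
  choose s hs using hs
  let f : Fin (rk (Λ ⊓ kerZ T)) ⊕ Fin (rk (mapZ T Λ)) → Λ :=
    Sum.elim (fun i => ⟨(b1 i : V), (Submodule.mem_inf.1 (b1 i).2).1⟩) s
  have hTf1 : ∀ i, T (b1 i : V) = 0 := fun i => (b1 i).2.2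
  have hli : LinearIndependent ℤ f := by
    rw [Fintype.linearIndependent_iff]
    intro g hg
    have hg' : ∑ i, g (Sum.inl i) • (b1 i : V) + ∑ j, g (Sum.inr j) • (s j : V) = 0 := by
      have := congrArg (Subtype.val) hg
      rw [Submodule.coe_sum, Fintype.sum_sum_type] at this
      exact this
    have h2 : ∀ j, g (Sum.inr j) = 0 := by
      apply Fintype.linearIndependent_iff.1 b2.linearIndependent
      apply Subtype.ext
      have := congrArg T hg'
      rw [Submodule.coe_sum]
      simp only [map_add, map_sum, map_zsmul, hTf1, hs, smul_zero, Finset.sum_const_zero,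
        zero_add, map_zero] at this
      simpa using this
    have h1 : ∀ j, g (Sum.inl j) = 0 := by
      apply Fintype.linearIndependent_iff.1 b1.linearIndependent
      apply Subtype.ext
      rw [Submodule.coe_sum]
      simp only [h2, zero_smul, Finset.sum_const_zero, add_zero] at hg'
      exact hg'
    rintro (i | i)
    · exact h1 i
    · exact h2 i
  have hsp : ⊤ ≤ Submodule.span ℤ (Set.range f) := by
    rintro ⟨x, hx⟩ -
    have h3 := b2.sum_repr ⟨T x, ⟨x, hx, rfl⟩⟩
    set d := b2.repr ⟨T x, ⟨x, hx, rfl⟩⟩ with hd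
    have hy : x - ∑ j, d j • (s j : V) ∈ Λ ⊓ kerZ T := by
      refine ⟨Λ.sub_mem hx (Λ.sum_mem fun j _ => Λ.smul_mem _ (s j).2), ?_⟩
      rw [SetLike.mem_coe, mem_kerZ, map_sub, map_sum]
      have h4 := congrArg Subtype.val h3
      rw [Submodule.coe_sum] at h4
      simp only [map_zsmul, hs]
      simp only [Submodule.coe_smul] at h4
      rw [h4, sub_self]
    have h5 := b1.sum_repr ⟨_, hy⟩
    set c := b1.repr ⟨_, hy⟩ with hc
    have h6 : (⟨x, hx⟩ : Λ) = ∑ i, c i • f (Sum.inl i) + ∑ j, d j • f (Sum.inr j) := by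
      apply Subtype.ext
      have h7 := congrArg Subtype.val h5
      rw [Submodule.coe_sum] at h7
      simp only [Submodule.coe_smul] at h7
      rw [Submodule.coe_add, Submodule.coe_sum, Submodule.coe_sum]
      simp only [Submodule.coe_smul, f, Sum.elim_inl, Sum.elim_inr]
      rw [h7]; abel
    rw [h6]
    refine Submodule.add_mem _ (Submodule.sum_mem _ fun i _ => ?_)
      (Submodule.sum_mem _ fun i _ => ?_)
    · exact Submodule.smul_mem _ _ (Submodule.subset_span ⟨_, rfl⟩)
    · exact Submodule.smul_mem _ _ (Submodule.subset_span ⟨_, rfl⟩)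
  refine ⟨b1, b2, Basis.mk hli hsp, fun i => ?_, fun i => ?_⟩
  · rw [Basis.mk_apply]; rfl
  · rw [Basis.mk_apply]; exact hs i

theorem rk_add {Λ : Submodule ℤ V} (h : Λ.FG) (T : V →ₗ[ℝ] W) :
    rk Λ = rk (Λ ⊓ kerZ T) + rk (mapZ T Λ) := by
  obtain ⟨b1, b2, b, -, -⟩ := adapted_basis h T
  rw [rk_eq_card b]; simp

/-- Lemma A. -/
theorem covol_ge {Λ : Submodule ℤ V} (h : Λ.FG) (T : V →ₗ[ℝ] W) (hT : ∀ v, ‖T v‖ ≤ ‖v‖) :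
    covol (Λ ⊓ kerZ T) * covol (mapZ T Λ) ≤ covol Λ := by
  obtain ⟨b1, b2, b, hb1, hb2⟩ := adapted_basis h T
  rw [covol_eq b1, covol_eq b2, covol_eq b, ← Real.sqrt_mul (gdet_nonneg _)]
  apply Real.sqrt_le_sqrt
  have e : (fun i => (b i : V)) = Sum.elim (fun i => (b1 i : V)) (fun j => (b (Sum.inr j) : V)) := by
    ext (i | i)
    · exact hb1 i
    · rfl
  rw [e]
  apply gdet_schur
  intro c d
  refine le_trans (le_of_eq ?_) (hT _)
  have : ∀ i, T (b1 i : V) = 0 := fun i => (b1 i).2.2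
  simp only [map_add, map_sum, map_smul, hb2, this, smul_zero, Finset.sum_const_zero, zero_add]

theorem covol_ge_scaled {Λ : Submodule ℤ V} (h : Λ.FG) (T : V →ₗ[ℝ] W) (k : ℝ) (hk : 0 < k)
    (hT : ∀ v ∈ Submodule.span ℝ (Λ : Set V), ‖T v‖ ≤ k * ‖v‖) :
    covol (Λ ⊓ kerZ T) * covol (mapZ T Λ) ≤ k ^ rk (mapZ T Λ) * covol Λ := by
  obtain ⟨b1, b2, b, hb1, hb2⟩ := adapted_basis h T
  have e : (fun i => (b i : V)) = Sum.elim (fun i => (b1 i : V)) (fun j => (b (Sum.inr j) : V)) := by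
    ext (i | i)
    · exact hb1 i
    · rfl
  have hsc := gdet_combo (fun i => (b2 i : W)) (fun i => k⁻¹ • (b2 i : W)) (k⁻¹ • 1)
    (fun i => by simp [Matrix.one_apply])
  have h1 := gdet_schur (fun i => (b1 i : V)) (fun j => (b (Sum.inr j) : V))
    (fun i => k⁻¹ • (b2 i : W)) (by
      intro c d
      have hm : ∑ i, c i • (b1 i : V) + ∑ j, d j • (b (Sum.inr j) : V) ∈
          Submodule.span ℝ (Λ : Set V) := by
        refine Submodule.add_mem _ (Submodule.sum_mem _ fun i _ => ?_)
          (Submodule.sum_mem _ fun i _ => ?_)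
        · exact Submodule.smul_mem _ _ (Submodule.subset_span (b1 i).2.1)
        · exact Submodule.smul_mem _ _ (Submodule.subset_span (b _).2)
      have h2 := hT _ hm
      have : ∀ i, T (b1 i : V) = 0 := fun i => (b1 i).2.2
      simp only [map_add, map_sum, map_smul, this, hb2, smul_zero, Finset.sum_const_zero,
        zero_add] at h2
      have h3 : ∑ j, d j • k⁻¹ • (b2 j : W) = k⁻¹ • ∑ j, d j • (b2 j : W) := by
        rw [Finset.smul_sum]
        exact Finset.sum_congr rfl fun j _ => smul_comm _ _ _
      rw [h3, norm_smul, norm_inv, Real.norm_of_nonneg hk.le, inv_mul_le_iff₀ hk]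
      exact h2)
  rw [← e, hsc, ← covol_sq b1, ← covol_sq b2, ← covol_sq b] at h1
  have hd : (k⁻¹ • (1 : Matrix (Fin (rk (mapZ T Λ))) (Fin (rk (mapZ T Λ))) ℝ)).det =
      (k ^ rk (mapZ T Λ))⁻¹ := by
    rw [Matrix.det_smul]; simp
  rw [hd] at h1
  have hkp : 0 < k ^ rk (mapZ T Λ) := pow_pos hk _
  have h4 : (covol (Λ ⊓ kerZ T) * covol (mapZ T Λ)) ^ 2 ≤ (k ^ rk (mapZ T Λ) * covol Λ) ^ 2 := by
    have h5 : covol (Λ ⊓ kerZ T) ^ 2 * (((k ^ rk (mapZ T Λ))⁻¹) ^ 2 * covol (mapZ T Λ) ^ 2) =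
      (covol (Λ ⊓ kerZ T) * covol (mapZ T Λ)) ^ 2 / (k ^ rk (mapZ T Λ)) ^ 2 := by
      field_simp
    rw [h5, div_le_iff₀ (by positivity)] at h1
    linarith [mul_pow (k ^ rk (mapZ T Λ)) (covol Λ) 2]
  exact (sq_le_sq₀ (mul_nonneg (covol_nonneg _) (covol_nonneg _))
    (mul_nonneg hkp.le (covol_nonneg _))).1 h4

/-- Basis of an injective image. -/
theorem map_basis {X : Submodule ℤ V} {ι : Type*} [Fintype ι] (b : Basis ι ℤ X) (T : V →ₗ[ℝ] W)
    (hT : ∀ x ∈ X, T x = 0 → x = 0) :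
    ∃ c : Basis ι ℤ (mapZ T X), ∀ i, (c i : W) = T (b i) := by
  let f : X →ₗ[ℤ] mapZ T X := (T.restrictScalars ℤ).submoduleMap X
  have hf : Function.Bijective f := by
    constructor
    · rw [injective_iff_map_eq_zero]
      rintro ⟨x, hx⟩ h
      apply Subtype.ext
      exact hT x hx (congrArg Subtype.val h)
    · exact LinearMap.submoduleMap_surjective _ _
  exact ⟨b.map (LinearEquiv.ofBijective f hf), fun i => by
    simp only [Basis.map_apply]; rfl⟩

theorem rk_map {X : Submodule ℤ V} (h : X.FG) (T : V →ₗ[ℝ] W)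
    (hT : ∀ x ∈ X, T x = 0 → x = 0) : rk (mapZ T X) = rk X := by
  obtain ⟨b⟩ := exists_basis h
  obtain ⟨c, -⟩ := map_basis b T hT
  rw [rk_eq_card c]; simp

theorem covol_map {X : Submodule ℤ V} (h : X.FG) (T : V →ₗ[ℝ] W) (k : ℝ) (hk : 0 < k)
    (hT : ∀ x ∈ X, ∀ y ∈ X, inner ℝ (T x) (T y) = k ^ 2 * (inner ℝ x y : ℝ)) :
    covol (mapZ T X) = k ^ rk X * covol X := by
  obtain ⟨b⟩ := exists_basis h
  obtain ⟨c, hc⟩ := map_basis b T (fun x hx h0 => by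
    have := hT x hx x hx
    rw [h0, inner_zero_left] at this
    have h2 : inner ℝ x x = (0:ℝ) := by
      have := (mul_eq_zero.1 this.symm).resolve_left (by positivity)
      exact this
    exact inner_self_eq_zero.1 h2)
  have hg : gdet (fun i => (c i : W)) = (k ^ rk X) ^ 2 * gdet (fun i => (b i : V)) := by
    have : Matrix.gram ℝ (fun i => (c i : W)) = k ^ 2 • Matrix.gram ℝ (fun i => (b i : V)) := by
      ext i j
      simp only [Matrix.gram_apply, hc, Matrix.smul_apply, smul_eq_mul]
      exact hT _ (b i).2 _ (b j).2
    rw [gdet, this, Matrix.det_smul, gdet]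
    simp [← pow_mul, mul_comm]
  rw [covol_eq c, hg, Real.sqrt_mul (by positivity), Real.sqrt_sq (by positivity), covol_eq b]

theorem span_basis {ι : Type*} [Fintype ι] {v : ι → V} (h : LinearIndependent ℤ v) :
    ∃ b : Basis ι ℤ (Submodule.span ℤ (Set.range v)), ∀ i, (b i : V) = v i :=
  ⟨Basis.span h, fun i => congrArg Subtype.val (Basis.span_apply h i)⟩

theorem linInd_int {ι : Type*} {v : ι → V} (h : LinearIndependent ℝ v) :
    LinearIndependent ℤ v := h.restrict_scalars (by
      intro a b hab
      simpa using hab)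

theorem covol_span {ι : Type*} [Fintype ι] [DecidableEq ι] {v : ι → V}
    (h : LinearIndependent ℤ v) :
    covol (Submodule.span ℤ (Set.range v)) = Real.sqrt (gdet v) := by
  obtain ⟨b, hb⟩ := span_basis h
  rw [covol_eq b]
  simp only [hb]

theorem rk_span {ι : Type*} [Fintype ι] {v : ι → V} (h : LinearIndependent ℤ v) :
    rk (Submodule.span ℤ (Set.range v)) = Fintype.card ι := by
  obtain ⟨b, hb⟩ := span_basis h
  rw [rk_eq_card b]

theorem covol_singleton {w : V} (hw : w ≠ 0) : covol (Submodule.span ℤ {w}) = ‖w‖ := by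
  have hli : LinearIndependent ℤ (fun _ : Fin 1 => w) :=
    linInd_int (linearIndependent_unique_iff.2 hw)
  have := covol_span hli
  rw [Set.range_const] at this
  rw [this, gdet]
  simp [Matrix.gram_apply, real_inner_self_eq_norm_sq]

theorem rk_singleton {w : V} (hw : w ≠ 0) : rk (Submodule.span ℤ {w}) = 1 := by
  have hli : LinearIndependent ℤ (fun _ : Fin 1 => w) :=
    linInd_int (linearIndependent_unique_iff.2 hw)
  have := rk_span hli
  rw [Set.range_const] at this
  simpa using this

/-! ### Gap condition -/

/-- Discreteness. -/
def Gap (X : Submodule ℤ V) : Prop := ∃ ε : ℝ, 0 < ε ∧ ∀ v ∈ X, v ≠ 0 → ε ≤ ‖v‖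

theorem Gap.mono {X Y : Submodule ℤ V} (h : Gap Y) (hXY : X ≤ Y) : Gap X := by
  obtain ⟨ε, h0, h1⟩ := h
  exact ⟨ε, h0, fun v hv => h1 v (hXY hv)⟩

theorem Gap.disc {X : Submodule ℤ V} (h : Gap X) : DiscreteTopology X := by
  obtain ⟨ε, h0, h1⟩ := h
  refine DiscreteTopology.of_forall_le_dist h0 ?_
  intro x y hxy
  rw [dist_eq_norm]
  have := h1 _ (X.sub_mem x.2 y.2) (by
    intro h
    exact hxy (Subtype.ext (sub_eq_zero.1 h)))
  simpa using this

theorem gap_of_disc {X : Submodule ℤ V} (h : DiscreteTopology X) : Gap X := by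
  have h0 : IsOpen ({0} : Set X) := isOpen_discrete _
  obtain ⟨ε, hε, hb⟩ := Metric.isOpen_iff.1 h0 0 rfl
  refine ⟨ε, hε, fun v hv hne => ?_⟩
  by_contra hlt
  push Not at hlt
  have : (⟨v, hv⟩ : X) ∈ Metric.ball (0 : X) ε := by
    rw [mem_ball_zero_iff]; exact hlt
  have := hb this
  exact hne (congrArg Subtype.val this)

variable [FiniteDimensional ℝ V]

theorem Gap.fg {X : Submodule ℤ V} (h : Gap X) : X.FG := by
  haveI := h.disc
  exact Module.Finite.iff_fg.1 inferInstance

theorem Gap.rk_eq {X : Submodule ℤ V} (h : Gap X) :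
    rk X = finrank ℝ (Submodule.span ℝ (X : Set V)) := by
  have h1 : DiscreteTopology (Submodule.span ℤ (X : Set V)) := by
    rw [Submodule.span_eq]; exact h.disc
  have := Real.finrank_eq_int_finrank_of_discrete h1
  unfold Set.finrank at this
  rw [this, Submodule.span_eq]

theorem Gap.linInd {X : Submodule ℤ V} (h : Gap X) {ι : Type*} [Fintype ι] (b : Basis ι ℤ X) :
    LinearIndependent ℝ (fun i => (b i : V)) := by
  rw [linearIndependent_iff_card_eq_finrank_span, ← rk_eq_card b, h.rk_eq, Set.finrank]
  suffices he : Submodule.span ℝ (X : Set V) = Submodule.span ℝ (Set.range fun i => (b i : V)) by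
    rw [he]
  apply le_antisymm
  · rw [Submodule.span_le]
    intro x hx
    have e : x = _ := repr_sum b ⟨x, hx⟩
    rw [SetLike.mem_coe, e]
    exact Submodule.sum_mem _ fun i _ => Submodule.smul_mem _ _ (Submodule.subset_span ⟨i, rfl⟩)
  · apply Submodule.span_mono
    rintro _ ⟨i, rfl⟩
    exact (b i).2

theorem Gap.covol_pos {X : Submodule ℤ V} (h : Gap X) : 0 < covol X := by
  obtain ⟨b⟩ := exists_basis h.fg
  rw [covol_eq b]
  exact Real.sqrt_pos.2 (gdet_pos (h.linInd b))

theorem gap_span {ι : Type*} [Fintype ι] {v : ι → V} (h : LinearIndependent ℝ v) :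
    Gap (Submodule.span ℤ (Set.range v)) := by
  let S := Submodule.span ℝ (Set.range v)
  let b : Basis ι ℝ S := Basis.span h
  have hd : DiscreteTopology (Submodule.span ℤ (Set.range b)) := inferInstance
  obtain ⟨ε, h0, h1⟩ := gap_of_disc hd
  refine ⟨ε, h0, fun w hw hne => ?_⟩
  have hm : Submodule.span ℤ (Set.range v) =
      mapZ S.subtype (Submodule.span ℤ (Set.range b)) := by
    rw [mapZ, Submodule.map_span, ← Set.range_comp]
    congr 2
    ext i
    exact (congrArg Subtype.val (Basis.span_apply h i)).symm
  rw [hm] at hw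
  obtain ⟨u, hu, rfl⟩ := hw
  have := h1 u hu (by rintro rfl; simp at hne)
  exact this

theorem Gap.finite {X : Submodule ℤ V} (h : Gap X) (r : ℝ) : {v | v ∈ X ∧ ‖v‖ ≤ r}.Finite := by
  haveI := h.disc
  haveI : DiscreteTopology (X : Set V) := h.disc
  have : IsClosed (X : Set V) := by
    haveI : DiscreteTopology X.toAddSubgroup := h.disc
    exact AddSubgroup.isClosed_of_discrete (H := X.toAddSubgroup)
  refine ((Metric.finite_isBounded_inter_isClosed DiscreteTopology.isDiscrete
    (Metric.isBounded_closedBall (x := (0:V)) (r := r)) this)).subset ?_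
  rintro v ⟨hv, hr⟩
  exact ⟨by simpa using hr, hv⟩

/-- Shortest vectors exist. -/
theorem Gap.exists_shortest {X : Submodule ℤ V} (h : Gap X) (hX : X ≠ ⊥) :
    ∃ w ∈ X, w ≠ 0 ∧ ∀ v ∈ X, v ≠ 0 → ‖w‖ ≤ ‖v‖ := by
  obtain ⟨x, hx, hx0⟩ := X.ne_bot_iff.1 hX
  have hf := h.finite ‖x‖
  have hf2 : {v | (v ∈ X ∧ ‖v‖ ≤ ‖x‖) ∧ v ≠ 0}.Finite := hf.subset fun v hv => hv.1
  obtain ⟨w, hw, hmin⟩ := Set.exists_min_image _ (fun v => ‖v‖) hf2 ⟨x, ⟨hx, le_rfl⟩, hx0⟩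
  refine ⟨w, hw.1.1, hw.2, fun v hv hv0 => ?_⟩
  by_cases hle : ‖v‖ ≤ ‖x‖
  · exact hmin v ⟨⟨hv, hle⟩, hv0⟩
  · exact hw.1.2.trans (not_le.1 hle).le

end P2

section P3
variable {V W : Type*} [NormedAddCommGroup V] [InnerProductSpace ℝ V]
  [NormedAddCommGroup W] [InnerProductSpace ℝ W]

/-- All sublattices have covolume at least `c ^ rank`. -/
def PP (X : Submodule ℤ V) (c : ℝ) : Prop := ∀ Y ≤ X, c ^ rk Y ≤ covol Y

theorem Hmin_nonneg (L : Submodule ℤ V) : 0 ≤ Hmin L := by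
  apply Real.sInf_nonneg
  rintro _ ⟨F, -, -, rfl⟩
  exact Real.rpow_nonneg (covol_nonneg _) _

theorem covol_latIn [FiniteDimensional ℝ V] {L : Submodule ℤ V} (hL : Gap L)
    (F : Submodule ℝ V) :
    covol (latIn L F) = covol (L ⊓ F.restrictScalars ℤ) ∧
    rk (latIn L F) = rk (L ⊓ F.restrictScalars ℤ) := by
  have hg : Gap (latIn L F) := by
    obtain ⟨ε, h0, h1⟩ := hL
    refine ⟨ε, h0, fun v hv hne => h1 v hv ?_⟩
    simpa using hne
  have e : mapZ F.subtype (latIn L F) = L ⊓ F.restrictScalars ℤ := by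
    ext x
    rw [mem_mapZ]
    constructor
    · rintro ⟨v, hv, rfl⟩
      exact ⟨hv, v.2⟩
    · rintro ⟨h1, h2⟩
      exact ⟨⟨x, h2⟩, h1, rfl⟩
  constructor
  · have := covol_map hg.fg F.subtype 1 one_pos (by intro x _ y _; simp)
    rw [← e, this]; simp
  · rw [← e, rk_map hg.fg F.subtype (by intro x _ h; simpa using h)]

theorem rk_rational [FiniteDimensional ℝ V] {L : Submodule ℤ V} (hL : Gap L)
    (F : Submodule ℝ V) (hF : IsRational L F) :
    rk (L ⊓ F.restrictScalars ℤ) = finrank ℝ F := by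
  rw [(hL.mono inf_le_left).rk_eq]
  have : Submodule.span ℝ ((L ⊓ F.restrictScalars ℤ : Submodule ℤ V) : Set V) = F := hF
  rw [this]

theorem PP_Hmin [FiniteDimensional ℝ V] {L : Submodule ℤ V} (hL : Gap L) : PP L (Hmin L) := by
  intro Y hY
  by_cases hb : Y = ⊥
  · rw [hb, rk_bot, covol_bot, pow_zero]
  set S := Submodule.span ℝ (Y : Set V) with hS
  have hYS : Y ≤ S.restrictScalars ℤ := fun y hy => Submodule.subset_span hy
  have hrat : IsRational L S := by
    apply le_antisymm
    · rw [Submodule.span_le]; exact fun x hx => hx.2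
    · rw [hS]
      apply Submodule.span_mono
      exact fun y hy => ⟨hY hy, hYS hy⟩
  have hS0 : S ≠ ⊥ := by
    intro h
    apply hb
    rw [eq_bot_iff]
    intro y hy
    have := hYS hy
    rw [h] at this
    exact this
  have hle : Hmin L ≤ Hr L S := by
    apply csInf_le
    · refine ⟨0, ?_⟩
      rintro _ ⟨F, -, -, rfl⟩
      exact Real.rpow_nonneg (covol_nonneg _) _
    · exact ⟨S, hS0, hrat, rfl⟩
  have hr : rk Y = finrank ℝ S := (hL.mono hY).rk_eq
  have hpos : (finrank ℝ S : ℝ) ≠ 0 := by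
    have : 0 < finrank ℝ S := by
      rw [Nat.pos_iff_ne_zero, Ne, Submodule.finrank_eq_zero]; exact hS0
    positivity
  have h2 : Hmin L ^ finrank ℝ S ≤ covol (L ⊓ S.restrictScalars ℤ) := by
    refine (pow_le_pow_left₀ (Hmin_nonneg L) hle _).trans ?_
    unfold Hr redH
    rw [← Real.rpow_natCast, ← Real.rpow_mul (covol_nonneg _), inv_mul_cancel₀ hpos,
      Real.rpow_one, (covol_latIn hL S).1]
  rw [hr]
  refine h2.trans (covol_anti (hL.mono inf_le_left).fg (le_inf hY hYS) ?_)
  rw [hr, rk_rational hL S hrat]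

theorem le_Hr [FiniteDimensional ℝ V] {L : Submodule ℤ V} (hL : Gap L) {c : ℝ} (hc : 0 ≤ c)
    (h : PP L c) (F : Submodule ℝ V) (hF0 : F ≠ ⊥) (hF : IsRational L F) : c ≤ Hr L F := by
  have h1 := h (L ⊓ F.restrictScalars ℤ) inf_le_left
  rw [rk_rational hL F hF, ← (covol_latIn hL F).1] at h1
  have hpos : 0 < finrank ℝ F := by
    rw [Nat.pos_iff_ne_zero, Ne, Submodule.finrank_eq_zero]; exact hF0
  unfold Hr redH
  have h2 := Real.rpow_le_rpow (pow_nonneg hc _) h1 (z := (finrank ℝ F : ℝ)⁻¹) (by positivity)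
  rwa [Real.pow_rpow_inv_natCast hc hpos.ne'] at h2

theorem le_Hmin [FiniteDimensional ℝ V] {L : Submodule ℤ V} (hL : Gap L)
    (hsp : Submodule.span ℝ (L : Set V) = ⊤) (hn : finrank ℝ V ≠ 0) {c : ℝ} (hc : 0 ≤ c)
    (h : PP L c) : c ≤ Hmin L := by
  apply le_csInf
  · refine ⟨_, ⊤, ?_, ?_, rfl⟩
    · intro h0
      apply hn
      rw [← finrank_top, h0, finrank_bot]
    · unfold IsRational
      simpa using hsp
  · rintro _ ⟨F, hF0, hF, rfl⟩
    exact le_Hr hL hc h F hF0 hF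

theorem Hmin_zero [FiniteDimensional ℝ V] (L : Submodule ℤ V) (hn : finrank ℝ V = 0) :
    Hmin L = 0 := by
  unfold Hmin
  convert Real.sInf_empty
  ext x
  simp only [Set.mem_setOf_eq, Set.mem_empty_iff_false, iff_false]
  rintro ⟨F, hF, -, -⟩
  apply hF
  haveI := Module.finrank_zero_iff.1 hn
  exact Subsingleton.elim _ _

/-! ### Projection off a vector -/

/-- Orthogonal projection onto the complement of `w`. -/
def pw (w : V) : V →ₗ[ℝ] V :=
  LinearMap.id - ((‖w‖ ^ 2)⁻¹ • (innerₛₗ ℝ w)).smulRight w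

theorem pw_apply (w v : V) : pw w v = v - ((inner ℝ w v : ℝ) / ‖w‖ ^ 2) • w := by
  simp [pw, div_eq_inv_mul]

theorem pw_inner {w : V} (hw : w ≠ 0) (v : V) : inner ℝ w (pw w v) = (0:ℝ) := by
  rw [pw_apply, inner_sub_right, real_inner_smul_right, real_inner_self_eq_norm_sq]
  have : ‖w‖ ^ 2 ≠ 0 := by positivity
  field_simp
  ring

theorem pw_self {w : V} (hw : w ≠ 0) : pw w w = 0 := by
  rw [pw_apply, real_inner_self_eq_norm_sq, div_self (by positivity), one_smul, sub_self]

theorem pw_norm {w : V} (hw : w ≠ 0) (v : V) :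
    ‖v‖ ^ 2 = ‖pw w v‖ ^ 2 + (inner ℝ w v : ℝ) ^ 2 / ‖w‖ ^ 2 := by
  have h1 : v = pw w v + ((inner ℝ w v : ℝ) / ‖w‖ ^ 2) • w := by rw [pw_apply]; abel
  have h2 : ‖w‖ ≠ 0 := by positivity
  have h3 := norm_add_sq_real (pw w v) (((inner ℝ w v : ℝ) / ‖w‖ ^ 2) • w)
  rw [← h1, real_inner_smul_right, real_inner_comm w (pw w v), pw_inner hw, norm_smul, mul_pow,
    Real.norm_eq_abs, sq_abs] at h3
  rw [h3]
  field_simp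
  ring

theorem pw_norm_le (w v : V) : ‖pw w v‖ ≤ ‖v‖ := by
  by_cases hw : w = 0
  · subst hw
    rw [pw_apply]; simp
  have := pw_norm hw v
  have h2 : 0 ≤ (inner ℝ w v : ℝ) ^ 2 / ‖w‖ ^ 2 := by positivity
  exact (sq_le_sq₀ (norm_nonneg _) (norm_nonneg _)).1 (by linarith)

theorem pw_eq_zero {w v : V} (h : pw w v = 0) : ∃ c : ℝ, v = c • w :=
  ⟨_, sub_eq_zero.1 ((pw_apply w v).symm.trans h)⟩

theorem pw_smul {w : V} (hw : w ≠ 0) (c : ℝ) : pw w (c • w) = 0 := by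
  rw [map_smul, pw_self hw, smul_zero]

/-- Primitive vectors. -/
def Prim (X : Submodule ℤ V) (w : V) : Prop :=
  w ∈ X ∧ w ≠ 0 ∧ ∀ c : ℝ, c • w ∈ X → ∃ n : ℤ, c = n

theorem Prim.inf_ker {X : Submodule ℤ V} {w : V} (h : Prim X w) :
    X ⊓ kerZ (pw w) = Submodule.span ℤ {w} := by
  apply le_antisymm
  · rintro v ⟨hv, hk⟩
    obtain ⟨c, rfl⟩ := pw_eq_zero hk
    obtain ⟨n, rfl⟩ := h.2.2 c hv
    rw [← zsmul_eq]
    exact Submodule.smul_mem _ _ (Submodule.subset_span rfl)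
  · rw [Submodule.span_le, Set.singleton_subset_iff]
    exact ⟨h.1, pw_self h.2.1⟩

theorem prim_of_shortest {X : Submodule ℤ V} {w : V} (hw : w ∈ X) (h0 : w ≠ 0)
    (h : ∀ v ∈ X, v ≠ 0 → ‖w‖ ≤ ‖v‖) : Prim X w := by
  refine ⟨hw, h0, fun c hc => ⟨round c, ?_⟩⟩
  by_contra hne
  have h1 : (c - round c) • w ∈ X := by
    rw [sub_smul, ← zsmul_eq]
    exact X.sub_mem hc (X.smul_mem _ hw)
  have h2 := h _ h1 (smul_ne_zero (sub_ne_zero.2 hne) h0)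
  rw [norm_smul, Real.norm_eq_abs] at h2
  have h3 := abs_sub_round c
  have h4 : 0 < ‖w‖ := norm_pos_iff.2 h0
  nlinarith

theorem exists_prim [FiniteDimensional ℝ V] {X : Submodule ℤ V} (hX : Gap X) {w : V} (hw : w ∈ X)
    (h0 : w ≠ 0) : ∃ u, Prim X u ∧ ∃ n : ℤ, n ≠ 0 ∧ w = n • u := by
  have hg : Gap (X ⊓ kerZ (pw w)) := hX.mono inf_le_left
  have hw' : w ∈ X ⊓ kerZ (pw w) := ⟨hw, pw_self h0⟩
  obtain ⟨u, hu, hu0, hs⟩ := hg.exists_shortest (fun h => h0 (by rw [h] at hw'; exact hw'))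
  obtain ⟨c, hc⟩ := pw_eq_zero hu.2
  have hc0 : c ≠ 0 := by rintro rfl; rw [zero_smul] at hc; exact hu0 hc
  have hp := prim_of_shortest hu hu0 hs
  have hp2 : Prim X u := by
    refine ⟨hu.1, hu0, fun d hd => hp.2.2 d ⟨hd, ?_⟩⟩
    rw [hc, smul_smul]; exact pw_smul h0 _
  have hwu : w = c⁻¹ • u := by rw [hc, smul_smul, inv_mul_cancel₀ hc0, one_smul]
  obtain ⟨n, hn⟩ := hp2.2.2 c⁻¹ (hwu ▸ hw)
  refine ⟨u, hp2, n, ?_, ?_⟩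
  · rintro rfl
    rw [Int.cast_zero] at hn
    exact inv_ne_zero hc0 hn
  · rw [zsmul_eq, ← hn]; exact hwu

theorem pw_lift {X : Submodule ℤ V} {w : V} (hw : w ∈ X) (h0 : w ≠ 0) {n : V}
    (hn : n ∈ mapZ (pw w) X) : ∃ v ∈ X, pw w v = n ∧ ‖v‖ ^ 2 ≤ ‖n‖ ^ 2 + ‖w‖ ^ 2 / 4 := by
  obtain ⟨v, hv, rfl⟩ := hn
  set c := (inner ℝ w v : ℝ) / ‖w‖ ^ 2 with hc
  refine ⟨v - (round c) • w, X.sub_mem hv (X.smul_mem _ hw), ?_, ?_⟩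
  · rw [map_sub, map_zsmul, pw_self h0, smul_zero, sub_zero]; rfl
  · have h1 := pw_norm h0 (v - (round c) • w)
    rw [map_sub, map_zsmul, pw_self h0, smul_zero, sub_zero] at h1
    rw [h1]
    change _ ≤ ‖pw w v‖ ^ 2 + _
    have hw2 : (0:ℝ) < ‖w‖ ^ 2 := by positivity
    have h2 : (inner ℝ w (v - (round c) • w) : ℝ) = (c - round c) * ‖w‖ ^ 2 := by
      rw [inner_sub_right, zsmul_eq, real_inner_smul_right, real_inner_self_eq_norm_sq, hc]
      field_simp
    rw [h2]
    have h3 := abs_sub_round c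
    have h4 : (c - round c) ^ 2 ≤ 1 / 4 := by
      rw [← sq_abs]
      nlinarith [abs_nonneg (c - round c)]
    have h5 : ((c - round c) * ‖w‖ ^ 2) ^ 2 / ‖w‖ ^ 2 = (c - round c) ^ 2 * ‖w‖ ^ 2 := by
      field_simp
    rw [h5]
    nlinarith

theorem pw_gap {X : Submodule ℤ V} {w : V} (hw : w ∈ X) (h0 : w ≠ 0)
    (h : ∀ v ∈ X, v ≠ 0 → ‖w‖ ≤ ‖v‖) :
    ∀ n ∈ mapZ (pw w) X, n ≠ 0 → 3 / 4 * ‖w‖ ^ 2 ≤ ‖n‖ ^ 2 := by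
  intro n hn hn0
  obtain ⟨v, hv, rfl, hle⟩ := pw_lift hw h0 hn
  have h1 := h v hv (by rintro rfl; exact hn0 (map_zero _))
  have := pow_le_pow_left₀ (norm_nonneg _) h1 2
  linarith

theorem gap_of_sq {X : Submodule ℤ V} {m : ℝ} (hm : 0 < m)
    (h : ∀ n ∈ X, n ≠ 0 → m ≤ ‖n‖ ^ 2) : Gap X :=
  ⟨Real.sqrt m, Real.sqrt_pos.2 hm, fun v hv hne =>
    Real.sqrt_le_iff.2 ⟨norm_nonneg _, h v hv hne⟩⟩

theorem covol_ge_prim {X : Submodule ℤ V} (hX : X.FG) {w : V} (h : Prim X w) :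
    ‖w‖ * covol (mapZ (pw w) X) ≤ covol X := by
  have := covol_ge hX (pw w) (pw_norm_le w)
  rwa [h.inf_ker, covol_singleton h.2.1] at this

theorem rk_prim {X : Submodule ℤ V} (hX : X.FG) {w : V} (h : Prim X w) :
    rk X = 1 + rk (mapZ (pw w) X) := by
  have := rk_add hX (pw w)
  rwa [h.inf_ker, rk_singleton h.2.1] at this

/-- Hermite's bound. -/
theorem hermite [FiniteDimensional ℝ V] (r : ℕ) : ∀ (X : Submodule ℤ V), Gap X → rk X = r →
    ∀ m : ℝ, 0 ≤ m → (∀ v ∈ X, v ≠ 0 → m ≤ ‖v‖ ^ 2) →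
    m ^ r * (3 / 4 : ℝ) ^ (r.choose 2) ≤ covol X ^ 2 := by
  induction r with
  | zero =>
    intro X hX hr m hm h
    rw [eq_bot_of_rk hX.fg hr, covol_bot]; simp
  | succ r ih =>
    intro X hX hr m hm h
    have hX0 : X ≠ ⊥ := by rintro rfl; rw [rk_bot] at hr; omega
    obtain ⟨w, hw, h0, hs⟩ := hX.exists_shortest hX0
    have hp := prim_of_shortest hw h0 hs
    have hg := pw_gap hw h0 hs
    have h34 : 0 < 3 / 4 * ‖w‖ ^ 2 := by positivity
    have hrk := rk_prim hX.fg hp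
    have h1 := ih (mapZ (pw w) X) (gap_of_sq h34 hg) (by omega) _ h34.le hg
    have h2 := covol_ge_prim hX.fg hp
    have h3 : (‖w‖ * covol (mapZ (pw w) X)) ^ 2 ≤ covol X ^ 2 :=
      pow_le_pow_left₀ (mul_nonneg (norm_nonneg _) (covol_nonneg _)) h2 2
    have h4 : m ^ (r+1) ≤ (‖w‖ ^ 2) ^ (r + 1) := pow_le_pow_left₀ hm (h w hw h0) _
    have hch : (r + 1).choose 2 = r + r.choose 2 := by
      rw [Nat.choose_succ_succ' r 1, Nat.choose_one_right]
    calc m ^ (r+1) * (3 / 4 : ℝ) ^ ((r+1).choose 2)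
        ≤ (‖w‖ ^ 2) ^ (r + 1) * (3 / 4 : ℝ) ^ ((r+1).choose 2) := by gcongr
      _ = ‖w‖ ^ 2 * ((3 / 4 * ‖w‖ ^ 2) ^ r * (3 / 4 : ℝ) ^ (r.choose 2)) := by
          rw [hch, pow_add, mul_pow, pow_succ]; ring
      _ ≤ ‖w‖ ^ 2 * covol (mapZ (pw w) X) ^ 2 := by gcongr
      _ ≤ covol X ^ 2 := by rw [← mul_pow]; exact h3

end P3

section P4
variable {V W : Type*} [NormedAddCommGroup V] [InnerProductSpace ℝ V]
  [NormedAddCommGroup W] [InnerProductSpace ℝ W]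

/-! ### Orthogonal unimodular structures -/

theorem detZ_le {ι : Type*} [Fintype ι] [DecidableEq ι] (v : ι → V) (T : V →ₗ[ℝ] V)
    (hT : ∀ x y, inner ℝ (T x) (T y) = (inner ℝ x y : ℝ)) :
    (Matrix.of fun i j => (inner ℝ (T (v i)) (v j) : ℝ)).det ^ 2 ≤ gdet v ^ 2 := by
  set Z : Matrix ι ι ℝ := Matrix.of fun i j => (inner ℝ (T (v i)) (v j) : ℝ) with hZ
  by_cases hli : LinearIndependent ℝ v
  · have h0 : gdet v ≠ 0 := (gdet_pos hli).ne'
    have hA : (Matrix.gram ℝ v).PosDef := Matrix.posDef_gram_of_linearIndependent hli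
    have : Invertible (Matrix.gram ℝ v) := Matrix.invertibleOfIsUnitDet _ (Ne.isUnit h0)
    set A := Matrix.gram ℝ v
    have hg : Matrix.gram ℝ (Sum.elim v (fun i => T (v i))) =
        Matrix.fromBlocks A Z.conjTranspose Z.conjTranspose.conjTranspose A := by
      ext i j
      rcases i with i | i <;> rcases j with j | j
      · rfl
      · simp [Z, Matrix.gram_apply, real_inner_comm]
      · simp [Z, Matrix.gram_apply]
      · simp [A, Matrix.gram_apply, hT]
    have hpsd := Matrix.posSemidef_gram ℝ (Sum.elim v (fun i => T (v i)))
    rw [hg, Matrix.PosDef.fromBlocks₁₁ _ _ hA, Matrix.conjTranspose_conjTranspose] at hpsd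
    have h1 : (Z * A⁻¹ * Z.conjTranspose).PosSemidef :=
      hA.inv.posSemidef.mul_mul_conjTranspose_same Z
    have h2 := det_mono _ _ h1 hpsd
    rw [Matrix.det_mul, Matrix.det_mul, Matrix.det_conjTranspose, Matrix.det_nonsing_inv,
      Ring.inverse_eq_inv', star_trivial] at h2
    have hpos : 0 < A.det := gdet_pos hli
    have h3 : Z.det ^ 2 / A.det ≤ A.det := by
      refine le_trans (le_of_eq ?_) h2
      field_simp
    rw [div_le_iff₀ hpos] at h3
    calc _ ≤ _ := h3
      _ = gdet v ^ 2 := by rw [sq]; rfl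
  · obtain ⟨g, hg, i, hi⟩ := Fintype.not_linearIndependent_iff.1 hli
    have : Z.det = 0 := by
      apply Matrix.exists_mulVec_eq_zero_iff.1
      refine ⟨g, fun h => hi (congrFun h i), ?_⟩
      ext k
      have : inner ℝ (T (v k)) (∑ j, g j • v j) = (0:ℝ) := by rw [hg, inner_zero_right]
      rw [inner_sum] at this
      simp only [real_inner_smul_right] at this
      simp only [Matrix.mulVec, dotProduct, hZ, Matrix.of_apply, Pi.zero_apply]
      rw [← this]
      exact Finset.sum_congr rfl fun j _ => mul_comm _ _
    rw [this]; nlinarith [sq_nonneg (gdet v)]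

/-- The form is integral on `X`. -/
def Integral (T : V →ₗ[ℝ] V) (X : Submodule ℤ V) : Prop :=
  ∀ x ∈ X, ∀ y ∈ X, ∃ n : ℤ, (inner ℝ (T x) y : ℝ) = n

/-- Isotropic submodules. -/
def Iso (T : V →ₗ[ℝ] V) (X : Submodule ℤ V) : Prop :=
  ∀ x ∈ X, ∀ y ∈ X, (inner ℝ (T x) y : ℝ) = 0

/-- The radical. -/
def radical (T : V →ₗ[ℝ] V) (N : Submodule ℤ V) : Submodule ℤ V where
  carrier := {v | v ∈ N ∧ ∀ n ∈ N, (inner ℝ (T v) n : ℝ) = 0}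
  zero_mem' := ⟨N.zero_mem, fun n _ => by simp⟩
  add_mem' := by
    rintro a b ⟨ha, ha'⟩ ⟨hb, hb'⟩
    exact ⟨N.add_mem ha hb, fun n hn => by
      rw [map_add, inner_add_left, ha' n hn, hb' n hn, add_zero]⟩
  smul_mem' := by
    rintro z a ⟨ha, ha'⟩
    exact ⟨N.smul_mem z ha, fun n hn => by
      rw [map_zsmul, zsmul_eq, real_inner_smul_left, ha' n hn, mul_zero]⟩

theorem radical_le (T : V →ₗ[ℝ] V) (N : Submodule ℤ V) : radical T N ≤ N := fun v hv => hv.1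

theorem radical_iso (T : V →ₗ[ℝ] V) (N : Submodule ℤ V) : Iso T (radical T N) :=
  fun _ hx _ hy => hx.2 _ hy.1

theorem span_zero_left (T : V →ₗ[ℝ] V) (X : Submodule ℤ V) (n : V)
    (h : ∀ x ∈ X, (inner ℝ (T x) n : ℝ) = 0) :
    ∀ x ∈ Submodule.span ℝ (X : Set V), (inner ℝ (T x) n : ℝ) = 0 := by
  intro x hx
  induction hx using Submodule.span_induction with
  | mem x hx => exact h x hx
  | zero => simp
  | add x y _ _ hx hy => rw [map_add, inner_add_left, hx, hy, add_zero]
  | smul c x _ hx => rw [map_smul, real_inner_smul_left, hx, mul_zero]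

theorem radical_covol [FiniteDimensional ℝ V] (T : V →ₗ[ℝ] V)
    (hT : ∀ x y, inner ℝ (T x) (T y) = (inner ℝ x y : ℝ))
    (hs : ∀ x y, inner ℝ (T x) y = (inner ℝ (T y) x : ℝ)) (N : Submodule ℤ V) (hN : N.FG)
    (hi : Integral T N) : covol (radical T N) ≤ covol N := by
  set R := radical T N with hR
  set S := Submodule.span ℝ (R : Set V) with hS
  set π : V →ₗ[ℝ] V := (Sᗮ.starProjection : V →ₗ[ℝ] V) with hπ
  have hπS : ∀ v, v - π v ∈ S := by
    intro v
    have := Submodule.sub_starProjection_mem_orthogonal (K := Sᗮ) v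
    rwa [Submodule.orthogonal_orthogonal] at this
  have hS1 : ∀ ρ ∈ S, ∀ n ∈ N, (inner ℝ (T ρ) n : ℝ) = 0 := fun ρ hρ n hn =>
    span_zero_left T R n (fun x hx => hx.2 n hn) ρ hρ
  have hS2 : ∀ ρ ∈ S, ∀ ρ' ∈ S, (inner ℝ (T ρ) ρ' : ℝ) = 0 := by
    intro ρ hρ ρ' hρ'
    rw [hs]
    refine span_zero_left T R ρ (fun x hx => ?_) ρ' hρ'
    rw [hs]
    exact hS1 ρ hρ x hx.1
  have hker : N ⊓ kerZ π = R := by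
    apply le_antisymm
    · rintro v ⟨hv, hk⟩
      refine ⟨hv, hS1 v ?_⟩
      have := hπS v
      have hk' : π v = 0 := hk
      rwa [hk', sub_zero] at this
    · intro v hv
      refine ⟨hv.1, ?_⟩
      rw [SetLike.mem_coe, mem_kerZ]
      apply Submodule.starProjection_apply_eq_zero_iff _ |>.2
      rw [Submodule.orthogonal_orthogonal]
      exact Submodule.subset_span hv
  have hform : ∀ u ∈ N, ∀ v ∈ N, (inner ℝ (T (π u)) (π v) : ℝ) = inner ℝ (T u) v := by
    intro u hu v hv
    obtain ⟨a, ha, e1⟩ : ∃ a ∈ S, π u = u - a := ⟨u - π u, hπS u, by abel⟩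
    obtain ⟨c, hc, e2⟩ : ∃ a ∈ S, π v = v - a := ⟨v - π v, hπS v, by abel⟩
    rw [e1, e2, map_sub, inner_sub_left, inner_sub_right, inner_sub_right, hS1 a ha v hv,
      hS2 a ha c hc, hs u c, hS1 c hc u hu]
    ring
  obtain ⟨b1, b2, b, hb1, hb2⟩ := adapted_basis hN π
  choose z hz using fun i j => hi (b (Sum.inr i)) (b _).2 (b (Sum.inr j)) (b _).2
  have hZ : (Matrix.of fun i j => (inner ℝ (T (b2 i)) (b2 j : V) : ℝ)) =
      (Matrix.of z).map (Int.castRingHom ℝ) := by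
    ext i j
    simp only [Matrix.of_apply, Matrix.map_apply]
    rw [← hb2, ← hb2, hform _ (b _).2 _ (b _).2, hz]; rfl
  have hdet : (Matrix.of z).det ≠ 0 := by
    intro h0
    obtain ⟨c, hc, hc0⟩ := Matrix.exists_vecMul_eq_zero_iff.2 h0
    apply hc
    have hu : ∑ i, c i • (b (Sum.inr i) : V) ∈ R := by
      refine ⟨N.sum_mem fun i _ => N.smul_mem _ (b _).2, fun n hn => ?_⟩
      have e : n = _ := repr_sum b ⟨n, hn⟩
      rw [e, inner_sum]
      refine Finset.sum_eq_zero fun k _ => ?_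
      rw [real_inner_smul_right]
      rcases k with k | k
      · have : (inner ℝ (T (∑ i, c i • (b (Sum.inr i) : V))) (b (Sum.inl k) : V) : ℝ) = 0 := by
          rw [hs, hb1]
          refine hS1 _ (Submodule.subset_span ?_) _
            (N.sum_mem fun i _ => N.smul_mem _ (b _).2)
          exact hker.le (b1 k).2
        rw [this, mul_zero]
      · have : (inner ℝ (T (∑ i, c i • (b (Sum.inr i) : V))) (b (Sum.inr k) : V) : ℝ) = 0 := by
          rw [map_sum, sum_inner]
          have h5 : ∀ i, (inner ℝ (T (c i • (b (Sum.inr i) : V))) (b (Sum.inr k) : V) : ℝ) =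
              ((c i * z i k : ℤ) : ℝ) := fun i => by
            rw [map_zsmul, zsmul_eq, real_inner_smul_left, hz]; push_cast; rfl
          have h6 := congrFun hc0 k
          simp only [Matrix.vecMul, dotProduct, Matrix.of_apply, Pi.zero_apply] at h6
          rw [Finset.sum_congr rfl fun i _ => h5 i, ← Int.cast_sum, h6, Int.cast_zero]
        rw [this, mul_zero]
    rw [← hker] at hu
    have hu2 : π (∑ i, c i • (b (Sum.inr i) : V)) = 0 := hu.2
    rw [map_sum] at hu2
    simp only [map_zsmul, hb2] at hu2
    ext i
    refine Fintype.linearIndependent_iff.1 b2.linearIndependent c ?_ i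
    apply Subtype.ext
    rw [Submodule.coe_sum]
    exact hu2
  have h1 : 1 ≤ covol (mapZ π N) := by
    have h2 := detZ_le (fun i => (b2 i : V)) T hT
    rw [hZ, ← RingHom.mapMatrix_apply, ← RingHom.map_det, ← map_pow, ← covol_sq b2] at h2
    have h7 : (1:ℤ) ≤ (Matrix.of z).det ^ 2 := by
      have := sq_pos_of_ne_zero hdet
      omega
    have h8 : (1:ℝ) ≤ Int.castRingHom ℝ ((Matrix.of z).det ^ 2) := by
      simp only [eq_intCast]; exact_mod_cast h7
    by_contra hlt
    push Not at hlt
    have h9 := covol_nonneg (mapZ π N)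
    have : (covol (mapZ π N) ^ 2) ^ 2 < 1 := by
      rw [← pow_mul]
      exact pow_lt_one₀ h9 hlt (by norm_num)
    linarith
  have h3 := covol_ge hN π (fun v => Sᗮ.norm_starProjection_apply_le v)
  rw [hker] at h3
  have := covol_nonneg R
  nlinarith

theorem iso_rank [FiniteDimensional ℝ V] (T : V →ₗ[ℝ] V)
    (hT : ∀ x y, inner ℝ (T x) (T y) = (inner ℝ x y : ℝ)) {R : Submodule ℤ V} (hR : Gap R)
    (h : Iso T R) : 2 * rk R ≤ finrank ℝ V := by
  set S := Submodule.span ℝ (R : Set V) with hS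
  have hinj : Function.Injective T := by
    rw [injective_iff_map_eq_zero]
    intro a ha
    have := hT a a
    rw [ha, inner_zero_left] at this
    exact inner_self_eq_zero.1 this.symm
  have h1 : S.map T ≤ Sᗮ := by
    rintro _ ⟨x, hx, rfl⟩
    rw [Submodule.mem_orthogonal']
    intro u hu
    induction hu using Submodule.span_induction with
    | mem u hu => exact span_zero_left T R u (fun x hx => h x hx u hu) x hx
    | zero => simp
    | add a b _ _ ha hb => rw [inner_add_right, ha, hb, add_zero]
    | smul c a _ ha => rw [real_inner_smul_right, ha, mul_zero]
  have h2 := Submodule.finrank_mono h1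
  rw [← (Submodule.equivMapOfInjective T hinj S).finrank_eq] at h2
  have h3 := Submodule.finrank_add_finrank_orthogonal S
  rw [hR.rk_eq, ← hS]
  omega

/-- Orthogonal unimodular lattices. -/
structure OU (L : Submodule ℤ V) (τ : V →ₗ[ℝ] V) : Prop where
  gap : Gap L
  span : Submodule.span ℝ (L : Set V) = ⊤
  isom : ∀ x y, inner ℝ (τ x) (τ y) = (inner ℝ x y : ℝ)
  symm : ∀ x y, inner ℝ (τ x) y = (inner ℝ (τ y) x : ℝ)
  dual : mapZ τ L = dualLat L

variable {L : Submodule ℤ V} {τ : V →ₗ[ℝ] V}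

theorem OU.invol (h : OU L τ) (x : V) : τ (τ x) = x := by
  apply ext_inner_right ℝ
  intro y
  rw [h.symm, h.isom, real_inner_comm]

theorem OU.norm (h : OU L τ) (x : V) : ‖τ x‖ = ‖x‖ := by
  have := h.isom x x
  rw [real_inner_self_eq_norm_sq, real_inner_self_eq_norm_sq] at this
  exact (sq_eq_sq₀ (norm_nonneg _) (norm_nonneg _)).1 this

theorem OU.mem_dual (h : OU L τ) {x : V} (hx : x ∈ L) : τ x ∈ dualLat L := by
  rw [← h.dual]; exact ⟨x, hx, rfl⟩

theorem OU.int (h : OU L τ) : Integral τ L := by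
  intro x hx y hy
  obtain ⟨n, hn⟩ := h.mem_dual hx y hy
  exact ⟨n, by rw [real_inner_comm]; exact hn⟩

theorem OU.of_dual (h : OU L τ) {f : V} (hf : f ∈ dualLat L) : τ f ∈ L := by
  rw [← h.dual] at hf
  obtain ⟨x, hx, rfl⟩ := hf
  change τ (τ x) ∈ L
  rw [h.invol]; exact hx

theorem OU.eq_zero (h : OU L τ) {x : V} (hx : ∀ z ∈ L, (inner ℝ (τ x) z : ℝ) = 0) : x = 0 := by
  have h1 : τ x = 0 := by
    have h2 : ∀ u ∈ Submodule.span ℝ (L : Set V), (inner ℝ (τ x) u : ℝ) = 0 := by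
      intro u hu
      induction hu using Submodule.span_induction with
      | mem u hu => exact hx u hu
      | zero => simp
      | add a b _ _ ha hb => rw [inner_add_right, ha, hb, add_zero]
      | smul c a _ ha => rw [real_inner_smul_right, ha, mul_zero]
    rw [h.span] at h2
    exact inner_self_eq_zero.1 (h2 (τ x) trivial)
  rw [← h.invol x, h1, map_zero]

theorem OU.prim (h : OU L τ) {x : V} (hx : Prim L x) : ∃ z ∈ L, (inner ℝ (τ x) z : ℝ) = 1 := by
  let I : Submodule ℤ ℤ :=
    { carrier := {n | ∃ z ∈ L, (inner ℝ (τ x) z : ℝ) = n}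
      zero_mem' := ⟨0, L.zero_mem, by simp⟩
      add_mem' := by
        rintro a b ⟨z, hz, e⟩ ⟨z', hz', e'⟩
        exact ⟨z + z', L.add_mem hz hz', by rw [inner_add_right, e, e']; push_cast; rfl⟩
      smul_mem' := by
        rintro c a ⟨z, hz, e⟩
        exact ⟨c • z, L.smul_mem c hz, by
          rw [zsmul_eq, real_inner_smul_right, e]; push_cast; simp⟩ }
  obtain ⟨d, hd⟩ := (IsPrincipalIdealRing.principal (I : Ideal ℤ)).principal
  have hdm : d ∈ I := by rw [hd]; exact Submodule.mem_span_singleton_self d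
  have hdiv : ∀ z ∈ L, ∃ k : ℤ, (inner ℝ (τ x) z : ℝ) = d * k := by
    intro z hz
    obtain ⟨n, hn⟩ := h.int x hx.1 z hz
    have : n ∈ I := ⟨z, hz, hn⟩
    rw [hd] at this
    obtain ⟨k, hk⟩ := Submodule.mem_span_singleton.1 this
    refine ⟨k, ?_⟩
    rw [hn, ← hk]; simp [mul_comm]
  have hd0 : (d : ℝ) ≠ 0 := by
    intro h0
    apply hx.2.1
    apply h.eq_zero
    intro z hz
    obtain ⟨k, hk⟩ := hdiv z hz
    rw [hk, h0, zero_mul]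
  have h1 : (d : ℝ)⁻¹ • τ x ∈ dualLat L := by
    intro z hz
    obtain ⟨k, hk⟩ := hdiv z hz
    refine ⟨k, ?_⟩
    rw [real_inner_smul_right, real_inner_comm, hk, inv_mul_cancel_left₀ hd0]
  have h2 := h.of_dual h1
  rw [map_smul, h.invol] at h2
  obtain ⟨n, hn⟩ := hx.2.2 _ h2
  have h3 : d * n = 1 := by
    have : (d : ℝ) * n = 1 := by rw [← hn, mul_inv_cancel₀ hd0]
    exact_mod_cast this
  obtain ⟨z, hz, e⟩ := hdm
  refine ⟨n • z, L.smul_mem n hz, ?_⟩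
  rw [zsmul_eq, real_inner_smul_right, e]
  rw [mul_comm] at h3
  exact_mod_cast h3

theorem OU.covol_one [FiniteDimensional ℝ V] (h : OU L τ) : covol L = 1 := by
  obtain ⟨b⟩ := exists_basis h.gap.fg
  have hli := h.gap.linInd b
  have hsp : ⊤ ≤ Submodule.span ℝ (Set.range fun i => (b i : V)) := by
    rw [← h.span, Submodule.span_le]
    intro x hx
    have e : x = _ := repr_sum b ⟨x, hx⟩
    rw [SetLike.mem_coe, e]
    exact Submodule.sum_mem _ fun i _ => Submodule.smul_mem _ _ (Submodule.subset_span ⟨i, rfl⟩)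
  let B : Basis _ ℝ V := Basis.mk hli hsp
  have hB : ∀ i, B i = b i := fun i => by simp [B]
  set A := Matrix.gram ℝ (fun i => (b i : V)) with hA
  set C : Matrix (Fin (rk L)) (Fin (rk L)) ℝ := Matrix.of fun i j => B.repr (τ (b i)) j with hC
  have hCs : ∀ i, τ (b i) = ∑ j, C i j • (b j : V) := by
    intro i
    rw [← B.sum_repr (τ (b i))]
    exact Finset.sum_congr rfl fun j _ => by rw [hB]; simp [hC]
  have hpos : 0 < gdet (fun i => (b i : V)) := gdet_pos hli
  have hC1 : C.det ^ 2 = 1 := by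
    have h1 := gdet_combo (fun i => (b i : V)) (fun i => τ (b i)) C hCs
    have h2 : gdet (fun i => τ (b i : V)) = gdet (fun i => (b i : V)) := by
      unfold gdet
      congr 1
      ext i j
      simp [Matrix.gram_apply, h.isom]
    rw [h2] at h1
    nlinarith
  choose z hz using fun i j => h.int (b i) (b i).2 (b j) (b j).2
  have hZ : (Matrix.of z).map (Int.castRingHom ℝ) = C * A := by
    ext i j
    rw [Matrix.mul_apply, Matrix.map_apply, Matrix.of_apply, eq_intCast, ← hz, hCs, sum_inner]
    exact Finset.sum_congr rfl fun k _ => by rw [real_inner_smul_left]; rfl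
  have hdet : ((Matrix.of z).det : ℝ) = C.det * A.det := by
    rw [← Matrix.det_mul, ← hZ, ← RingHom.mapMatrix_apply, ← RingHom.map_det]; rfl
  -- dual basis
  have hd : ∀ i, ∃ x ∈ L, ∀ j, (inner ℝ (τ x) (b j : V) : ℝ) = if i = j then 1 else 0 := by
    intro i
    let φ : V →ₗ[ℝ] ℝ := B.coord i
    let f : V := (InnerProductSpace.toDual ℝ V).symm (LinearMap.toContinuousLinearMap φ)
    have hf : ∀ v, (inner ℝ f v : ℝ) = φ v := fun v => by
      simp [f, InnerProductSpace.toDual_symm_apply]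
    have hφ : ∀ j, φ (b j) = if i = j then 1 else 0 := by
      intro j
      rw [← hB]
      simp [φ, Finsupp.single_apply, eq_comm]
    have hfd : f ∈ dualLat L := by
      intro x hx
      refine ⟨b.repr ⟨x, hx⟩ i, ?_⟩
      have e : x = _ := repr_sum b ⟨x, hx⟩
      rw [real_inner_comm, hf]
      conv_lhs => rw [e]
      rw [map_sum]
      simp [hφ]
    refine ⟨τ f, h.of_dual hfd, fun j => ?_⟩
    rw [h.invol, hf, hφ]
  choose x hx hxb using hd
  have hN : (Matrix.of fun i j => b.repr ⟨x i, hx i⟩ j) * Matrix.of z = 1 := by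
    ext i j
    have h1 := hxb i j
    have e : x i = _ := repr_sum b ⟨x i, hx i⟩
    rw [e, map_sum, sum_inner] at h1
    simp only [map_smul, real_inner_smul_left, hz] at h1
    rw [Matrix.mul_apply, Matrix.one_apply]
    have h2 : ((∑ k, b.repr ⟨x i, hx i⟩ k * z k j : ℤ) : ℝ) = ((if i = j then 1 else 0 : ℤ) : ℝ) := by
      push_cast
      rw [h1]
    exact_mod_cast h2
  have hzd : ((Matrix.of z).det : ℝ) ^ 2 = 1 := by
    have h4 := congrArg Matrix.det hN
    rw [Matrix.det_mul, Matrix.det_one, mul_comm] at h4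
    rcases Int.eq_one_or_neg_one_of_mul_eq_one h4 with h | h <;> rw [h] <;> norm_num
  rw [hdet, mul_pow, hC1, one_mul] at hzd
  have hA1 : gdet (fun i => (b i : V)) = 1 := by
    have : gdet (fun i => (b i : V)) ^ 2 = 1 := hzd
    nlinarith
  rw [covol_eq b, hA1, Real.sqrt_one]

theorem OU.rk_eq [FiniteDimensional ℝ V] (h : OU L τ) : rk L = finrank ℝ V := by
  rw [h.gap.rk_eq, h.span, finrank_top]

theorem OU.Hmin_le_one [FiniteDimensional ℝ V] (h : OU L τ) : Hmin L ≤ 1 := by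
  by_cases hn : finrank ℝ V = 0
  · rw [Hmin_zero L hn]; norm_num
  · have := PP_Hmin h.gap L le_rfl
    rw [h.covol_one, h.rk_eq] at this
    by_contra hlt
    push Not at hlt
    have := one_lt_pow₀ hlt hn
    linarith

/-- It suffices to treat isotropic sublattices. -/
theorem PP_of_iso [FiniteDimensional ℝ V] (T : V →ₗ[ℝ] V)
    (hT : ∀ x y, inner ℝ (T x) (T y) = (inner ℝ x y : ℝ))
    (hs : ∀ x y, inner ℝ (T x) y = (inner ℝ (T y) x : ℝ)) (X : Submodule ℤ V) (hX : Gap X)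
    (hi : Integral T X) {c : ℝ} (hc0 : 0 ≤ c) (hc : c ≤ 1)
    (h : ∀ R ≤ X, Iso T R → c ^ rk R ≤ covol R) : PP X c := by
  intro N hN
  have h1 := radical_covol T hT hs N (hX.mono hN).fg
    (fun x hx y hy => hi x (hN hx) y (hN hy))
  have h2 := h (radical T N) ((radical_le T N).trans hN) (radical_iso T N)
  refine le_trans ?_ (h2.trans h1)
  exact pow_le_pow_of_le_one hc0 hc (rk_mono (hX.mono hN).fg (radical_le T N))

end P4

section P5
variable {V W G : Type*} [NormedAddCommGroup V] [InnerProductSpace ℝ V]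
  [NormedAddCommGroup W] [InnerProductSpace ℝ W] [NormedAddCommGroup G] [InnerProductSpace ℝ G]
  [FiniteDimensional ℝ V] [FiniteDimensional ℝ W]
  {tp : V →ₗ[ℝ] W →ₗ[ℝ] G}

/-! ### Tensor products -/

theorem IsTensor.flip (h : IsTensor tp) : IsTensor tp.flip := by
  refine ⟨?_, fun x x' y y' => ?_⟩
  · have : (TensorProduct.lift tp.flip) =
        (TensorProduct.lift tp) ∘ₗ (TensorProduct.comm ℝ W V).toLinearMap := by
      ext x y; simp
    rw [this]
    exact h.1.comp (TensorProduct.comm ℝ W V).bijective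
  · rw [LinearMap.flip_apply, LinearMap.flip_apply, h.2, mul_comm]

theorem IsTensor.fd (h : IsTensor tp) : FiniteDimensional ℝ G :=
  (LinearEquiv.ofBijective _ h.1).finiteDimensional

theorem IsTensor.finrank_eq (h : IsTensor tp) : finrank ℝ G = finrank ℝ V * finrank ℝ W := by
  rw [← (LinearEquiv.ofBijective _ h.1).finrank_eq, finrank_tensorProduct]

theorem IsTensor.ind (h : IsTensor tp) {p : G → Prop} (h0 : p 0) (ht : ∀ x y, p (tp x y))
    (ha : ∀ a b, p a → p b → p (a + b)) (w : G) : p w := by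
  obtain ⟨z, rfl⟩ := h.1.2 w
  induction z using TensorProduct.induction_on with
  | zero => rw [map_zero]; exact h0
  | tmul x y => rw [TensorProduct.lift.tmul]; exact ht x y
  | add a b ha' hb' => rw [map_add]; exact ha _ _ ha' hb'

theorem IsTensor.norm (h : IsTensor tp) (x : V) (y : W) : ‖tp x y‖ = ‖x‖ * ‖y‖ := by
  have := h.2 x x y y
  simp only [real_inner_self_eq_norm_sq] at this
  rw [← mul_pow] at this
  exact (sq_eq_sq₀ (norm_nonneg _) (by positivity)).1 this

theorem IsTensor.ne_zero (h : IsTensor tp) {x : V} {y : W} (hx : x ≠ 0) (hy : y ≠ 0) :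
    tp x y ≠ 0 := by
  rw [← norm_ne_zero_iff, h.norm]
  exact mul_ne_zero (norm_ne_zero_iff.2 hx) (norm_ne_zero_iff.2 hy)

/-- Contraction. -/
def con [FiniteDimensional ℝ G] (tp : V →ₗ[ℝ] W →ₗ[ℝ] G) (f : W) : G →ₗ[ℝ] V :=
  LinearMap.adjoint (tp.flip f)

section con
variable [FiniteDimensional ℝ G]

theorem con_inner (f : W) (w : G) (e : V) : inner ℝ (con tp f w) e = (inner ℝ w (tp e f) : ℝ) := by
  unfold con; rw [LinearMap.adjoint_inner_left]; rfl

theorem con_tp (h : IsTensor tp) (f : W) (x : V) (y : W) :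
    con tp f (tp x y) = (inner ℝ f y : ℝ) • x := by
  apply ext_inner_right ℝ
  intro e
  rw [con_inner, h.2, real_inner_smul_left, mul_comm, real_inner_comm y f]

theorem con_add (f g : W) (w : G) : con tp (f + g) w = con tp f w + con tp g w := by
  apply ext_inner_right ℝ
  intro e
  simp only [con_inner, map_add, inner_add_right, inner_add_left]

theorem con_smul (c : ℝ) (g : W) (w : G) : con tp (c • g) w = c • con tp g w := by
  apply ext_inner_right ℝ
  intro e
  simp only [con_inner, map_smul, inner_smul_right, real_inner_smul_left]

theorem con_sub (f g : W) (w : G) : con tp (f - g) w = con tp f w - con tp g w := by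
  apply ext_inner_right ℝ
  intro e
  simp only [con_inner, map_sub, inner_sub_right, inner_sub_left]

theorem con_zero (w : G) : con tp 0 w = 0 := by
  apply ext_inner_right ℝ
  intro e
  simp only [con_inner, map_zero, inner_zero_right, inner_zero_left]

theorem con_norm (h : IsTensor tp) (f : W) (w : G) : ‖con tp f w‖ ≤ ‖f‖ * ‖w‖ := by
  have h1 : ‖con tp f w‖ ^ 2 ≤ ‖w‖ * (‖con tp f w‖ * ‖f‖) := by
    rw [← real_inner_self_eq_norm_sq, con_inner, ← h.norm]
    exact real_inner_le_norm _ _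
  rcases eq_or_lt_of_le (norm_nonneg (con tp f w)) with h0 | h0
  · rw [← h0]; positivity
  · nlinarith

theorem con_sep (h : IsTensor tp) {w : G} (hw : ∀ f, con tp f w = 0) : w = 0 := by
  have : ∀ u, (inner ℝ w u : ℝ) = 0 := by
    refine h.ind (by simp) (fun x y => ?_) (fun a b ha hb => by rw [inner_add_right, ha, hb, add_zero])
    rw [← con_inner, hw, inner_zero_left]
  exact inner_self_eq_zero.1 (this w)

/-- Contractions on both sides agree. -/
theorem con_comm (f : W) (e : V) (w : G) :
    (inner ℝ (con tp f w) e : ℝ) = inner ℝ (con tp.flip e w) f := by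
  rw [con_inner, con_inner]; rfl

theorem con_lat (h : IsTensor tp) {L : Submodule ℤ V} {M : Submodule ℤ W} {f : W}
    (hf : f ∈ dualLat M) {w : G} (hw : w ∈ tensorLat tp L M) : con tp f w ∈ L := by
  induction hw using Submodule.span_induction with
  | mem w hw =>
    obtain ⟨x, hx, y, hy, rfl⟩ := hw
    obtain ⟨n, hn⟩ := hf y hy
    change con tp f (tp x y) ∈ L
    rw [con_tp h, real_inner_comm, hn, ← zsmul_eq]
    exact L.smul_mem n hx
  | zero => rw [map_zero]; exact L.zero_mem
  | add a b _ _ ha hb => rw [map_add]; exact L.add_mem ha hb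
  | smul n a _ ha => rw [map_zsmul]; exact L.smul_mem n ha

/-- The flag step. -/
theorem flag_step (h : IsTensor tp) {Λ : Submodule ℤ G} (hΛ : Λ.FG) (f f' : W) (hf' : f' ≠ 0)
    (hff : ∀ w ∈ Λ, con tp f w = con tp f' w) :
    covol (Λ ⊓ kerZ (con tp f)) * covol (mapZ (con tp f) Λ) ≤
      ‖f'‖ ^ rk (mapZ (con tp f) Λ) * covol Λ := by
  refine covol_ge_scaled hΛ _ _ (norm_pos_iff.2 hf') fun v hv => ?_
  have : con tp f v = con tp f' v := by
    induction hv using Submodule.span_induction with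
    | mem x hx => exact hff x hx
    | zero => simp
    | add a b _ _ ha hb => rw [map_add, map_add, ha, hb]
    | smul c a _ ha => rw [map_smul, map_smul, ha]
  rw [this]
  exact con_norm h f' v

end con

/-- Tensor product of endomorphisms. -/
def tmap (h : IsTensor tp) (A : V →ₗ[ℝ] V) (B : W →ₗ[ℝ] W) : G →ₗ[ℝ] G :=
  TensorProduct.lift tp ∘ₗ TensorProduct.map A B ∘ₗ
    (LinearEquiv.ofBijective _ h.1).symm.toLinearMap

theorem tmap_tp (h : IsTensor tp) (A : V →ₗ[ℝ] V) (B : W →ₗ[ℝ] W) (x : V) (y : W) :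
    tmap h A B (tp x y) = tp (A x) (B y) := by
  have : tp x y = LinearEquiv.ofBijective _ h.1 (x ⊗ₜ[ℝ] y) := by simp
  rw [this]
  change TensorProduct.lift tp (TensorProduct.map A B
    ((LinearEquiv.ofBijective _ h.1).symm (LinearEquiv.ofBijective _ h.1 (x ⊗ₜ[ℝ] y)))) = _
  rw [LinearEquiv.symm_apply_apply, TensorProduct.map_tmul, TensorProduct.lift.tmul]

theorem tmap_isom (h : IsTensor tp) {A : V →ₗ[ℝ] V} {B : W →ₗ[ℝ] W}
    (hA : ∀ x y, inner ℝ (A x) (A y) = (inner ℝ x y : ℝ))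
    (hB : ∀ x y, inner ℝ (B x) (B y) = (inner ℝ x y : ℝ)) (u v : G) :
    (inner ℝ (tmap h A B u) (tmap h A B v) : ℝ) = inner ℝ u v := by
  revert v
  refine h.ind (p := fun u => ∀ v, (inner ℝ (tmap h A B u) (tmap h A B v) : ℝ) = inner ℝ u v)
    (fun v => by rw [map_zero, inner_zero_left, inner_zero_left])
    (fun x y v => ?_) (fun a b ha hb v => by
    rw [map_add, inner_add_left, ha, hb, inner_add_left]) u
  refine h.ind (p := fun v => (inner ℝ (tmap h A B (tp x y)) (tmap h A B v) : ℝ) =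
    inner ℝ (tp x y) v) (by rw [map_zero, inner_zero_right, inner_zero_right])
    (fun x' y' => ?_) (fun a b ha hb => by
    rw [map_add, inner_add_right, ha, hb, inner_add_right]) v
  rw [tmap_tp, tmap_tp, h.2, h.2, hA, hB]

theorem tmap_symm (h : IsTensor tp) {A : V →ₗ[ℝ] V} {B : W →ₗ[ℝ] W}
    (hA : ∀ x y, inner ℝ (A x) y = (inner ℝ (A y) x : ℝ))
    (hB : ∀ x y, inner ℝ (B x) y = (inner ℝ (B y) x : ℝ)) (u v : G) :
    (inner ℝ (tmap h A B u) v : ℝ) = inner ℝ (tmap h A B v) u := by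
  revert v
  refine h.ind (p := fun u => ∀ v, (inner ℝ (tmap h A B u) v : ℝ) = inner ℝ (tmap h A B v) u)
    (fun v => by rw [map_zero, inner_zero_left, inner_zero_right])
    (fun x y v => ?_) (fun a b ha hb v => by
    rw [map_add, inner_add_left, ha, hb, ← inner_add_right]) u
  refine h.ind (p := fun v => (inner ℝ (tmap h A B (tp x y)) v : ℝ) =
    inner ℝ (tmap h A B v) (tp x y)) (by rw [map_zero, inner_zero_right, inner_zero_left])
    (fun x' y' => ?_) (fun a b ha hb => by
    rw [map_add, inner_add_right, ha, hb, ← inner_add_left]) v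
  rw [tmap_tp, tmap_tp, h.2, h.2, hA, hB]

theorem tmap_lat (h : IsTensor tp) {A : V →ₗ[ℝ] V} {B : W →ₗ[ℝ] W} {L L' : Submodule ℤ V}
    {M M' : Submodule ℤ W} (hA : ∀ x ∈ L, A x ∈ L') (hB : ∀ x ∈ M, B x ∈ M') :
    ∀ w ∈ tensorLat tp L M, tmap h A B w ∈ tensorLat tp L' M' := by
  intro w hw
  induction hw using Submodule.span_induction with
  | mem w hw =>
    obtain ⟨x, hx, y, hy, rfl⟩ := hw
    change tmap h A B (tp x y) ∈ _
    rw [tmap_tp]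
    exact Submodule.subset_span ⟨_, hA x hx, _, hB y hy, rfl⟩
  | zero => rw [map_zero]; exact Submodule.zero_mem _
  | add a b _ _ ha hb => rw [map_add]; exact Submodule.add_mem _ ha hb
  | smul n a _ ha => rw [map_zsmul]; exact Submodule.smul_mem _ n ha

theorem tp_mem {L : Submodule ℤ V} {M : Submodule ℤ W} {x : V} {y : W} (hx : x ∈ L) (hy : y ∈ M) :
    tp x y ∈ tensorLat tp L M := Submodule.subset_span ⟨x, hx, y, hy, rfl⟩

theorem tensor_int (h : IsTensor tp) {A : V →ₗ[ℝ] V} {B : W →ₗ[ℝ] W} {L : Submodule ℤ V}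
    {M : Submodule ℤ W} (hA : Integral A L) (hB : Integral B M) :
    Integral (tmap h A B) (tensorLat tp L M) := by
  intro u hu
  induction hu using Submodule.span_induction with
  | mem w hw =>
    obtain ⟨x, hx, y, hy, rfl⟩ := hw
    intro v hv
    change ∃ n : ℤ, (inner ℝ (tmap h A B (tp x y)) v : ℝ) = n
    induction hv using Submodule.span_induction with
    | mem w hw =>
      obtain ⟨x', hx', y', hy', rfl⟩ := hw
      change ∃ n : ℤ, (inner ℝ (tmap h A B (tp x y)) (tp x' y') : ℝ) = n
      obtain ⟨m, hm⟩ := hA x hx x' hx'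
      obtain ⟨n, hn⟩ := hB y hy y' hy'
      exact ⟨m * n, by rw [tmap_tp, h.2, hm, hn]; push_cast; rfl⟩
    | zero => exact ⟨0, by simp⟩
    | add a b _ _ ha hb =>
      obtain ⟨m, hm⟩ := ha
      obtain ⟨n, hn⟩ := hb
      exact ⟨m + n, by rw [inner_add_right, hm, hn]; push_cast; rfl⟩
    | smul k a _ ha =>
      obtain ⟨m, hm⟩ := ha
      exact ⟨k * m, by rw [zsmul_eq, real_inner_smul_right, hm]; push_cast; rfl⟩
  | zero => exact fun v _ => ⟨0, by simp⟩
  | add a b _ _ ha hb =>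
    intro v hv
    obtain ⟨m, hm⟩ := ha v hv
    obtain ⟨n, hn⟩ := hb v hv
    exact ⟨m + n, by rw [map_add, inner_add_left, hm, hn]; push_cast; rfl⟩
  | smul k a _ ha =>
    intro v hv
    obtain ⟨m, hm⟩ := ha v hv
    exact ⟨k * m, by rw [map_zsmul, zsmul_eq, real_inner_smul_left, hm]; push_cast; rfl⟩

theorem tensorLat_flip (L : Submodule ℤ V) (M : Submodule ℤ W) :
    tensorLat tp.flip M L = tensorLat tp L M := by
  unfold tensorLat
  rw [Set.image2_swap]; rfl

theorem tensorLat_mono {L L' : Submodule ℤ V} {M M' : Submodule ℤ W} (h : L ≤ L') (h' : M ≤ M') :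
    tensorLat tp L M ≤ tensorLat tp L' M' :=
  Submodule.span_mono (Set.image2_subset h h')

theorem tensor_gdet (h : IsTensor tp) {ι κ : Type*} [Fintype ι] [DecidableEq ι] [Fintype κ]
    [DecidableEq κ] (v : ι → V) (u : κ → W) :
    gdet (fun p : ι × κ => tp (v p.1) (u p.2)) =
      gdet v ^ Fintype.card κ * gdet u ^ Fintype.card ι := by
  unfold gdet
  rw [← Matrix.det_kronecker]
  congr 1
  ext p q
  simp [Matrix.gram_apply, h.2]

theorem tensorLat_eq {X : Submodule ℤ V} {Y : Submodule ℤ W} {ι κ : Type*} [Fintype ι] [Fintype κ]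
    (b : Basis ι ℤ X) (c : Basis κ ℤ Y) : tensorLat tp X Y =
      Submodule.span ℤ (Set.range fun p : ι × κ => tp (b p.1) (c p.2)) := by
  apply le_antisymm
  · apply Submodule.span_le.2
    rintro _ ⟨x, hx, y, hy, rfl⟩
    have e1 : x = _ := repr_sum b ⟨x, hx⟩
    have e2 : y = _ := repr_sum c ⟨y, hy⟩
    change tp x y ∈ _
    rw [e1, e2, map_sum]
    refine Submodule.sum_mem _ fun j _ => ?_
    rw [map_sum, LinearMap.sum_apply]
    refine Submodule.sum_mem _ fun i _ => ?_
    rw [map_smul, map_smul, LinearMap.smul_apply, ← zsmul_eq, ← zsmul_eq]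
    exact Submodule.smul_mem _ _ (Submodule.smul_mem _ _ (Submodule.subset_span ⟨(i, j), rfl⟩))
  · apply Submodule.span_le.2
    rintro _ ⟨p, rfl⟩
    exact tp_mem (b _).2 (c _).2

theorem tensor_linInd (h : IsTensor tp) {ι κ : Type*} [Fintype ι] [Fintype κ]
    {v : ι → V} {u : κ → W} (hv : LinearIndependent ℝ v) (hu : LinearIndependent ℝ u) :
    LinearIndependent ℝ (fun p : ι × κ => tp (v p.1) (u p.2)) := by
  classical
  apply linInd_of_gdet
  rw [tensor_gdet h]
  exact mul_ne_zero (pow_ne_zero _ (gdet_pos hv).ne') (pow_ne_zero _ (gdet_pos hu).ne')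

theorem tensor_gap (h : IsTensor tp) {X : Submodule ℤ V} {Y : Submodule ℤ W} (hX : Gap X)
    (hY : Gap Y) : Gap (tensorLat tp X Y) := by
  have := h.fd
  obtain ⟨b⟩ := exists_basis hX.fg
  obtain ⟨c⟩ := exists_basis hY.fg
  rw [tensorLat_eq b c]
  exact gap_span (tensor_linInd h (v := fun i => (b i : V)) (u := fun i => (c i : W))
    (hX.linInd b) (hY.linInd c))

theorem tensor_covol (h : IsTensor tp) {X : Submodule ℤ V} {Y : Submodule ℤ W} (hX : Gap X)
    (hY : Gap Y) : covol (tensorLat tp X Y) = covol X ^ rk Y * covol Y ^ rk X ∧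
      rk (tensorLat tp X Y) = rk X * rk Y := by
  obtain ⟨b⟩ := exists_basis hX.fg
  obtain ⟨c⟩ := exists_basis hY.fg
  rw [tensorLat_eq b c]
  have h1 := linInd_int (tensor_linInd h (v := fun i => (b i : V)) (u := fun i => (c i : W))
    (hX.linInd b) (hY.linInd c))
  have h2 := tensor_gdet h (fun i => (b i : V)) (fun i => (c i : W))
  rw [covol_span h1, rk_span h1, h2, ← covol_sq b, ← covol_sq c]
  constructor
  · rw [Real.sqrt_eq_iff_mul_self_eq]
    · simp only [Fintype.card_fin]; ring
    · positivity
    · have := covol_nonneg X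
      have := covol_nonneg Y
      positivity
  · simp

theorem tensor_span (h : IsTensor tp) {L : Submodule ℤ V} {M : Submodule ℤ W}
    (hL : Submodule.span ℝ (L : Set V) = ⊤) (hM : Submodule.span ℝ (M : Set W) = ⊤) :
    Submodule.span ℝ (tensorLat tp L M : Set G) = ⊤ := by
  rw [eq_top_iff]
  intro w _
  refine h.ind (Submodule.zero_mem _) (fun x y => ?_) (fun a b ha hb => Submodule.add_mem _ ha hb) w
  have hx : x ∈ Submodule.span ℝ (L : Set V) := by rw [hL]; trivial
  have hy : y ∈ Submodule.span ℝ (M : Set W) := by rw [hM]; trivial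
  induction hx using Submodule.span_induction with
  | mem x hx =>
    induction hy using Submodule.span_induction with
    | mem y hy => exact Submodule.subset_span (tp_mem hx hy)
    | zero => rw [map_zero]; exact Submodule.zero_mem _
    | add a b _ _ ha hb => rw [map_add]; exact Submodule.add_mem _ ha hb
    | smul c a _ ha => rw [map_smul]; exact Submodule.smul_mem _ c ha
  | zero => rw [map_zero]; exact Submodule.zero_mem _
  | add a b _ _ ha hb => rw [map_add]; exact Submodule.add_mem _ ha hb
  | smul c a _ ha => rw [map_smul]; exact Submodule.smul_mem _ c ha

/-- Upper bound. -/
theorem Hmin_upper (h : IsTensor tp) {L : Submodule ℤ V} {M : Submodule ℤ W} (hL : Gap L)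
    (hM : Gap M) (hLs : Submodule.span ℝ (L : Set V) = ⊤)
    (hMs : Submodule.span ℝ (M : Set W) = ⊤) (hn : finrank ℝ V ≠ 0) (hm : finrank ℝ W ≠ 0) :
    Hmin (tensorLat tp L M) ≤ Hmin L * Hmin M := by
  have := h.fd
  have hPP := PP_Hmin (tensor_gap h hL hM)
  have h0 := Hmin_nonneg (tensorLat tp L M)
  set c := Hmin (tensorLat tp L M) with hc
  -- key inequality
  have key : ∀ X ≤ L, ∀ Y ≤ M, rk X ≠ 0 → rk Y ≠ 0 →
      c ≤ covol X ^ ((rk X : ℝ)⁻¹) * covol Y ^ ((rk Y : ℝ)⁻¹) := by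
    intro X hX Y hY hrX hrY
    obtain ⟨e1, e2⟩ := tensor_covol h (hL.mono hX) (hM.mono hY)
    have h1 := hPP _ (tensorLat_mono (tp := tp) hX hY)
    rw [e1, e2] at h1
    have hx := covol_nonneg X
    have hy := covol_nonneg Y
    refine (pow_le_pow_iff_left₀ h0 (by positivity) (mul_ne_zero hrX hrY)).1 (h1.trans (le_of_eq ?_))
    rw [mul_pow, pow_mul, Real.rpow_inv_natCast_pow hx hrX, mul_comm (rk X), pow_mul,
      Real.rpow_inv_natCast_pow hy hrY]
  have key2 : ∀ P : Submodule ℝ V, P ≠ ⊥ → IsRational L P → ∀ Q : Submodule ℝ W, Q ≠ ⊥ →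
      IsRational M Q → c ≤ Hr L P * Hr M Q := by
    intro P hP hPr Q hQ hQr
    have h1 := rk_rational hL P hPr
    have h2 := rk_rational hM Q hQr
    have h3 := key (L ⊓ P.restrictScalars ℤ) inf_le_left (M ⊓ Q.restrictScalars ℤ) inf_le_left
      (by rw [h1]; exact fun h => hP (Submodule.finrank_eq_zero.1 h))
      (by rw [h2]; exact fun h => hQ (Submodule.finrank_eq_zero.1 h))
    rw [h1, h2, ← (covol_latIn hL P).1, ← (covol_latIn hM Q).1] at h3
    exact h3
  have hrn : ∀ Q : Submodule ℝ W, 0 ≤ Hr M Q := fun Q => Real.rpow_nonneg (covol_nonneg _) _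
  have hneL : {h : ℝ | ∃ F : Submodule ℝ V, F ≠ ⊥ ∧ IsRational L F ∧ h = Hr L F}.Nonempty := by
    refine ⟨_, ⊤, fun h => hn ?_, ?_, rfl⟩
    · rw [← finrank_top, h, finrank_bot]
    · unfold IsRational; simpa using hLs
  have hneM : {h : ℝ | ∃ F : Submodule ℝ W, F ≠ ⊥ ∧ IsRational M F ∧ h = Hr M F}.Nonempty := by
    refine ⟨_, ⊤, fun h => hm ?_, ?_, rfl⟩
    · rw [← finrank_top, h, finrank_bot]
    · unfold IsRational; simpa using hMs
  have step : ∀ Q : Submodule ℝ W, Q ≠ ⊥ → IsRational M Q → c ≤ Hmin L * Hr M Q := by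
    intro Q hQ hQr
    rcases eq_or_lt_of_le (hrn Q) with h1 | h1
    · obtain ⟨_, P, hP, hPr, rfl⟩ := hneL
      have := key2 P hP hPr Q hQ hQr
      rw [← h1, mul_zero] at this ⊢
      exact this
    · rw [← div_le_iff₀ h1]
      apply le_csInf hneL
      rintro _ ⟨P, hP, hPr, rfl⟩
      rw [div_le_iff₀ h1]
      exact key2 P hP hPr Q hQ hQr
  rcases eq_or_lt_of_le (Hmin_nonneg L) with h1 | h1
  · obtain ⟨_, Q, hQ, hQr, rfl⟩ := hneM
    have := step Q hQ hQr
    rw [← h1, zero_mul] at this ⊢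
    exact this
  · rw [← div_le_iff₀' h1]
    apply le_csInf hneM
    rintro _ ⟨Q, hQ, hQr, rfl⟩
    rw [div_le_iff₀' h1]
    exact step Q hQ hQr

end P5

section P6
variable {V W G : Type*} [NormedAddCommGroup V] [InnerProductSpace ℝ V]
  [NormedAddCommGroup W] [InnerProductSpace ℝ W] [NormedAddCommGroup G] [InnerProductSpace ℝ G]
  [FiniteDimensional ℝ V] [FiniteDimensional ℝ W]
  {tp : V →ₗ[ℝ] W →ₗ[ℝ] G} {L : Submodule ℤ V} {M : Submodule ℤ W}
  {τ : V →ₗ[ℝ] V} {υ : W →ₗ[ℝ] W}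

/-! ### The easy cases -/

theorem PP_tensor_iso (h : IsTensor tp) (hL : OU L τ) (hM : OU M υ) {c : ℝ} (hc0 : 0 ≤ c)
    (hc : c ≤ 1)
    (hR : ∀ R ≤ tensorLat tp L M, Iso (tmap h τ υ) R → c ^ rk R ≤ covol R) :
    PP (tensorLat tp L M) c := by
  have := h.fd
  exact PP_of_iso _ (tmap_isom h hL.isom hM.isom) (tmap_symm h hL.symm hM.symm) _
    (tensor_gap h hL.gap hM.gap) (tensor_int h hL.int hM.int) hc0 hc hR

theorem PP.mono {X : Submodule ℤ G} {c d : ℝ} (h : PP X d) (hc : 0 ≤ c) (hcd : c ≤ d) : PP X c :=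
  fun Y hY => (pow_le_pow_left₀ hc hcd _).trans (h Y hY)

/-- Both forms are definite. -/
theorem case_def (h : IsTensor tp) (hL : OU L τ) (hM : OU M υ) {ε ε' : ℝ} (hε : ε ≠ 0)
    (hε' : ε' ≠ 0) (h1 : ∀ x, τ x = ε • x) (h2 : ∀ x, υ x = ε' • x) {c : ℝ} (hc0 : 0 ≤ c)
    (hc : c ≤ 1) : PP (tensorLat tp L M) c := by
  have hT : ∀ w, tmap h τ υ w = (ε * ε') • w := by
    refine h.ind (by simp) (fun x y => ?_) (fun a b ha hb => by rw [map_add, ha, hb, smul_add])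
    rw [tmap_tp, h1, h2, map_smul, map_smul, LinearMap.smul_apply, smul_smul, mul_comm]
  refine PP_tensor_iso h hL hM hc0 hc fun R hR hi => ?_
  have : R = ⊥ := by
    rw [eq_bot_iff]
    intro w hw
    have := hi w hw w hw
    rw [hT, real_inner_smul_left] at this
    rcases mul_eq_zero.1 this with h0 | h0
    · exact absurd h0 (mul_ne_zero hε hε')
    · exact inner_self_eq_zero.1 h0
  rw [this, covol_bot, rk_bot, pow_zero]

/-- Integral lattices of small rank behave like `ℤ^n`. -/
theorem case_semidef_aux (h : IsTensor tp) (hL : Gap L) {γ : ℝ} (hγ0 : 0 ≤ γ) (hγ : PP L γ) (n : ℕ) :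
    ∀ N : Submodule ℤ W, Gap N → rk N = n → n ≤ 4 → covol N ≤ 1 →
    Integral LinearMap.id N → ∀ Λ ≤ tensorLat tp L N, γ ^ rk Λ ≤ covol Λ := by
  have := h.fd
  induction n with
  | zero =>
    intro N hN hr _ _ _ Λ hΛ
    have h1 : N = ⊥ := eq_bot_of_rk hN.fg hr
    have h2 : Λ = ⊥ := by
      rw [eq_bot_iff]
      refine hΛ.trans ?_
      apply Submodule.span_le.2
      rintro _ ⟨x, hx, y, hy, rfl⟩
      rw [h1] at hy
      have : y = 0 := hy
      subst this
      simp
    rw [h2, covol_bot, rk_bot, pow_zero]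
  | succ n ih =>
    intro N hN hr hn hcov hintg Λ hΛ
    have hNb : N ≠ ⊥ := by
      rintro rfl
      rw [rk_bot] at hr
      omega
    obtain ⟨y, hy, hy0, hmin⟩ := hN.exists_shortest hNb
    obtain ⟨k, hk⟩ := hintg y hy y hy
    rw [LinearMap.id_apply, real_inner_self_eq_norm_sq] at hk
    have hy1 : ‖y‖ ^ 2 = 1 := by
      have hh := hermite (n + 1) N hN hr (‖y‖ ^ 2) (by positivity)
        (fun v hv hv0 => pow_le_pow_left₀ (norm_nonneg _) (hmin v hv hv0) 2)
      have hkp : (0:ℝ) < k := by rw [← hk]; have := norm_pos_iff.2 hy0; positivity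
      have hkp' : 0 < k := by exact_mod_cast hkp
      rw [hk] at hh ⊢
      have hc1 : covol N ^ 2 ≤ 1 := pow_le_one₀ (covol_nonneg _) hcov
      have : k < 2 := by
        by_contra h2
        push Not at h2
        have h2' : (2:ℝ) ≤ k := by exact_mod_cast h2
        have h3 : (2:ℝ) ^ (n+1) * (3/4:ℝ) ^ ((n+1).choose 2) ≤ 1 := by
          refine le_trans ?_ (hh.trans hc1)
          gcongr
        have : n = 0 ∨ n = 1 ∨ n = 2 ∨ n = 3 := by omega
        rcases this with rfl | rfl | rfl | rfl <;> norm_num [Nat.choose] at h3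
      have : k = 1 := by omega
      rw [this]; norm_num
    have hyn : ‖y‖ = 1 := by nlinarith [norm_nonneg y]
    have hprim := prim_of_shortest hy hy0 hmin
    set N' := mapZ (pw y) N with hN'
    have hN'N : N' ≤ N := by
      rintro _ ⟨v, hv, rfl⟩
      obtain ⟨m, hm⟩ := hintg y hy v hv
      change pw y v ∈ N
      rw [pw_apply, hy1, div_one]
      rw [LinearMap.id_apply] at hm
      rw [hm, ← zsmul_eq]
      exact N.sub_mem hv (N.smul_mem m hy)
    have hrk := rk_prim hN.fg hprim
    have hcv := covol_ge_prim hN.fg hprim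
    rw [← hN'] at hrk hcv
    rw [hyn, one_mul] at hcv
    have hyd : y ∈ dualLat N := fun x hx => hintg x hx y hy
    set Λ' := Λ ⊓ kerZ (con tp y) with hΛ'
    have hΛg : Gap Λ := (tensor_gap h hL hN).mono hΛ
    have hΛ'N : Λ' ≤ tensorLat tp L N' := by
      rintro w ⟨hw, hk⟩
      have hk' : con tp y w = 0 := hk
      have e : ∀ w, tmap h LinearMap.id (pw y) w = w - tp (con tp y w) y := by
        refine h.ind (by simp) (fun x z => ?_) (fun a b ha hb => ?_)
        · rw [tmap_tp, con_tp h, pw_apply, hy1, div_one, map_smul, LinearMap.smul_apply,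
            map_sub, map_smul]; rfl
        · rw [map_add, ha, hb, map_add, map_add, LinearMap.add_apply]; abel
      have e1 := e w
      rw [hk', map_zero, LinearMap.zero_apply, sub_zero] at e1
      rw [← e1]
      exact tmap_lat h (L := L) (M' := N') (fun x hx => hx) (fun x hx => ⟨x, hx, rfl⟩) w (hΛ hw)
    have h1 := ih N' (hN.mono hN'N) (by omega) (by omega) (hcv.trans hcov)
      (fun x hx y hy => hintg x (hN'N hx) y (hN'N hy)) Λ' hΛ'N
    have h2 := flag_step h hΛg.fg y y hy0 (fun _ _ => rfl)
    rw [hyn, one_pow, one_mul] at h2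
    have h3 : mapZ (con tp y) Λ ≤ L := by
      rintro _ ⟨w, hw, rfl⟩
      exact con_lat h hyd (hΛ hw)
    have h4 := hγ _ h3
    rw [rk_add hΛg.fg (con tp y), pow_add]
    exact (mul_le_mul h1 h4 (by positivity) (covol_nonneg _)).trans h2

theorem case_semidef (h : IsTensor tp) (hL : Gap L) (hM : OU M υ) {ε : ℝ} (hε : ε = 1 ∨ ε = -1)
    (h2 : ∀ x, υ x = ε • x) (hdim : finrank ℝ W ≤ 4) {γ δ : ℝ} (hγ0 : 0 ≤ γ) (hδ0 : 0 ≤ δ)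
    (hδ : δ ≤ 1) (hγ : PP L γ) : PP (tensorLat tp L M) (γ * δ) := by
  have h1 : PP (tensorLat tp L M) γ := by
    refine case_semidef_aux h hL hγ0 hγ (rk M) M hM.gap rfl (by rw [hM.rk_eq]; exact hdim)
      hM.covol_one.le ?_
    intro x hx y hy
    obtain ⟨n, hn⟩ := hM.int x hx y hy
    rw [h2, real_inner_smul_left] at hn
    rcases hε with rfl | rfl
    · exact ⟨n, by rw [← hn, one_mul]; rfl⟩
    · exact ⟨-n, by rw [Int.cast_neg, ← hn]; simp⟩
  exact h1.mono (by positivity) (mul_le_of_le_one_right hγ0 hδ)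

/-! ### Submodularity -/

theorem covol_split [FiniteDimensional ℝ G] {Λ : Submodule ℤ G} (hΛ : Gap Λ) (U : Submodule ℝ G)
    (hU : U = Submodule.span ℝ ((Λ ⊓ kerZ (Uᗮ.starProjection : G →ₗ[ℝ] G) : Submodule ℤ G) : Set G)) :
    covol Λ = covol (Λ ⊓ kerZ (Uᗮ.starProjection : G →ₗ[ℝ] G)) *
      covol (mapZ (Uᗮ.starProjection : G →ₗ[ℝ] G) Λ) := by
  set π : G →ₗ[ℝ] G := (Uᗮ.starProjection : G →ₗ[ℝ] G) with hπ
  obtain ⟨b1, b2, b, hb1, hb2⟩ := adapted_basis hΛ.fg π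
  have hsp : ∀ u ∈ U, ∃ c : Fin (rk (Λ ⊓ kerZ π)) → ℝ, u = ∑ i, c i • (b1 i : G) := by
    intro u hu
    rw [hU] at hu
    induction hu using Submodule.span_induction with
    | mem x hx => exact ⟨_, repr_sum b1 ⟨x, hx⟩⟩
    | zero => exact ⟨0, by simp⟩
    | add x y _ _ hx hy =>
      obtain ⟨c, rfl⟩ := hx
      obtain ⟨d, rfl⟩ := hy
      exact ⟨c + d, by simp [add_smul, Finset.sum_add_distrib]⟩
    | smul a x _ hx =>
      obtain ⟨c, rfl⟩ := hx
      exact ⟨a • c, by simp [Finset.smul_sum, smul_smul]⟩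
  have hπU : ∀ v, v - π v ∈ U := by
    intro v
    have := Submodule.sub_starProjection_mem_orthogonal (K := Uᗮ) v
    rwa [Submodule.orthogonal_orthogonal] at this
  have hπo : ∀ v, π v ∈ Uᗮ := fun v => Submodule.starProjection_apply_mem _ v
  choose C hC using fun k => hsp _ (hπU (b (Sum.inr k)))
  have h1 := gdet_orth (fun i => (b1 i : G)) (fun k => (b (Sum.inr k) : G)) (fun k => (b2 k : G))
    (Matrix.of C) (fun k => by
      rw [← hb2]
      simp only [Matrix.of_apply]
      rw [← hC]; abel) (fun i k => by
      rw [← hb2]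
      refine (Submodule.mem_orthogonal _ _).1 (hπo _) _ ?_
      rw [hU]
      exact Submodule.subset_span (b1 i).2)
  have h2 : (Sum.elim (fun i => (b1 i : G)) (fun k => (b (Sum.inr k) : G))) = fun i => (b i : G) := by
    ext i
    rcases i with i | i
    · exact (hb1 i).symm
    · rfl
  rw [h2, ← covol_sq b, ← covol_sq b1, ← covol_sq b2, ← mul_pow] at h1
  exact (sq_eq_sq₀ (covol_nonneg _) (mul_nonneg (covol_nonneg _) (covol_nonneg _))).1 h1

theorem submodular [FiniteDimensional ℝ G] {Λ X Y : Submodule ℤ G} (hΛ : Gap Λ) (hX : X ≤ Λ)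
    (hY : Y = Λ ⊓ (Submodule.span ℝ (Y : Set G)).restrictScalars ℤ) :
    covol (X ⊓ Y) * covol (X ⊔ Y) ≤ covol X * covol Y ∧
      rk (X ⊓ Y) + rk (X ⊔ Y) = rk X + rk Y := by
  set U := Submodule.span ℝ (Y : Set G) with hU
  set π : G →ₗ[ℝ] G := (Uᗮ.starProjection : G →ₗ[ℝ] G) with hπ
  have hYΛ : Y ≤ Λ := by rw [hY]; exact inf_le_left
  have hker : ∀ v, π v = 0 ↔ v ∈ U := fun v => by
    change Uᗮ.starProjection v = 0 ↔ _
    rw [Submodule.starProjection_apply_eq_zero_iff, Submodule.orthogonal_orthogonal]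
  have hΛk : Λ ⊓ kerZ π = Y := by
    conv_rhs => rw [hY]
    ext v
    simp only [Submodule.mem_inf, mem_kerZ, hker]
    rfl
  have h1 : X ⊓ kerZ π = X ⊓ Y := by
    rw [← hΛk, ← inf_assoc, inf_eq_left.2 hX]
  have hXY : X ⊔ Y ≤ Λ := sup_le hX hYΛ
  have hYk : Y ≤ kerZ π := by rw [← hΛk]; exact inf_le_right
  have h2 : (X ⊔ Y) ⊓ kerZ π = Y := by
    apply le_antisymm
    · exact (inf_le_inf_right _ hXY).trans hΛk.le
    · exact le_inf le_sup_right hYk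
  have h3 : mapZ π (X ⊔ Y) = mapZ π X := by
    apply le_antisymm
    · rintro _ ⟨v, hv, rfl⟩
      obtain ⟨x, hx, y, hy, rfl⟩ := Submodule.mem_sup.1 hv
      refine ⟨x, hx, ?_⟩
      have : π y = 0 := hYk hy
      change π x = π (x + y)
      rw [map_add, this, add_zero]
    · exact Submodule.map_mono le_sup_left
  have h4 := covol_split (hΛ.mono hXY) U (by rw [h2])
  rw [h2, h3] at h4
  have h5 := covol_ge (hΛ.mono hX).fg π (fun v => Uᗮ.norm_starProjection_apply_le v)
  have h6 := rk_add (hΛ.mono hX).fg π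
  have h7 := rk_add (hΛ.mono hXY).fg π
  rw [h1] at h5 h6
  rw [h2, h3] at h7
  constructor
  · rw [h4]
    have := covol_nonneg Y
    nlinarith
  · omega

/-- Saturation. -/
theorem saturate [FiniteDimensional ℝ G] {Λ X : Submodule ℤ G} (hΛ : Gap Λ) (hX : X ≤ Λ) :
    ∃ Y, X ≤ Y ∧ Y ≤ Λ ∧ rk Y = rk X ∧ covol Y ≤ covol X ∧
      Y = Λ ⊓ (Submodule.span ℝ (Y : Set G)).restrictScalars ℤ ∧
      Submodule.span ℝ (Y : Set G) = Submodule.span ℝ (X : Set G) := by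
  set Y := Λ ⊓ (Submodule.span ℝ (X : Set G)).restrictScalars ℤ with hY
  have h1 : X ≤ Y := le_inf hX (fun x hx => Submodule.subset_span hx)
  have h2 : Submodule.span ℝ (Y : Set G) = Submodule.span ℝ (X : Set G) := by
    apply le_antisymm
    · exact Submodule.span_le.2 fun y hy => hy.2
    · exact Submodule.span_mono h1
  have h3 : Y ≤ Λ := inf_le_left
  have h4 : rk Y = rk X := by rw [(hΛ.mono h3).rk_eq, h2, (hΛ.mono hX).rk_eq]
  exact ⟨Y, h1, h3, h4, covol_anti (hΛ.mono h3).fg h1 h4.symm, by rw [h2], h2⟩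

/-- Reduction to invariant sublattices. -/
theorem PP_of_invariant [FiniteDimensional ℝ G] {Λ : Submodule ℤ G} (hΛ : Gap Λ) (S : G →ₗ[ℝ] G)
    (hS : ∀ x y, inner ℝ (S x) (S y) = (inner ℝ x y : ℝ)) (hS2 : ∀ x, S (S x) = x)
    (hSΛ : ∀ x ∈ Λ, S x ∈ Λ) {c : ℝ} (hc : 0 ≤ c)
    (h : ∀ R ≤ Λ, (∀ x ∈ R, S x ∈ R) → c ^ rk R ≤ covol R) : PP Λ c := by
  intro X hX
  obtain ⟨Y, hXY, hYΛ, hrk, hcov, hsat, -⟩ := saturate hΛ hX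
  rw [← hrk]
  refine le_trans ?_ hcov
  set Z := mapZ S Y with hZ
  have hSinj : ∀ x, S x = 0 → x = 0 := fun x hx => by rw [← hS2 x, hx, map_zero]
  have hYf := (hΛ.mono hYΛ).fg
  have hZr : rk Z = rk Y := rk_map hYf S fun x _ hx => hSinj x hx
  have hZc : covol Z = covol Y := by
    have := covol_map hYf S 1 one_pos (fun x _ y _ => by rw [hS]; ring)
    rw [one_pow, one_mul] at this
    exact this
  have hspan : ∀ v ∈ Submodule.span ℝ (Z : Set G), S v ∈ Submodule.span ℝ (Y : Set G) := by
    intro v hv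
    induction hv using Submodule.span_induction with
    | mem x hx =>
      obtain ⟨y, hy, rfl⟩ := hx
      change S (S y) ∈ _
      rw [hS2]; exact Submodule.subset_span hy
    | zero => rw [map_zero]; exact Submodule.zero_mem _
    | add a b _ _ ha hb => rw [map_add]; exact Submodule.add_mem _ ha hb
    | smul a x _ hx => rw [map_smul]; exact Submodule.smul_mem _ _ hx
  have hZsat : Z = Λ ⊓ (Submodule.span ℝ (Z : Set G)).restrictScalars ℤ := by
    apply le_antisymm
    · refine le_inf ?_ (fun x hx => Submodule.subset_span hx)
      rintro _ ⟨y, hy, rfl⟩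
      exact hSΛ _ (hYΛ hy)
    · rintro v ⟨hv, hv'⟩
      have h1 := hspan v hv'
      have h2 : S v ∈ Y := by rw [hsat]; exact ⟨hSΛ v hv, h1⟩
      exact ⟨S v, h2, hS2 v⟩
  have hZΛ : Z ≤ Λ := by rw [hZsat]; exact inf_le_left
  have hYZ : ∀ y ∈ Y, S y ∈ Z := fun y hy => ⟨y, hy, rfl⟩
  have hZY : ∀ y ∈ Z, S y ∈ Y := by
    rintro _ ⟨y, hy, rfl⟩
    change S (S y) ∈ Y
    rw [hS2]; exact hy
  obtain ⟨h1, h2⟩ := submodular hΛ hYΛ hZsat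
  have h3 := h (Y ⊓ Z) (inf_le_left.trans hYΛ) (fun x hx => ⟨hZY x hx.2, hYZ x hx.1⟩)
  have h4 := h (Y ⊔ Z) (sup_le hYΛ hZΛ) (by
    intro x hx
    obtain ⟨y, hy, z, hz, rfl⟩ := Submodule.mem_sup.1 hx
    rw [map_add, add_comm]
    exact Submodule.add_mem_sup (hZY z hz) (hYZ y hy))
  have h5 : c ^ rk (Y ⊓ Z) * c ^ rk (Y ⊔ Z) ≤ covol Y * covol Y := by
    refine (mul_le_mul h3 h4 (by positivity) (covol_nonneg _)).trans (h1.trans ?_)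
    rw [hZc]
  rw [← pow_add, h2, hZr, pow_add] at h5
  exact (mul_self_le_mul_self_iff (by positivity) (covol_nonneg _)).2 h5

end P6

section P7
variable {V W G : Type*} [NormedAddCommGroup V] [InnerProductSpace ℝ V]
  [NormedAddCommGroup W] [InnerProductSpace ℝ W] [NormedAddCommGroup G] [InnerProductSpace ℝ G]
  [FiniteDimensional ℝ V] [FiniteDimensional ℝ W]
  {tp : V →ₗ[ℝ] W →ₗ[ℝ] G} {L : Submodule ℤ V} {M : Submodule ℤ W}
  {τ : V →ₗ[ℝ] V} {υ : W →ₗ[ℝ] W}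

/-! ### Dimension two -/

/-- Indefinite involutions. -/
def Indef (υ : W →ₗ[ℝ] W) : Prop := (∃ p, p ≠ 0 ∧ υ p = p) ∧ ∃ q, q ≠ 0 ∧ υ q = -q

theorem def_or_indef (hM : OU M υ) : (∃ ε : ℝ, (ε = 1 ∨ ε = -1) ∧ ∀ x, υ x = ε • x) ∨ Indef υ := by
  by_cases h1 : ∃ p, p ≠ 0 ∧ υ p = p
  · by_cases h2 : ∃ q, q ≠ 0 ∧ υ q = -q
    · exact Or.inr ⟨h1, h2⟩
    · left
      push Not at h2
      refine ⟨1, Or.inl rfl, fun x => ?_⟩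
      by_contra h3
      rw [one_smul] at h3
      refine h2 (υ x - x) (sub_ne_zero.2 h3) ?_
      rw [map_sub, hM.invol]; abel
  · left
    push Not at h1
    refine ⟨-1, Or.inr rfl, fun x => ?_⟩
    by_contra h3
    refine h1 (υ x + x) (fun h => h3 ?_) ?_
    · rw [neg_one_smul]; exact eq_neg_of_add_eq_zero_left h
    · rw [map_add, hM.invol]; abel

theorem orth_card {n : ℕ} (v : Fin n → W) (h0 : ∀ i, v i ≠ 0)
    (ho : ∀ i j, i ≠ j → (inner ℝ (v i) (v j) : ℝ) = 0) : n ≤ finrank ℝ W := by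
  have := linearIndependent_of_ne_zero_of_inner_eq_zero (𝕜 := ℝ) h0 (fun i j hij => ho i j hij)
  simpa using this.fintype_card_le_finrank

theorem orth3 (hd : finrank ℝ W = 2) {a b c : W} (ha : a ≠ 0) (hb : b ≠ 0)
    (hab : (inner ℝ a b : ℝ) = 0) (hac : (inner ℝ a c : ℝ) = 0) (hbc : (inner ℝ b c : ℝ) = 0) :
    c = 0 := by
  by_contra hc
  have := orth_card ![a, b, c] (by intro i; fin_cases i <;> simpa) (by
    intro i j hij
    fin_cases i <;> fin_cases j <;> simp_all [real_inner_comm])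
  omega

theorem line2 (hd : finrank ℝ W = 2) {u a z : W} (hu : u ≠ 0) (ha : a ≠ 0)
    (hua : (inner ℝ u a : ℝ) = 0) (huz : (inner ℝ u z : ℝ) = 0) : ∃ c : ℝ, z = c • a := by
  apply pw_eq_zero
  refine orth3 hd hu ha hua ?_ (pw_inner ha z)
  rw [pw_apply, inner_sub_right, huz, real_inner_smul_right, hua]; ring

theorem OU.map_ne (hM : OU M υ) {u : W} (hu : u ≠ 0) : υ u ≠ 0 := by
  rw [← norm_ne_zero_iff, hM.norm, norm_ne_zero_iff]; exact hu

theorem ou2_iso (hM : OU M υ) (hd : finrank ℝ W = 2) (hI : Indef υ) :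
    ∃ u, Prim M u ∧ (inner ℝ (υ u) u : ℝ) = 0 := by
  suffices hs : ∃ u ∈ M, u ≠ 0 ∧ (inner ℝ (υ u) u : ℝ) = 0 by
    obtain ⟨w, hw, hw0, hwi⟩ := hs
    obtain ⟨u, hu, n, hn, rfl⟩ := exists_prim hM.gap hw hw0
    refine ⟨u, hu, ?_⟩
    rw [map_zsmul, zsmul_eq, zsmul_eq, real_inner_smul_left, real_inner_smul_right] at hwi
    have hn' : (n:ℝ) ≠ 0 := by exact_mod_cast hn
    simpa [hn'] using hwi
  obtain ⟨⟨p, hp0, hp⟩, q, hq0, hq⟩ := hI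
  have hpq : (inner ℝ p q : ℝ) = 0 := by
    have := hM.isom p q
    rw [hp, hq, inner_neg_right] at this
    linarith
  have hqp : (inner ℝ q p : ℝ) = 0 := by rw [real_inner_comm]; exact hpq
  have hdec : ∀ x : W, ∃ α β : ℝ, x = α • p + β • q := by
    intro x
    obtain ⟨c, hc⟩ := line2 hd (u := p) (a := q) (z := pw p x) hp0 hq0 hpq (pw_inner hp0 x)
    rw [pw_apply] at hc
    exact ⟨_, c, by rw [← hc]; abel⟩
  obtain ⟨b0⟩ := exists_basis hM.gap.fg
  have hr : rk M = 2 := by rw [hM.rk_eq, hd]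
  let b : Basis (Fin 2) ℤ M := b0.reindex (finCongr hr)
  have hcov := covol_sq b
  rw [hM.covol_one] at hcov
  unfold gdet at hcov
  rw [Matrix.det_fin_two] at hcov
  simp only [Matrix.gram_apply] at hcov
  set e1 : W := ((b 0 : M) : W) with he1
  set e2 : W := ((b 1 : M) : W) with he2
  have hm1 : e1 ∈ M := (b 0).2
  have hm2 : e2 ∈ M := (b 1).2
  have hli := hM.gap.linInd b
  obtain ⟨i11, h11⟩ := hM.int e1 hm1 e1 hm1
  obtain ⟨i12, h12⟩ := hM.int e1 hm1 e2 hm2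
  obtain ⟨i22, h22⟩ := hM.int e2 hm2 e2 hm2
  have h21 : (inner ℝ (υ e2) e1 : ℝ) = i12 := by rw [hM.symm]; exact h12
  have hdisc : (i12:ℝ) ^ 2 - i11 * i22 = 1 := by
    obtain ⟨α, β, hx⟩ := hdec e1
    obtain ⟨α', β', hy⟩ := hdec e2
    rw [hx, hy] at hcov
    rw [← h11, ← h12, ← h22, hx, hy]
    simp only [map_add, map_smul, hp, hq, inner_add_left, inner_add_right, real_inner_smul_left,
      real_inner_smul_right, hpq, hqp, smul_neg, inner_neg_left] at hcov ⊢
    linear_combination -hcov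
  by_cases h0 : i11 = 0
  · exact ⟨e1, hm1, hli.ne_zero 0, by rw [h11, h0]; simp⟩
  · refine ⟨(1 - i12) • e1 + i11 • e2, M.add_mem (M.smul_mem _ hm1) (M.smul_mem _ hm2), ?_, ?_⟩
    · intro h
      have h3 := Fintype.linearIndependent_iff.1 hli ![((1 - i12 : ℤ) : ℝ), (i11 : ℝ)] (by
        rw [Fin.sum_univ_two]
        simp only [Matrix.cons_val_zero, Matrix.cons_val_one]
        rw [← zsmul_eq, ← zsmul_eq]
        exact h) 1
      have h4 : (i11 : ℝ) = 0 := h3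
      exact h0 (by exact_mod_cast h4)
    · simp only [zsmul_eq, map_add, map_smul, inner_add_left, inner_add_right,
        real_inner_smul_left, real_inner_smul_right, h11, h12, h21, h22]
      push_cast
      linear_combination (-(i11:ℝ)) * hdisc

/-- The flag of an isotropic vector in dimension two. -/
theorem flag2 [FiniteDimensional ℝ G] (h : IsTensor tp) (hL : Gap L) (hM : OU M υ)
    (hd : finrank ℝ W = 2) {u : W}
    (hu : Prim M u) (hui : (inner ℝ (υ u) u : ℝ) = 0) {γ : ℝ} (hγ0 : 0 ≤ γ) (hγ : PP L γ)
    {Λ : Submodule ℤ G} (hΛ : Λ ≤ tensorLat tp L M) :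
    γ ^ rk Λ * ‖u‖ ^ rk (Λ ⊓ kerZ (con tp (υ u))) ≤
      ‖u‖ ^ rk (mapZ (con tp (υ u)) Λ) * covol Λ := by
  have hg := (tensor_gap h hL hM.gap).mono hΛ
  have hu0 := hu.2.1
  have hun : 0 < ‖u‖ := norm_pos_iff.2 hu0
  have huu0 := hM.map_ne hu0
  set A := Λ ⊓ kerZ (con tp (υ u)) with hA
  have hAg : Gap A := hg.mono inf_le_left
  have h1 := flag_step h hg.fg (υ u) (υ u) huu0 (fun _ _ => rfl)
  rw [hM.norm] at h1
  have h2 : mapZ (con tp (υ u)) Λ ≤ L := by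
    rintro _ ⟨w, hw, rfl⟩
    exact con_lat h (hM.mem_dual hu.1) (hΛ hw)
  obtain ⟨v, hv, huv⟩ := hM.prim hu
  have hvu : (inner ℝ u (υ v) : ℝ) = 1 := by rw [real_inner_comm, ← hM.symm]; exact huv
  have huui : (inner ℝ u (υ u) : ℝ) = 0 := by rw [real_inner_comm]; exact hui
  have h3 := flag_step h hAg.fg (υ v) ((‖u‖ ^ 2)⁻¹ • u)
    (smul_ne_zero (by positivity) hu0) (by
      rintro w ⟨-, hw⟩
      have hw' : con tp (υ u) w = 0 := hw
      obtain ⟨c, hc⟩ := line2 hd (u := u) (a := υ u) (z := υ v - (‖u‖ ^ 2)⁻¹ • u) hu0 huu0 huui (by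
        rw [inner_sub_right, hvu, real_inner_smul_right, real_inner_self_eq_norm_sq]
        field_simp
        ring)
      rw [← sub_eq_zero, ← con_sub, hc, con_smul, hw', smul_zero])
  have h4 : A ⊓ kerZ (con tp (υ v)) = ⊥ := by
    rw [eq_bot_iff]
    rintro w ⟨⟨-, hw1⟩, hw2⟩
    have hw1' : con tp (υ u) w = 0 := hw1
    have hw2' : con tp (υ v) w = 0 := hw2
    refine con_sep h fun f => ?_
    obtain ⟨c, hc⟩ := line2 hd (u := u) (a := υ u) (z := f - (inner ℝ u f : ℝ) • υ v) hu0 huu0 huui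
      (by rw [inner_sub_right, real_inner_smul_right, hvu]; ring)
    have : con tp (f - (inner ℝ u f : ℝ) • υ v) w = 0 := by rw [hc, con_smul, hw1', smul_zero]
    rwa [con_sub, con_smul, hw2', smul_zero, sub_zero] at this
  have h5 : mapZ (con tp (υ v)) A ≤ L := by
    rintro _ ⟨w, hw, rfl⟩
    exact con_lat h (hM.mem_dual hv) (hΛ hw.1)
  have h6 := rk_add hAg.fg (con tp (υ v))
  rw [h4, rk_bot, zero_add] at h6
  have hnorm : ‖(‖u‖ ^ 2)⁻¹ • u‖ = ‖u‖⁻¹ := by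
    rw [norm_smul, norm_inv, norm_pow, norm_norm]; field_simp
  rw [h4, covol_bot, one_mul, ← h6, hnorm, inv_pow, inv_mul_eq_div, le_div_iff₀ (by positivity)] at h3
  have h7 := hγ _ h5
  rw [← h6] at h7
  have h8 := hγ _ h2
  have h9 := rk_add hg.fg (con tp (υ u))
  rw [h9, pow_add]
  calc γ ^ rk A * γ ^ rk (mapZ (con tp (υ u)) Λ) * ‖u‖ ^ rk A
      = (γ ^ rk A * ‖u‖ ^ rk A) * γ ^ rk (mapZ (con tp (υ u)) Λ) := by ring
    _ ≤ (covol (mapZ (con tp (υ v)) A) * ‖u‖ ^ rk A) * covol (mapZ (con tp (υ u)) Λ) := by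
        gcongr
        exact mul_nonneg (covol_nonneg _) (by positivity)
    _ ≤ covol A * covol (mapZ (con tp (υ u)) Λ) := by
        gcongr
        exact covol_nonneg _
    _ ≤ _ := h1

theorem two_fin {γ δ x c : ℝ} {r r1 r2 : ℕ} (hγ : 0 ≤ γ) (hδ : 0 ≤ δ) (hδ1 : δ ≤ 1) (hx : 0 < x)
    (hδx : δ ≤ x) (hr : r1 ≤ r) (h12 : r2 ≤ r1) (h : γ ^ r * x ^ r1 ≤ x ^ r2 * c) :
    (γ * δ) ^ r ≤ c := by
  obtain ⟨k, rfl⟩ := Nat.exists_eq_add_of_le h12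
  have h1 : γ ^ r * x ^ k ≤ c := by
    rw [pow_add] at h
    have : 0 < x ^ r2 := by positivity
    nlinarith
  rw [mul_pow]
  refine le_trans ?_ h1
  gcongr
  calc δ ^ r ≤ δ ^ k := pow_le_pow_of_le_one hδ hδ1 (by omega)
    _ ≤ x ^ k := by gcongr

theorem PP.le_norm {c : ℝ} (h : PP M c) {u : W} (hu : u ∈ M) (hu0 : u ≠ 0) : c ≤ ‖u‖ := by
  have := h (Submodule.span ℤ {u}) (Submodule.span_le.2 (by simpa using hu))
  rwa [rk_singleton hu0, covol_singleton hu0, pow_one] at this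

/-- One of the lattices is an indefinite plane. -/
theorem case_two (h : IsTensor tp) (hL : Gap L) (hM : OU M υ) (hd : finrank ℝ W = 2)
    (hI : Indef υ) {γ δ : ℝ} (hγ0 : 0 ≤ γ) (hδ0 : 0 ≤ δ) (hδ1 : δ ≤ 1) (hγ : PP L γ)
    (hδ : PP M δ) : PP (tensorLat tp L M) (γ * δ) := by
  have := h.fd
  have hg := tensor_gap h hL hM.gap
  obtain ⟨u, hu, hui⟩ := ou2_iso hM hd hI
  have hu0 := hu.2.1
  have hun : 0 < ‖u‖ := norm_pos_iff.2 hu0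
  have huu0 := hM.map_ne hu0
  obtain ⟨v, hv, huv⟩ := hM.prim hu
  obtain ⟨k, hk⟩ := hM.int v hv v hv
  have huui : (inner ℝ u (υ u) : ℝ) = 0 := by rw [real_inner_comm]; exact hui
  have hvu : (inner ℝ u (υ v) : ℝ) = 1 := by rw [real_inner_comm, ← hM.symm]; exact huv
  -- structure of `v`
  have hN : (inner ℝ u u : ℝ) = ‖u‖ ^ 2 := real_inner_self_eq_norm_sq u
  have hvdec : ∃ a : ℝ, v = a • u + (‖u‖ ^ 2)⁻¹ • υ u := by
    obtain ⟨a, ha⟩ := line2 hd (u := υ u) (a := u) (z := v - (‖u‖ ^ 2)⁻¹ • υ u) huu0 hu0 hui (by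
      rw [inner_sub_right, huv, real_inner_smul_right, hM.isom, hN]
      field_simp
      ring)
    exact ⟨a, by rw [← ha]; abel⟩
  obtain ⟨a, ha⟩ := hvdec
  have hka : (k:ℝ) = 2 * a := by
    rw [← hk, ha]
    simp only [map_add, map_smul, hM.invol, inner_add_left, inner_add_right,
      real_inner_smul_left, real_inner_smul_right, hM.isom, hui, huui, hN]
    field_simp
    ring
  have hkey : (2:ℝ) • v - (k:ℝ) • u = (2 * (‖u‖ ^ 2)⁻¹) • υ u := by
    rw [hka, ha, smul_add, smul_smul, smul_smul]; abel
  have hmem : (2:ℝ) • v - (k:ℝ) • u ∈ M := by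
    have h2 : (2:ℝ) • v = (2:ℤ) • v := by rw [zsmul_eq]; norm_num
    rw [h2, ← zsmul_eq]
    exact M.sub_mem (M.smul_mem _ hv) (M.smul_mem _ hu.1)
  have hne : (2:ℝ) • v - (k:ℝ) • u ≠ 0 := by
    rw [hkey]; exact smul_ne_zero (by positivity) huu0
  obtain ⟨u', hu', n, hn, hun'⟩ := exists_prim hM.gap hmem hne
  have hn' : (n:ℝ) ≠ 0 := by exact_mod_cast hn
  obtain ⟨d, hd0, hdu⟩ : ∃ d : ℝ, d ≠ 0 ∧ u' = d • υ u := by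
    refine ⟨(n:ℝ)⁻¹ * (2 * (‖u‖ ^ 2)⁻¹), by positivity, ?_⟩
    rw [mul_smul, ← hkey, hun', zsmul_eq, smul_smul, inv_mul_cancel₀ hn', one_smul]
  have hu'i : (inner ℝ (υ u') u' : ℝ) = 0 := by
    rw [hdu, map_smul, hM.invol, real_inner_smul_left, real_inner_smul_right, huui]; ring
  have hυu' : υ u' = d • u := by rw [hdu, map_smul, hM.invol]
  -- the reflection
  let σ : W →ₗ[ℝ] W := LinearMap.id - (2:ℝ) • pw u
  have hσ : ∀ z, σ z = z - (2:ℝ) • pw u z := fun z => rfl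
  have hpwpw : ∀ z, pw u (pw u z) = pw u z := by
    intro z
    conv_lhs => rw [pw_apply, pw_inner hu0]
    simp
  have hσ2 : ∀ z, σ (σ z) = z := by
    intro z
    simp only [hσ, map_sub, map_smul, hpwpw]
    module
  have hσi : ∀ x y, (inner ℝ (σ x) (σ y) : ℝ) = inner ℝ x y := by
    intro x y
    simp only [hσ, pw_apply]
    simp only [inner_sub_left, inner_sub_right, real_inner_smul_left, real_inner_smul_right, hN,
      real_inner_comm u]
    field_simp
    ring
  have hσM : ∀ z ∈ M, σ z ∈ M := by
    intro z hz
    obtain ⟨m, hm⟩ := hM.int u hu.1 z hz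
    obtain ⟨c, hc⟩ := line2 hd (u := υ u) (a := u) (z := z - (m:ℝ) • v) huu0 hu0 hui (by
      rw [inner_sub_right, hm, real_inner_smul_right, huv]; ring)
    have hcM : c • u ∈ M := by
      rw [← hc, ← zsmul_eq]; exact M.sub_mem hz (M.smul_mem _ hv)
    obtain ⟨j, hj⟩ := hu.2.2 c hcM
    have hz' : z = (m:ℝ) • v + (j:ℝ) • u := by rw [← hj, ← hc]; abel
    have e : σ z = (m * k + 2 * j : ℤ) • u - z := by
      have huv' : (inner ℝ u v : ℝ) = a * ‖u‖ ^ 2 := by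
        rw [ha, inner_add_right, real_inner_smul_right, real_inner_smul_right, huui, hN]; ring
      rw [hσ, pw_apply, hz', inner_add_right, real_inner_smul_right, real_inner_smul_right, hN,
        huv', zsmul_eq]
      have : ((m:ℝ) * (a * ‖u‖ ^ 2) + j * ‖u‖ ^ 2) / ‖u‖ ^ 2 = m * a + j := by
        field_simp
      rw [this]
      push_cast
      rw [hka]
      module
    rw [e]
    exact M.sub_mem (M.smul_mem _ hu.1) hz
  set S := tmap h LinearMap.id σ with hS
  have hSS : ∀ w, S (S w) = w := by
    refine h.ind (by simp) (fun x y => ?_) (fun a b ha hb => by rw [map_add, map_add, ha, hb])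
    rw [hS, tmap_tp, tmap_tp, hσ2]; rfl
  have hSu : ∀ w, con tp u (S w) = con tp u w := by
    refine h.ind (by simp) (fun x y => ?_) (fun a b ha hb => by
      rw [map_add, map_add, ha, hb, map_add])
    rw [hS, tmap_tp, con_tp h, con_tp h, hσ, inner_sub_right, real_inner_smul_right, pw_inner hu0]
    simp
  have hSu' : ∀ w, con tp (υ u) (S w) = - con tp (υ u) w := by
    refine h.ind (by simp) (fun x y => ?_) (fun a b ha hb => by
      rw [map_add, map_add, ha, hb, map_add]; abel)
    rw [hS, tmap_tp, con_tp h, con_tp h, hσ, inner_sub_right, real_inner_smul_right, pw_apply,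
      inner_sub_right, real_inner_smul_right, hui, ← neg_smul]
    congr 1
    ring
  refine PP_of_invariant hg S (tmap_isom h (fun _ _ => rfl) hσi) hSS
    (tmap_lat h (fun _ hx => hx) hσM) (by positivity) fun R hR hinv => ?_
  have hRg := hg.mono hR
  -- rank inequalities
  have hrank : ∀ (f g : W), (∀ w, con tp f (S w) = con tp f w) → (∀ w, con tp g (S w) = - con tp g w) →
      rk (mapZ (con tp g) R) ≤ rk (R ⊓ kerZ (con tp f)) ∧
      rk (mapZ (con tp f) R) ≤ rk (R ⊓ kerZ (con tp g)) := by
    intro f g hf hg'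
    have aux : ∀ (f g : W) (ε : ℝ), (∀ w ∈ R, S w ∈ R) → (ε = 1 ∨ ε = -1) →
        (∀ w, con tp f (S w) = ε • con tp f w) → (∀ w, con tp g (S w) = (- ε) • con tp g w) →
        rk (mapZ (con tp g) R) ≤ rk (R ⊓ kerZ (con tp f)) := by
      intro f g ε _ hε hf hg'
      have hε2 : ε * ε = 1 := by rcases hε with rfl | rfl <;> norm_num
      have hf1 := fg_mapZ hRg.fg (con tp g)
      set B := R ⊓ kerZ (con tp f) with hB
      have hBg : Gap B := hRg.mono inf_le_left
      have e1 : rk (mapZ ((2:ℝ) • LinearMap.id) (mapZ (con tp g) R)) = rk (mapZ (con tp g) R) := by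
        apply rk_map hf1
        intro x _ hx
        have : (2:ℝ) • x = 0 := hx
        simpa using this
      rw [← e1]
      have e2 : mapZ ((2:ℝ) • LinearMap.id) (mapZ (con tp g) R) ≤ mapZ (con tp g) B := by
        rintro _ ⟨_, ⟨w, hw, rfl⟩, rfl⟩
        change (2:ℝ) • con tp g w ∈ _
        have hεS : ε • S w ∈ R := by
          rcases hε with rfl | rfl
          · rw [one_smul]; exact hinv w hw
          · rw [neg_one_smul]; exact R.neg_mem (hinv w hw)
        refine ⟨w - ε • S w, ⟨R.sub_mem hw hεS, ?_⟩, ?_⟩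
        · change con tp f (w - ε • S w) = 0
          rw [map_sub, map_smul, hf, smul_smul, hε2, one_smul, sub_self]
        · change con tp g (w - ε • S w) = _
          rw [map_sub, map_smul, hg', smul_smul, mul_neg, hε2]
          module
      refine (rk_mono (fg_mapZ hBg.fg _) e2).trans ?_
      have := rk_add hBg.fg (con tp g)
      omega
    exact ⟨aux f g 1 hinv (Or.inl rfl) (fun w => by rw [hf, one_smul])
        (fun w => by rw [hg', neg_one_smul]),
      aux g f (-1) hinv (Or.inr rfl) (fun w => by rw [hg', neg_one_smul])
        (fun w => by rw [hf, neg_neg, one_smul])⟩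
  obtain ⟨hr1, hr2⟩ := hrank u (υ u) hSu hSu'
  have hker : R ⊓ kerZ (con tp (υ u')) = R ⊓ kerZ (con tp u) := by
    ext w
    simp only [Submodule.mem_inf, mem_kerZ, hυu', con_smul, smul_eq_zero, hd0, false_or]
  have hr3 : rk R = rk (R ⊓ kerZ (con tp (υ u))) + rk (mapZ (con tp (υ u)) R) := rk_add hRg.fg _
  have hr4 : rk R = rk (R ⊓ kerZ (con tp u)) + rk (mapZ (con tp u) R) := rk_add hRg.fg _
  have hr5 : rk R = rk (R ⊓ kerZ (con tp (υ u'))) + rk (mapZ (con tp (υ u')) R) := rk_add hRg.fg _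
  rw [hker] at hr5
  by_cases hcase : rk (R ⊓ kerZ (con tp u)) ≤ rk (R ⊓ kerZ (con tp (υ u)))
  · exact two_fin hγ0 hδ0 hδ1 hun (hδ.le_norm hu.1 hu0) (by omega) (by omega)
      (flag2 h hL hM hd hu hui hγ0 hγ hR)
  · have hf := flag2 h hL hM hd hu' hu'i hγ0 hγ hR
    rw [hker] at hf
    exact two_fin hγ0 hδ0 hδ1 (norm_pos_iff.2 hu'.2.1) (hδ.le_norm hu'.1 hu'.2.1) (by omega)
      (by omega) hf

end P7

section P8
variable {V W G : Type*} [NormedAddCommGroup V] [InnerProductSpace ℝ V]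
  [NormedAddCommGroup W] [InnerProductSpace ℝ W] [NormedAddCommGroup G] [InnerProductSpace ℝ G]
  [FiniteDimensional ℝ V] [FiniteDimensional ℝ W]
  {tp : V →ₗ[ℝ] W →ₗ[ℝ] G} {L : Submodule ℤ V} {M : Submodule ℤ W}
  {τ : V →ₗ[ℝ] V} {υ : W →ₗ[ℝ] W}

/-! ### Dimension three: flags -/

theorem orth4 (hd : finrank ℝ W = 3) {a b c d : W} (ha : a ≠ 0) (hb : b ≠ 0) (hc : c ≠ 0)
    (hab : (inner ℝ a b : ℝ) = 0) (hac : (inner ℝ a c : ℝ) = 0) (hbc : (inner ℝ b c : ℝ) = 0)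
    (had : (inner ℝ a d : ℝ) = 0) (hbd : (inner ℝ b d : ℝ) = 0) (hcd : (inner ℝ c d : ℝ) = 0) :
    d = 0 := by
  by_contra h0
  have := orth_card ![a, b, c, d] (by
    intro i; fin_cases i
    · exact ha
    · exact hb
    · exact hc
    · exact h0) (by
    intro i j hij
    have hba := hab
    have hca := hac
    have hcb := hbc
    have hda := had
    have hdb := hbd
    have hdc := hcd
    rw [real_inner_comm] at hba hca hcb hda hdb hdc
    fin_cases i <;> fin_cases j <;> first | exact absurd rfl hij | assumption)
  omega

/-- There are no isotropic planes in dimension three. -/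
theorem no_plane (hM : OU M υ) (hd : finrank ℝ W = 3) {x y : W} (hx : x ≠ 0)
    (hxx : (inner ℝ (υ x) x : ℝ) = 0) (hxy : (inner ℝ (υ x) y : ℝ) = 0)
    (hyy : (inner ℝ (υ y) y : ℝ) = 0) : pw x y = 0 := by
  by_contra h0
  have h1 : (inner ℝ x (pw x y) : ℝ) = 0 := pw_inner hx y
  have h2 : (inner ℝ (υ x) (pw x y) : ℝ) = 0 := by
    rw [pw_apply, inner_sub_right, real_inner_smul_right, hxy, hxx]; ring
  have h3 : (inner ℝ (υ (pw x y)) (pw x y) : ℝ) = 0 := by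
    have hyx : (inner ℝ (υ y) x : ℝ) = 0 := by rw [hM.symm]; exact hxy
    rw [pw_apply]
    simp only [map_sub, map_smul, inner_sub_right, inner_sub_left, real_inner_smul_right,
      real_inner_smul_left, hxy, hxx, hyy, hyx]
    ring
  have h4 := orth4 hd (a := x) (b := υ x) (c := pw x y) (d := υ (pw x y)) hx (hM.map_ne hx) h0
    (by rw [real_inner_comm]; exact hxx) h1 h2 (by rw [real_inner_comm, hM.symm]; exact h2)
    (by rw [hM.isom]; exact h1) (by rw [real_inner_comm]; exact h3)
  exact hM.map_ne h0 h4

theorem rk_one_gen {X : Submodule ℤ V} (hX : Gap X) (h : rk X = 1) :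
    ∃ g ∈ X, g ≠ 0 ∧ covol X = ‖g‖ ∧ ∀ v ∈ X, ∃ c : ℝ, v = c • g := by
  obtain ⟨b0⟩ := exists_basis hX.fg
  let b : Basis (Fin 1) ℤ X := b0.reindex (finCongr h)
  have hc := covol_eq b
  have hli := hX.linInd b
  refine ⟨(b 0 : X), (b 0).2, hli.ne_zero 0, ?_, fun v hv => ?_⟩
  · rw [hc]
    unfold gdet
    rw [Matrix.det_fin_one, Matrix.gram_apply, real_inner_self_eq_norm_sq,
      Real.sqrt_sq (norm_nonneg _)]
  · have := repr_sum b ⟨v, hv⟩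
    rw [Fin.sum_univ_one] at this
    exact ⟨_, this⟩

/-- The lattice orthogonal to a primitive vector for the bilinear form. -/
theorem perp_facts (hM : OU M υ) (hd : finrank ℝ W = 3) {y : W} (hy : Prim M y) :
    rk (M ⊓ kerZ (innerₗ W (υ y))) = 2 ∧ covol (M ⊓ kerZ (innerₗ W (υ y))) ≤ ‖y‖ := by
  have himg : mapZ (innerₗ W (υ y)) M = Submodule.span ℤ {(1:ℝ)} := by
    apply le_antisymm
    · rintro _ ⟨z, hz, rfl⟩
      obtain ⟨n, hn⟩ := hM.int y hy.1 z hz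
      rw [Submodule.mem_span_singleton]
      exact ⟨n, by simpa using hn.symm⟩
    · rw [Submodule.span_le]
      rintro _ rfl
      obtain ⟨z, hz, h1⟩ := hM.prim hy
      exact ⟨z, hz, h1⟩
  have hyn : 0 < ‖y‖ := norm_pos_iff.2 hy.2.1
  have h1 := rk_add hM.gap.fg (innerₗ W (υ y))
  have h2 := covol_ge_scaled hM.gap.fg (innerₗ W (υ y)) ‖y‖ hyn (fun v _ => by
    have := norm_inner_le_norm (𝕜 := ℝ) (υ y) v
    rw [hM.norm] at this
    exact this)
  rw [himg, rk_singleton one_ne_zero] at h1 h2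
  rw [covol_singleton one_ne_zero, hM.covol_one] at h2
  rw [hM.rk_eq, hd] at h1
  simp at h2
  exact ⟨by omega, h2⟩

/-- Isotropic case: the orthogonal lattice has covolume at least the norm. -/
theorem perp_covol (hM : OU M υ) (hd : finrank ℝ W = 3) {y : W} (hy : Prim M y)
    (hyy : (inner ℝ (υ y) y : ℝ) = 0) {X : Submodule ℤ W} (hX : X ≤ M)
    (hXy : ∀ z ∈ X, (inner ℝ (υ y) z : ℝ) = 0) (hr : rk X = 2) : ‖y‖ ≤ covol X := by
  obtain ⟨h1, h2⟩ := perp_facts hM hd hy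
  set K := M ⊓ kerZ (innerₗ W (υ y)) with hK
  have hKg : Gap K := hM.gap.mono inf_le_left
  have hXK : X ≤ K := fun z hz => ⟨hX hz, hXy z hz⟩
  refine le_trans ?_ (covol_anti hKg.fg hXK (by omega))
  have hyK : Prim K y := ⟨⟨hy.1, hyy⟩, hy.2.1, fun c hc => hy.2.2 c hc.1⟩
  have h3 := covol_ge_prim hKg.fg hyK
  have h4 := rk_prim hKg.fg hyK
  have hlow : ∀ n ∈ mapZ (pw y) K, n ≠ 0 → 1 ≤ ‖n‖ ^ 2 := by
    rintro _ ⟨z, hz, rfl⟩ hn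
    change pw y z ≠ 0 at hn
    change 1 ≤ ‖pw y z‖ ^ 2
    have hz1 : (inner ℝ (υ y) z : ℝ) = 0 := hz.2
    have hzy : (inner ℝ (υ z) y : ℝ) = 0 := by rw [hM.symm]; exact hz1
    have e1 : (inner ℝ y (pw y z) : ℝ) = 0 := pw_inner hy.2.1 z
    have e2 : (inner ℝ (υ y) (pw y z) : ℝ) = 0 := by
      rw [pw_apply, inner_sub_right, real_inner_smul_right, hz1, hyy]; ring
    have e3 : (inner ℝ (υ (pw y z)) (pw y z) : ℝ) = inner ℝ (υ z) z := by
      rw [pw_apply]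
      simp only [map_sub, map_smul, inner_sub_right, inner_sub_left, real_inner_smul_right,
        real_inner_smul_left, hz1, hyy, hzy]
      ring
    have e4 : (inner ℝ (υ z) z : ℝ) ≠ 0 := fun h0 => hn (no_plane hM hd hy.2.1 hyy hz1 h0)
    obtain ⟨n, hn'⟩ := hM.int z hz.1 z hz.1
    rw [hn'] at e4 e3
    have hn0 : n ≠ 0 := by exact_mod_cast e4
    have e5 : (1:ℝ) ≤ |(n:ℝ)| := by exact_mod_cast Int.one_le_abs hn0
    have e6 := abs_real_inner_le_norm (υ (pw y z)) (pw y z)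
    rw [e3, hM.norm, ← sq] at e6
    linarith
  have hg := gap_of_sq one_pos hlow
  obtain ⟨g, hg1, hg0, hg2, -⟩ := rk_one_gen hg (by omega)
  have h5 := hlow g hg1 hg0
  have h6 : 1 ≤ ‖g‖ := by nlinarith [norm_nonneg g]
  rw [hg2] at h3
  nlinarith [norm_nonneg y]

/-- The slice `{e : e ⊗ y ∈ Λ}`. -/
def sec (tp : V →ₗ[ℝ] W →ₗ[ℝ] G) (Λ : Submodule ℤ G) (y : W) : Submodule ℤ V :=
  Λ.comap ((tp.flip y).restrictScalars ℤ)

theorem mem_sec {Λ : Submodule ℤ G} {y : W} {e : V} : e ∈ sec tp Λ y ↔ tp e y ∈ Λ := Iff.rfl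

/-- The flag inequality in dimension three. -/
theorem flag3 [FiniteDimensional ℝ G] (h : IsTensor tp) (hL : Gap L) (hM : OU M υ)
    (hd : finrank ℝ W = 3) {y v : W} (hy : Prim M y) (hv : Prim M v)
    (hvy : (inner ℝ (υ v) y : ℝ) = 0) {Λ : Submodule ℤ G} (hΛ : Λ ≤ tensorLat tp L M) :
    sec tp Λ y ≤ L ∧ mapZ (con tp (υ v)) Λ ≤ L ∧ ∃ X ≤ L,
      rk Λ = rk (sec tp Λ y) + rk X + rk (mapZ (con tp (υ v)) Λ) ∧
      ‖v‖ ^ rk X * ‖y‖ ^ rk (sec tp Λ y) *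
        (covol (sec tp Λ y) * covol X * covol (mapZ (con tp (υ v)) Λ)) ≤
      ‖v‖ ^ rk (mapZ (con tp (υ v)) Λ) * ‖y‖ ^ rk X * covol Λ := by
  have hg := (tensor_gap h hL hM.gap).mono hΛ
  have hy0 := hy.2.1
  have hv0 := hv.2.1
  have hyn : 0 < ‖y‖ := norm_pos_iff.2 hy0
  have hvn : 0 < ‖v‖ := norm_pos_iff.2 hv0
  have hyv : (inner ℝ (υ y) v : ℝ) = 0 := by rw [hM.symm]; exact hvy
  -- the vector `z`
  obtain ⟨k1, k2⟩ := perp_facts hM hd hy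
  set K := M ⊓ kerZ (innerₗ W (υ y)) with hK
  have hKg : Gap K := hM.gap.mono inf_le_left
  have hvK : Prim K v := ⟨⟨hv.1, hyv⟩, hv0, fun c hc => hv.2.2 c hc.1⟩
  have k3 := covol_ge_prim hKg.fg hvK
  have k4 := rk_prim hKg.fg hvK
  have hKpg : ∃ g ∈ mapZ (pw v) K, g ≠ 0 ∧ covol (mapZ (pw v) K) = ‖g‖ := by
    obtain ⟨b0⟩ := exists_basis (fg_mapZ hKg.fg (pw v))
    let b : Basis (Fin 1) ℤ (mapZ (pw v) K) := b0.reindex (finCongr (by omega))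
    refine ⟨(b 0 : mapZ (pw v) K), (b 0).2, ?_, ?_⟩
    · intro h0
      exact b.ne_zero 0 (Subtype.ext h0)
    · rw [covol_eq b]
      unfold gdet
      rw [Matrix.det_fin_one, Matrix.gram_apply, real_inner_self_eq_norm_sq,
        Real.sqrt_sq (norm_nonneg _)]
  obtain ⟨g, ⟨z, hz, hzg⟩, hg0, hgc⟩ := hKpg
  change pw v z = g at hzg
  have hzy : (inner ℝ (υ y) z : ℝ) = 0 := hz.2
  have hyz : (inner ℝ (υ z) y : ℝ) = 0 := by rw [hM.symm]; exact hzy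
  have hgn : ‖g‖ * ‖v‖ ≤ ‖y‖ := by rw [← hgc, mul_comm]; exact k3.trans k2
  have hgυ : ∃ c : ℝ, υ g = υ z - c • υ v := by
    refine ⟨(inner ℝ v z : ℝ) / ‖v‖ ^ 2, ?_⟩
    rw [← hzg, pw_apply, map_sub, map_smul]
  obtain ⟨c0, hc0⟩ := hgυ
  -- first step
  have s1 := flag_step h hg.fg (υ v) (υ v) (hM.map_ne hv0) (fun _ _ => rfl)
  rw [hM.norm] at s1
  have l3 : mapZ (con tp (υ v)) Λ ≤ L := by
    rintro _ ⟨w, hw, rfl⟩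
    exact con_lat h (hM.mem_dual hv.1) (hΛ hw)
  set A := Λ ⊓ kerZ (con tp (υ v)) with hA
  have hAg : Gap A := hg.mono inf_le_left
  have t1 := rk_add hg.fg (con tp (υ v))
  rw [← hA] at t1
  -- second step
  have s2 := flag_step h hAg.fg (υ z) (υ g) (hM.map_ne hg0) (by
    rintro w ⟨-, hw⟩
    have hw' : con tp (υ v) w = 0 := hw
    rw [hc0, con_sub, con_smul, hw', smul_zero, sub_zero])
  rw [hM.norm] at s2
  have l2 : mapZ (con tp (υ z)) A ≤ L := by
    rintro _ ⟨w, hw, rfl⟩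
    exact con_lat h (hM.mem_dual hz.1) (hΛ hw.1)
  set B := A ⊓ kerZ (con tp (υ z)) with hB
  have hBg : Gap B := hAg.mono inf_le_left
  have t2 := rk_add hAg.fg (con tp (υ z))
  rw [← hB] at t2
  set X := mapZ (con tp (υ z)) A with hX
  -- third step
  obtain ⟨w0, hw0, hw1⟩ := hM.prim hy
  have hw2 : (inner ℝ (υ w0) y : ℝ) = 1 := by rw [hM.symm]; exact hw1
  have key : ∀ f : W, (inner ℝ f y : ℝ) = 0 → ∀ w ∈ B, con tp f w = 0 := by
    intro f hf w hw
    have hwv : con tp (υ v) w = 0 := hw.1.2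
    have hwz : con tp (υ z) w = 0 := hw.2
    have hwg : con tp (υ g) w = 0 := by rw [hc0, con_sub, con_smul, hwv, hwz]; simp
    have hvg : (inner ℝ (υ v) (υ g) : ℝ) = 0 := by rw [hM.isom, ← hzg]; exact pw_inner hv0 z
    have hyg : (inner ℝ y (υ g) : ℝ) = 0 := by
      rw [real_inner_comm, hc0, inner_sub_left, real_inner_smul_left, hyz, hvy]; ring
    have hyv' : (inner ℝ y (υ v) : ℝ) = 0 := by rw [real_inner_comm]; exact hvy
    have hvv : (inner ℝ (υ v) (υ v) : ℝ) ≠ 0 := by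
      rw [real_inner_self_eq_norm_sq]; have := norm_pos_iff.2 (hM.map_ne hv0); positivity
    have hgg : (inner ℝ (υ g) (υ g) : ℝ) ≠ 0 := by
      rw [real_inner_self_eq_norm_sq]; have := norm_pos_iff.2 (hM.map_ne hg0); positivity
    have hgv : (inner ℝ (υ g) (υ v) : ℝ) = 0 := by rw [real_inner_comm]; exact hvg
    have e := orth4 hd (a := y) (b := υ v) (c := υ g)
      (d := f - ((inner ℝ (υ v) f : ℝ) / inner ℝ (υ v) (υ v)) • υ v
        - ((inner ℝ (υ g) f : ℝ) / inner ℝ (υ g) (υ g)) • υ g) hy0 (hM.map_ne hv0) (hM.map_ne hg0)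
      hyv' hyg hvg
      (by simp only [inner_sub_right, real_inner_smul_right, hyv', hyg]
          rw [real_inner_comm, hf]; ring)
      (by simp only [inner_sub_right, real_inner_smul_right, hvg]
          field_simp; ring)
      (by simp only [inner_sub_right, real_inner_smul_right, hgv]
          field_simp; ring)
    have e2 := con_zero (tp := tp) w
    rw [← e, con_sub, con_sub, con_smul, con_smul, hwv, hwg] at e2
    simpa using e2
  have hyy : (inner ℝ y y : ℝ) = ‖y‖ ^ 2 := real_inner_self_eq_norm_sq y
  have hB1 : ∀ w ∈ B, w = tp (con tp (υ w0) w) y := by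
    intro w hw
    rw [← sub_eq_zero]
    refine con_sep h fun f => ?_
    have e := key (f - (inner ℝ f y : ℝ) • υ w0) (by
      rw [inner_sub_left, real_inner_smul_left, hw2]; ring) w hw
    rw [con_sub, con_smul] at e
    rw [map_sub, con_tp h]; exact e
  have hsec : mapZ (con tp (υ w0)) B = sec tp Λ y := by
    apply le_antisymm
    · rintro _ ⟨w, hw, rfl⟩
      have := hw.1.1
      rw [hB1 w hw] at this
      exact this
    · intro e he
      have he' : tp e y ∈ Λ := he
      refine ⟨tp e y, ⟨⟨he', ?_⟩, ?_⟩, ?_⟩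
      · change con tp (υ v) (tp e y) = 0
        rw [con_tp h, hvy, zero_smul]
      · change con tp (υ z) (tp e y) = 0
        rw [con_tp h, hyz, zero_smul]
      · change con tp (υ w0) (tp e y) = e
        rw [con_tp h, hw2, one_smul]
  have s3 := flag_step h hBg.fg (υ w0) ((‖y‖ ^ 2)⁻¹ • y) (smul_ne_zero (by positivity) hy0) (by
    intro w hw
    have e := key (υ w0 - (‖y‖ ^ 2)⁻¹ • y) (by
      rw [inner_sub_left, real_inner_smul_left, hw2, hyy]; field_simp; ring) w hw
    rw [con_sub, sub_eq_zero] at e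
    exact e)
  have t3 := rk_add hBg.fg (con tp (υ w0))
  have hbot : B ⊓ kerZ (con tp (υ w0)) = ⊥ := by
    rw [eq_bot_iff]
    rintro w ⟨hw, hw'⟩
    have hw'' : con tp (υ w0) w = 0 := hw'
    have := hB1 w hw
    rw [hw'', map_zero, LinearMap.zero_apply] at this
    exact this
  have hnorm : ‖(‖y‖ ^ 2)⁻¹ • y‖ = ‖y‖⁻¹ := by
    rw [norm_smul, norm_inv, norm_pow, norm_norm]; field_simp
  rw [hbot, rk_bot, hsec, zero_add] at t3
  rw [hbot, covol_bot, one_mul, hsec, hnorm, inv_pow, inv_mul_eq_div,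
    le_div_iff₀ (by positivity)] at s3
  refine ⟨?_, l3, X, l2, by omega, ?_⟩
  · rw [← hsec]
    rintro _ ⟨w, hw, rfl⟩
    exact con_lat h (hM.mem_dual hw0) (hΛ hw.1.1)
  have n1 := covol_nonneg (sec tp Λ y)
  have n2 := covol_nonneg X
  have n3 := covol_nonneg (mapZ (con tp (υ v)) Λ)
  have n4 := covol_nonneg A
  calc _ = ‖v‖ ^ rk X * ((covol (sec tp Λ y) * ‖y‖ ^ rk (sec tp Λ y)) * covol X) *
          covol (mapZ (con tp (υ v)) Λ) := by ring
    _ ≤ ‖v‖ ^ rk X * (covol B * covol X) * covol (mapZ (con tp (υ v)) Λ) := by gcongr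
    _ ≤ ‖v‖ ^ rk X * (‖g‖ ^ rk X * covol A) * covol (mapZ (con tp (υ v)) Λ) := by gcongr
    _ = (‖g‖ * ‖v‖) ^ rk X * (covol A * covol (mapZ (con tp (υ v)) Λ)) := by
        rw [mul_pow]; ring
    _ ≤ ‖y‖ ^ rk X * (‖v‖ ^ rk (mapZ (con tp (υ v)) Λ) * covol Λ) := by
        gcongr
    _ = _ := by ring

end P8

section P9
variable {V W G : Type*} [NormedAddCommGroup V] [InnerProductSpace ℝ V]
  [NormedAddCommGroup W] [InnerProductSpace ℝ W] [NormedAddCommGroup G] [InnerProductSpace ℝ G]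
  [FiniteDimensional ℝ V] [FiniteDimensional ℝ W]
  {tp : V →ₗ[ℝ] W →ₗ[ℝ] G} {L : Submodule ℤ V} {M : Submodule ℤ W}
  {τ : V →ₗ[ℝ] V} {υ : W →ₗ[ℝ] W}

/-! ### Dimension three: combinatorics of split vectors -/

theorem PP.one_le {X : Submodule ℤ V} (h : PP L 1) (hX : X ≤ L) : 1 ≤ covol X := by
  have := h X hX
  rwa [one_pow] at this

theorem PP.norm_one {x : V} (h : PP L 1) (hx : x ∈ L) (h0 : x ≠ 0) : 1 ≤ ‖x‖ := by
  have := h.one_le (Submodule.span_le.2 (by simpa using hx) : Submodule.span ℤ {x} ≤ L)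
  rwa [covol_singleton h0] at this

theorem rk_pos {X : Submodule ℤ V} (hX : Gap X) {x : V} (hx : x ∈ X) (h0 : x ≠ 0) : 1 ≤ rk X := by
  by_contra h
  have := eq_bot_of_rk hX.fg (by omega)
  rw [this] at hx
  exact h0 hx

/-- A hypothetical isotropic sublattice of small covolume. -/
structure Bad [FiniteDimensional ℝ G] (tp : V →ₗ[ℝ] W →ₗ[ℝ] G) (L : Submodule ℤ V)
    (M : Submodule ℤ W) (τ : V →ₗ[ℝ] V) (υ : W →ₗ[ℝ] W) (Λ : Submodule ℤ G) : Prop where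
  h : IsTensor tp
  hL : OU L τ
  hM : OU M υ
  dV : finrank ℝ V = 3
  dW : finrank ℝ W = 3
  pL : PP L 1
  pM : PP M 1
  le : Λ ≤ tensorLat tp L M
  iso : ∀ x y, tp x y ∈ Λ → ∀ w ∈ Λ, (inner ℝ (τ x) (con tp (υ y) w) : ℝ) = 0
  rk4 : rk Λ ≤ 4
  lt : covol Λ < 1

variable [FiniteDimensional ℝ G] {Λ : Submodule ℤ G}

theorem Bad.flip (B : Bad tp L M τ υ Λ) : Bad tp.flip M L υ τ Λ where
  h := B.h.flip
  hL := B.hM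
  hM := B.hL
  dV := B.dW
  dW := B.dV
  pL := B.pM
  pM := B.pL
  le := by rw [tensorLat_flip]; exact B.le
  iso := by
    intro y x hxy w hw
    rw [real_inner_comm, ← con_comm, real_inner_comm]
    exact B.iso x y hxy w hw
  rk4 := B.rk4
  lt := B.lt

theorem Bad.gap (B : Bad tp L M τ υ Λ) : Gap Λ := (tensor_gap B.h B.hL.gap B.hM.gap).mono B.le

theorem Bad.form (B : Bad tp L M τ υ Λ) {x x' : V} {y y' : W} (h1 : tp x y ∈ Λ)
    (h2 : tp x' y' ∈ Λ) : (inner ℝ (τ x) x' : ℝ) = 0 ∨ (inner ℝ (υ y) y' : ℝ) = 0 := by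
  have := B.iso x y h1 _ h2
  rw [con_tp B.h, real_inner_smul_right, mul_eq_zero] at this
  exact this.symm

theorem Bad.img_le (B : Bad tp L M τ υ Λ) {y : W} (hy : y ∈ M) : mapZ (con tp (υ y)) Λ ≤ L := by
  rintro _ ⟨w, hw, rfl⟩
  exact con_lat B.h (B.hM.mem_dual hy) (B.le hw)

theorem Bad.img_perp (B : Bad tp L M τ υ Λ) {x : V} {y : W} (h1 : tp x y ∈ Λ) :
    ∀ e ∈ mapZ (con tp (υ y)) Λ, (inner ℝ (τ x) e : ℝ) = 0 := by
  rintro _ ⟨w, hw, rfl⟩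
  exact B.iso x y h1 w hw

theorem Bad.img_rk (B : Bad tp L M τ υ Λ) {x : V} {y : W} (hx : Prim L x) (hy : y ∈ M)
    (h1 : tp x y ∈ Λ) : rk (mapZ (con tp (υ y)) Λ) ≤ 2 := by
  have h2 := (perp_facts B.hL B.dV hx).1
  rw [← h2]
  exact rk_mono (B.hL.gap.mono inf_le_left).fg
    (fun e he => ⟨B.img_le hy he, B.img_perp h1 e he⟩)

theorem Bad.sec_le (B : Bad tp L M τ υ Λ) {y : W} (hy : Prim M y) : sec tp Λ y ≤ L := by
  intro e he
  obtain ⟨w0, hw0, hw1⟩ := B.hM.prim hy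
  have hw2 : (inner ℝ (υ w0) y : ℝ) = 1 := by rw [B.hM.symm]; exact hw1
  have := con_lat B.h (B.hM.mem_dual hw0) (B.le he)
  change con tp (υ w0) (tp e y) ∈ L at this
  rwa [con_tp B.h, hw2, one_smul] at this

theorem Bad.isoflag (B : Bad tp L M τ υ Λ) {x : V} {y : W} (hx : Prim L x) (hy : Prim M y)
    (h1 : tp x y ∈ Λ) (hyy : (inner ℝ (υ y) y : ℝ) = 0) :
    rk (sec tp Λ y) = 1 ∧ rk (mapZ (con tp (υ y)) Λ) = 2 ∧ 3 ≤ rk Λ ∧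
      covol (sec tp Λ y) ≤ ‖y‖ * covol Λ := by
  obtain ⟨f1, f2, X, hX, hr, hc⟩ := flag3 B.h B.hL.gap B.hM B.dW hy hy hyy B.le
  have hyn := B.pM.norm_one hy.1 hy.2.1
  have c1 := B.pL.one_le f1
  have c2 := B.pL.one_le hX
  have c3 := B.pL.one_le f2
  have r3 := B.img_rk hx hy.1 h1
  have r1 : 1 ≤ rk (sec tp Λ y) := rk_pos (B.hL.gap.mono f1) h1 hx.2.1
  have hlt := B.lt
  have hcn := covol_nonneg Λ
  have hc' : ‖y‖ ^ rk (sec tp Λ y) * covol (sec tp Λ y) ≤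
      ‖y‖ ^ rk (mapZ (con tp (υ y)) Λ) * covol Λ := by
    have hp : 0 < ‖y‖ ^ rk X := by positivity
    have : ‖y‖ ^ rk (sec tp Λ y) * (covol (sec tp Λ y) * 1 * 1) ≤
        ‖y‖ ^ rk (sec tp Λ y) * (covol (sec tp Λ y) * covol X *
          covol (mapZ (con tp (υ y)) Λ)) := by gcongr
    refine le_of_mul_le_mul_left ?_ hp
    nlinarith
  have h12 : rk (sec tp Λ y) < rk (mapZ (con tp (υ y)) Λ) := by
    by_contra hcon
    push Not at hcon
    have e1 : ‖y‖ ^ rk (mapZ (con tp (υ y)) Λ) ≤ ‖y‖ ^ rk (sec tp Λ y) :=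
      pow_le_pow_right₀ hyn hcon
    have e2 : 0 < ‖y‖ ^ rk (sec tp Λ y) := by positivity
    nlinarith
  have e1 : rk (sec tp Λ y) = 1 := by omega
  have e2 : rk (mapZ (con tp (υ y)) Λ) = 2 := by omega
  refine ⟨e1, e2, by omega, ?_⟩
  rw [e1, e2] at hc'
  have hp : 0 < ‖y‖ := by linarith
  refine le_of_mul_le_mul_left ?_ hp
  nlinarith

theorem Bad.sec_rk (B : Bad tp L M τ υ Λ) {x : V} {y : W} (hx : Prim L x) (hy : Prim M y)
    (h1 : tp x y ∈ Λ) : rk (sec tp Λ y) = 1 ∧ ‖x‖ ≤ covol (sec tp Λ y) ∧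
      ∀ e ∈ sec tp Λ y, ∃ c : ℝ, e = c • x := by
  have hle := B.sec_le hy
  have hg : Gap (sec tp Λ y) := B.hL.gap.mono hle
  have hr : rk (sec tp Λ y) = 1 := by
    by_cases hyy : (inner ℝ (υ y) y : ℝ) = 0
    · exact (B.isoflag hx hy h1 hyy).1
    · have r1 : 1 ≤ rk (sec tp Λ y) := rk_pos hg h1 hx.2.1
      have := iso_rank τ B.hL.isom hg (fun e he e' he' => (B.form he he').resolve_right hyy)
      rw [B.dV] at this
      omega
  have hp : Prim (sec tp Λ y) x := ⟨h1, hx.2.1, fun c hc => hx.2.2 c (hle hc)⟩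
  have h2 := rk_prim hg.fg hp
  have h3 := eq_bot_of_rk (fg_mapZ hg.fg (pw x)) (by omega)
  have h4 := covol_ge_prim hg.fg hp
  rw [h3, covol_bot, mul_one] at h4
  refine ⟨hr, h4, fun e he => pw_eq_zero ?_⟩
  have : pw x e ∈ mapZ (pw x) (sec tp Λ y) := ⟨e, he, rfl⟩
  rw [h3] at this
  exact this

/-- Key inequality for an isotropic factor. -/
theorem Bad.iso_le (B : Bad tp L M τ υ Λ) {x : V} {y : W} (hx : Prim L x) (hy : Prim M y)
    (h1 : tp x y ∈ Λ) (hxx : (inner ℝ (τ x) x : ℝ) = 0) :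
    3 ≤ rk Λ ∧ ‖y‖ ≤ ‖x‖ * covol Λ := by
  have h2 := B.flip.isoflag hy hx h1 hxx
  have h3 := B.flip.sec_rk hy hx h1
  exact ⟨h2.2.2.1, h3.2.1.trans h2.2.2.2⟩

/-- Two split vectors with isotropic first factors: one order. -/
theorem Bad.two_aux (B : Bad tp L M τ υ Λ) {x x' : V} {y y' : W} (hx : Prim L x) (hy : Prim M y)
    (hx' : Prim L x') (hy' : Prim M y')
    (h1 : tp x y ∈ Λ) (h2 : tp x' y' ∈ Λ) (hxx : (inner ℝ (τ x) x : ℝ) = 0)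
    (hxx' : (inner ℝ (τ x') x' : ℝ) = 0) (hyy' : (inner ℝ (υ y') y : ℝ) = 0) :
    ‖y‖ * ‖x‖ * ‖x'‖ ≤ ‖y'‖ ^ 2 * covol Λ := by
  obtain ⟨f1, f2, X, hX, hr, hc⟩ := flag3 B.h B.hL.gap B.hM B.dW hy hy' hyy' B.le
  obtain ⟨g1, g2, -⟩ := B.sec_rk hx hy h1
  obtain ⟨i1, i2⟩ := B.iso_le hx hy h1 hxx
  obtain ⟨-, i2'⟩ := B.iso_le hx' hy' h2 hxx'
  have nx := B.pL.norm_one hx.1 hx.2.1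
  have nx' := B.pL.norm_one hx'.1 hx'.2.1
  have ny := B.pM.norm_one hy.1 hy.2.1
  have ny' := B.pM.norm_one hy'.1 hy'.2.1
  have c2 := B.pL.one_le hX
  have c3 := B.pL.one_le f2
  have r3 := B.img_rk hx' hy'.1 h2
  have hlt := B.lt
  have hcn := covol_nonneg Λ
  have hr4 := B.rk4
  have r3' : 1 ≤ rk (mapZ (con tp (υ y')) Λ) := by
    by_contra h0
    have h0' : rk (mapZ (con tp (υ y')) Λ) = 0 := by omega
    have h3 := eq_bot_of_rk (B.hL.gap.mono f2).fg h0'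
    have h4 : con tp (υ y') (tp x' y') ∈ mapZ (con tp (υ y')) Λ := ⟨_, h2, rfl⟩
    rw [h3, con_tp B.h] at h4
    have h5 : (inner ℝ (υ y') y' : ℝ) • x' = 0 := h4
    rcases smul_eq_zero.1 h5 with h6 | h6
    · have := (B.isoflag hx' hy' h2 h6).2.1
      omega
    · exact hx'.2.1 h6
  rw [g1] at hr hc
  set C := covol Λ with hC
  have hxy : 0 < ‖x‖ := by linarith
  have hyp : 0 < ‖y‖ := by linarith
  have hyp' : 0 < ‖y'‖ := by linarith
  rcases (show rk (mapZ (con tp (υ y')) Λ) = 1 ∨ rk (mapZ (con tp (υ y')) Λ) = 2 by omega)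
    with e | e
  · exfalso
    rw [e] at hc hr
    have hc' : ‖y'‖ ^ rk X * ‖y‖ ^ 1 * (‖x‖ * 1 * 1) ≤ ‖y'‖ ^ 1 * ‖y‖ ^ rk X * C := by
      refine le_trans ?_ hc
      gcongr
      all_goals first | exact covol_nonneg _ | exact mul_nonneg (covol_nonneg _) (covol_nonneg _)
    rcases (show rk X = 1 ∨ rk X = 2 by omega) with e' | e'
    · rw [e'] at hc'
      have : (‖y'‖ * ‖y‖) * ‖x‖ ≤ (‖y'‖ * ‖y‖) * C := by linarith
      have := le_of_mul_le_mul_left this (by positivity)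
      linarith
    · rw [e'] at hc'
      have : (‖y'‖ * ‖y‖) * (‖y'‖ * ‖x‖) ≤ (‖y'‖ * ‖y‖) * (‖y‖ * C) := by linarith
      have := le_of_mul_le_mul_left this (by positivity)
      have : ‖x‖ * ‖y'‖ ≤ ‖x‖ * (C * C) := by nlinarith
      have := le_of_mul_le_mul_left this (by positivity)
      nlinarith
  · have c3' := perp_covol B.hL B.dV hx' hxx' f2 (B.img_perp h2) e
    rw [e] at hc hr
    have hc' : ‖y'‖ ^ rk X * ‖y‖ ^ 1 * (‖x‖ * 1 * ‖x'‖) ≤ ‖y'‖ ^ 2 * ‖y‖ ^ rk X * C := by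
      refine le_trans ?_ hc
      gcongr
      all_goals first | exact covol_nonneg _ | exact mul_nonneg (covol_nonneg _) (covol_nonneg _)
    rcases (show rk X = 0 ∨ rk X = 1 by omega) with e' | e'
    · rw [e'] at hc'
      linarith
    · exfalso
      rw [e'] at hc'
      have : (‖y'‖ * ‖y‖) * (‖x‖ * ‖x'‖) ≤ (‖y'‖ * ‖y‖) * (‖y'‖ * C) := by linarith
      have := le_of_mul_le_mul_left this (by positivity)
      have h5 : ‖x'‖ * ‖x‖ ≤ ‖x'‖ * (C * C) := by nlinarith
      have := le_of_mul_le_mul_left h5 (by linarith)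
      nlinarith

theorem Bad.two (B : Bad tp L M τ υ Λ) {x x' : V} {y y' : W} (hx : Prim L x) (hy : Prim M y)
    (hx' : Prim L x') (hy' : Prim M y')
    (h1 : tp x y ∈ Λ) (h2 : tp x' y' ∈ Λ) (hxx : (inner ℝ (τ x) x : ℝ) = 0)
    (hxx' : (inner ℝ (τ x') x' : ℝ) = 0) (hne : pw (tp x y) (tp x' y') ≠ 0) : False := by
  have hw0 := B.h.ne_zero hx.2.1 hy.2.1
  have hxx2 : (inner ℝ (τ x) x' : ℝ) ≠ 0 := by
    intro h0
    obtain ⟨c, hc⟩ := pw_eq_zero (no_plane B.hL B.dV hx.2.1 hxx h0 hxx')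
    have h3 : c • y' ∈ sec tp.flip Λ x := by
      change tp x (c • y') ∈ Λ
      rw [map_smul, ← LinearMap.smul_apply, ← map_smul, ← hc]
      exact h2
    obtain ⟨d, hd⟩ := (B.flip.sec_rk hy hx h1).2.2 _ h3
    apply hne
    have : tp x' y' = d • tp x y := by
      rw [← map_smul, ← hd, hc, map_smul, map_smul, LinearMap.smul_apply]
    rw [this]
    exact pw_smul hw0 d
  have hyy' := (B.form h1 h2).resolve_left hxx2
  have hyy : (inner ℝ (υ y') y : ℝ) = 0 := by rw [B.hM.symm]; exact hyy'
  have k1 := B.two_aux hx hy hx' hy' h1 h2 hxx hxx' hyy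
  have k2 := B.two_aux hx' hy' hx hy h2 h1 hxx' hxx hyy'
  obtain ⟨-, i2⟩ := B.iso_le hx hy h1 hxx
  obtain ⟨-, i2'⟩ := B.iso_le hx' hy' h2 hxx'
  have nx := B.pL.norm_one hx.1 hx.2.1
  have nx' := B.pL.norm_one hx'.1 hx'.2.1
  have ny := B.pM.norm_one hy.1 hy.2.1
  have ny' := B.pM.norm_one hy'.1 hy'.2.1
  have hlt := B.lt
  have hcn := covol_nonneg Λ
  set C := covol Λ
  set a := ‖x‖
  set a' := ‖x'‖
  set b := ‖y‖
  set b' := ‖y'‖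
  have p1 : (b * a * a') * (b' * a' * a) ≤ (b' ^ 2 * C) * (b ^ 2 * C) := by gcongr
  have p2 : b * b' ≤ (a * C) * (a' * C) := by gcongr
  have p3 : (b * b') * (a * a') ^ 2 ≤ (b * b') * ((b * b') * C ^ 2) := by nlinarith
  have p4 := le_of_mul_le_mul_left p3 (by nlinarith)
  have p5 : (a * a') * (a * a') ≤ (a * a') * C ^ 4 := by
    have : (b * b') * C ^ 2 ≤ ((a * C) * (a' * C)) * C ^ 2 := by gcongr
    nlinarith
  have p6 := le_of_mul_le_mul_left p5 (by nlinarith)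
  have p7 : C ^ 4 < 1 := pow_lt_one₀ hcn hlt (by norm_num)
  nlinarith

end P9

section P10
variable {V W G : Type*} [NormedAddCommGroup V] [InnerProductSpace ℝ V]
  [NormedAddCommGroup W] [InnerProductSpace ℝ W] [NormedAddCommGroup G] [InnerProductSpace ℝ G]
  [FiniteDimensional ℝ V] [FiniteDimensional ℝ W]
  {tp : V →ₗ[ℝ] W →ₗ[ℝ] G} {L : Submodule ℤ V} {M : Submodule ℤ W}
  {τ : V →ₗ[ℝ] V} {υ : W →ₗ[ℝ] W}

/-! ### Short vectors of a tensor product are split -/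

theorem trace_ge {n : ℕ} {A B : Matrix (Fin n) (Fin n) ℝ} (hA : A.PosSemidef) (hB : B.PosSemidef)
    (dA : 1 ≤ A.det) (dB : 1 ≤ B.det) : (n : ℝ) ≤ (A * B).trace := by
  obtain ⟨C, hC⟩ : ∃ C : Matrix (Fin n) (Fin n) ℝ, B = C.conjTranspose * C := by
    open scoped MatrixOrder in
    exact CStarAlgebra.nonneg_iff_eq_star_mul_self.mp hB.nonneg
  have hS : (C * A * C.conjTranspose).PosSemidef := hA.mul_mul_conjTranspose_same C
  have ht : (A * B).trace = (C * A * C.conjTranspose).trace := by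
    rw [hC, ← Matrix.mul_assoc, Matrix.trace_mul_comm, Matrix.mul_assoc]
  have hd : 1 ≤ (C * A * C.conjTranspose).det := by
    have e : (C * A * C.conjTranspose).det = A.det * B.det := by
      rw [hC]; simp only [Matrix.det_mul]; ring
    rw [e]; nlinarith
  rw [ht]
  rw [hS.isHermitian.trace_eq_sum_eigenvalues]
  rw [hS.isHermitian.det_eq_prod_eigenvalues] at hd
  simp only [RCLike.ofReal_real_eq_id, id] at hd ⊢
  set l := hS.isHermitian.eigenvalues
  have hl : ∀ i, 0 < l i := by
    intro i
    refine lt_of_le_of_ne (hS.eigenvalues_nonneg i) fun h0 => ?_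
    rw [Finset.prod_eq_zero (Finset.mem_univ i) h0.symm] at hd
    linarith
  have hlog : 0 ≤ ∑ i, Real.log (l i) := by
    rw [← Real.log_prod (fun i _ => (hl i).ne')]
    exact Real.log_nonneg hd
  have : ∑ i, Real.log (l i) ≤ ∑ i, (l i - 1) :=
    Finset.sum_le_sum fun i _ => Real.log_le_sub_one_of_pos (hl i)
  simp at this
  linarith

/-- `w` is a sum of `k` split vectors. -/
def Rep (tp : V →ₗ[ℝ] W →ₗ[ℝ] G) (L : Submodule ℤ V) (M : Submodule ℤ W) (w : G) (k : ℕ) : Prop :=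
  ∃ (e : Fin k → V) (y : Fin k → W), (∀ i, e i ∈ L) ∧ (∀ i, y i ∈ M) ∧ w = ∑ i, tp (e i) (y i)

theorem exists_rep {w : G} (hw : w ∈ tensorLat tp L M) : ∃ k, Rep tp L M w k := by
  induction hw using Submodule.span_induction with
  | mem w hw =>
    obtain ⟨x, hx, y, hy, rfl⟩ := hw
    exact ⟨1, fun _ => x, fun _ => y, fun _ => hx, fun _ => hy, by simp⟩
  | zero => exact ⟨0, Fin.elim0, Fin.elim0, fun i => i.elim0, fun i => i.elim0, by simp⟩
  | add u v _ _ hu hv =>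
    obtain ⟨k, e, y, he, hy, rfl⟩ := hu
    obtain ⟨k', e', y', he', hy', rfl⟩ := hv
    refine ⟨k + k', Fin.append e e', Fin.append y y', ?_, ?_, ?_⟩
    · intro i; refine Fin.addCases (fun i => ?_) (fun i => ?_) i <;> simp [he, he']
    · intro i; refine Fin.addCases (fun i => ?_) (fun i => ?_) i <;> simp [hy, hy']
    · rw [Fin.sum_univ_add]; simp
  | smul a u _ hu =>
    obtain ⟨k, e, y, he, hy, rfl⟩ := hu
    refine ⟨k, fun i => a • e i, y, fun i => L.smul_mem _ (he i), hy, ?_⟩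
    rw [Finset.smul_sum]
    refine Finset.sum_congr rfl fun i _ => ?_
    simp only [zsmul_eq, map_smul, LinearMap.smul_apply]

theorem rep_reduce (hL : Gap L) {k : ℕ} (e : Fin k → V) (y : Fin k → W)
    (he : ∀ i, e i ∈ L) (hy : ∀ i, y i ∈ M) :
    ∃ (e' : Fin (rk (Submodule.span ℤ (Set.range e))) → V)
      (y' : Fin (rk (Submodule.span ℤ (Set.range e))) → W),
      LinearIndependent ℝ e' ∧ (∀ i, e' i ∈ L) ∧ (∀ i, y' i ∈ M) ∧
      ∑ i, tp (e i) (y i) = ∑ i, tp (e' i) (y' i) := by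
  have hX : Submodule.span ℤ (Set.range e) ≤ L :=
    Submodule.span_le.2 (by rintro _ ⟨i, rfl⟩; exact he i)
  obtain ⟨b⟩ := exists_basis (hL.mono hX).fg
  have hm : ∀ i, e i ∈ Submodule.span ℤ (Set.range e) := fun i => Submodule.subset_span ⟨i, rfl⟩
  refine ⟨fun i => b i, fun j => ∑ i, (b.repr ⟨e i, hm i⟩ j : ℤ) • y i,
    (hL.mono hX).linInd b, fun i => hX (b i).2,
    fun j => Submodule.sum_mem _ fun i _ => M.smul_mem _ (hy i), ?_⟩
  simp only [map_sum, zsmul_eq, map_smul]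
  rw [Finset.sum_comm]
  refine Finset.sum_congr rfl fun i _ => ?_
  have hh : e i = _ := repr_sum b ⟨e i, hm i⟩
  conv_lhs => rw [hh]
  simp only [map_sum, map_smul, LinearMap.sum_apply, LinearMap.smul_apply]

theorem rk_span_le {k : ℕ} (e : Fin k → V) : rk (Submodule.span ℤ (Set.range e)) ≤ k := by
  have := finrank_range_le_card (R := ℤ) e
  rw [Fintype.card_fin] at this
  exact this

theorem rep_min (hL : Gap L) (hM : Gap M) {w : G} (hw : w ∈ tensorLat tp L M) :
    ∃ (k : ℕ) (e : Fin k → V) (y : Fin k → W), (∀ i, e i ∈ L) ∧ (∀ i, y i ∈ M) ∧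
      LinearIndependent ℝ e ∧ LinearIndependent ℝ y ∧ w = ∑ i, tp (e i) (y i) := by
  classical
  have hex := exists_rep hw
  set k := Nat.find hex with hk
  obtain ⟨e0, y0, he0, hy0, h0⟩ := Nat.find_spec hex
  have hmin : ∀ r, Rep tp L M w r → k ≤ r := fun r hr => Nat.find_min' hex hr
  obtain ⟨e, y, hie, he, hy, h1⟩ := rep_reduce (tp := tp) hL e0 y0 he0 hy0
  rw [← h0] at h1
  generalize hr : rk (Submodule.span ℤ (Set.range e0)) = r at e y hie he hy h1
  have hr1 : r ≤ k := hr ▸ rk_span_le e0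
  have hr2 := hmin r ⟨e, y, he, hy, h1⟩
  obtain ⟨y', e', hiy, hy', he', h2⟩ := rep_reduce (tp := tp.flip) hM y e hy he
  have hs1 := rk_span_le y
  have hs2 := hmin _ ⟨e', y', he', hy', by rw [h1]; simpa using h2⟩
  refine ⟨r, e, y, he, hy, hie, ?_, h1⟩
  have hX : Submodule.span ℤ (Set.range y) ≤ M :=
    Submodule.span_le.2 (by rintro _ ⟨i, rfl⟩; exact hy i)
  have hg := (hM.mono hX).rk_eq
  rw [linearIndependent_iff_card_eq_finrank_span, Fintype.card_fin, Set.finrank]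
  have : Submodule.span ℝ ((Submodule.span ℤ (Set.range y) : Submodule ℤ W) : Set W)
      = Submodule.span ℝ (Set.range y) := Submodule.span_span_of_tower ℤ ℝ _
  rw [this] at hg
  omega

theorem norm_rep (h : IsTensor tp) {k : ℕ} (e : Fin k → V) (y : Fin k → W) :
    ‖∑ i, tp (e i) (y i)‖ ^ 2 = (Matrix.gram ℝ e * Matrix.gram ℝ y).trace := by
  rw [← real_inner_self_eq_norm_sq, sum_inner]
  simp only [inner_sum, h.2, Matrix.trace, Matrix.diag, Matrix.mul_apply, Matrix.gram_apply]
  refine Finset.sum_congr rfl fun i _ => Finset.sum_congr rfl fun j _ => ?_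
  rw [real_inner_comm (y i) (y j)]

theorem PP.gdet_one {k : ℕ} {e : Fin k → V} (h : PP L 1) (he : ∀ i, e i ∈ L)
    (hi : LinearIndependent ℝ e) : 1 ≤ (Matrix.gram ℝ e).det := by
  have hX : Submodule.span ℤ (Set.range e) ≤ L :=
    Submodule.span_le.2 (by rintro _ ⟨i, rfl⟩; exact he i)
  have := h.one_le hX
  rw [covol_span (linInd_int hi)] at this
  exact Real.one_le_sqrt.1 this

theorem Prim.smul_sign {x : V} (hx : Prim L x) {n : ℤ} (hn : n = 1 ∨ n = -1) :
    Prim L ((n : ℝ) • x) := by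
  obtain ⟨h1, h2, h3⟩ := hx
  refine ⟨?_, ?_, ?_⟩
  · rw [← zsmul_eq]; exact L.smul_mem _ h1
  · rcases hn with rfl | rfl <;> simpa using h2
  · intro c hc
    rw [smul_smul] at hc
    obtain ⟨m, hm⟩ := h3 _ hc
    rcases hn with rfl | rfl
    · exact ⟨m, by simpa using hm⟩
    · exact ⟨-m, by push_cast; push_cast at hm; linarith⟩

theorem tensor_short (h : IsTensor tp) (hL : Gap L) (hM : Gap M) (pL : PP L 1) (pM : PP M 1)
    {w : G} (hw : w ∈ tensorLat tp L M) (h0 : w ≠ 0) :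
    1 ≤ ‖w‖ ^ 2 ∧ (‖w‖ ^ 2 < 2 → ∃ x y, Prim L x ∧ Prim M y ∧ w = tp x y) := by
  obtain ⟨k, e, y, he, hy, hie, hiy, rfl⟩ := rep_min hL hM hw
  have hn : (k : ℝ) ≤ ‖∑ i, tp (e i) (y i)‖ ^ 2 := by
    rw [norm_rep h]
    exact trace_ge (Matrix.posSemidef_gram ℝ e) (Matrix.posSemidef_gram ℝ y) (pL.gdet_one he hie) (pM.gdet_one hy hiy)
  have hk : k ≠ 0 := by rintro rfl; simp at h0
  have hk1 : (1 : ℝ) ≤ k := by exact_mod_cast Nat.one_le_iff_ne_zero.2 hk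
  refine ⟨hk1.trans hn, fun h2 => ?_⟩
  have : (k : ℝ) < 2 := hn.trans_lt h2
  have : k < 2 := by exact_mod_cast this
  obtain rfl : k = 1 := by omega
  simp only [Finset.univ_unique, Finset.sum_singleton] at *
  set a := e default
  set b := y default
  have ha : a ≠ 0 := hie.ne_zero _
  have hb : b ≠ 0 := hiy.ne_zero _
  obtain ⟨u, hu, n, hn0, hun⟩ := exists_prim hL (he default) ha
  obtain ⟨v, hv, m, hm0, hvm⟩ := exists_prim hM (hy default) hb
  have hu1 := pL.norm_one hu.1 hu.2.1
  have hv1 := pM.norm_one hv.1 hv.2.1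
  have e1 : a = (n : ℝ) • u := by rw [← zsmul_eq]; exact hun
  have e2 : b = (m : ℝ) • v := by rw [← zsmul_eq]; exact hvm
  have e3 : tp a b = ((n * m : ℤ) : ℝ) • tp u v := by
    rw [e1, e2]; simp [smul_smul, mul_comm]
  have e4 : ‖tp a b‖ ^ 2 = ((n * m : ℤ) : ℝ) ^ 2 * (‖u‖ * ‖v‖) ^ 2 := by
    rw [e3, norm_smul, h.norm, mul_pow, Real.norm_eq_abs, sq_abs]
  have e5 : 1 ≤ (‖u‖ * ‖v‖) ^ 2 := by
    have : 1 ≤ ‖u‖ * ‖v‖ := by nlinarith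
    nlinarith
  have e6 : ((n * m : ℤ) : ℝ) ^ 2 < 2 := by
    rw [e4] at h2
    nlinarith [sq_nonneg ((n * m : ℤ) : ℝ)]
  have e7 : (n * m) ^ 2 < 2 := by exact_mod_cast e6
  have e8 : n * m ≠ 0 := mul_ne_zero hn0 hm0
  have e9 : n * m = 1 ∨ n * m = -1 := by
    have l1 : n * m < 2 := by nlinarith
    have l2 : -2 < n * m := by nlinarith
    omega
  refine ⟨_, v, hu.smul_sign e9, hv, ?_⟩
  rw [e3, map_smul, LinearMap.smul_apply]

end P10

section P11
variable {V W G : Type*} [NormedAddCommGroup V] [InnerProductSpace ℝ V]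
  [NormedAddCommGroup W] [InnerProductSpace ℝ W] [NormedAddCommGroup G] [InnerProductSpace ℝ G]
  [FiniteDimensional ℝ V] [FiniteDimensional ℝ W]
  {tp : V →ₗ[ℝ] W →ₗ[ℝ] G} {L : Submodule ℤ V} {M : Submodule ℤ W}
  {τ : V →ₗ[ℝ] V} {υ : W →ₗ[ℝ] W}

/-! ### Three short vectors -/

theorem one_short {X : Submodule ℤ V} (hX : Gap X) (h1 : ∀ v ∈ X, v ≠ 0 → 1 ≤ ‖v‖ ^ 2)
    (hr4 : rk X ≤ 4) (hc : covol X < 1) : ∃ w ∈ X, w ≠ 0 ∧ ‖w‖ ^ 2 < 2 := by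
  have hne : X ≠ ⊥ := by rintro rfl; rw [covol_bot] at hc; exact lt_irrefl _ hc
  have hr0 : rk X ≠ 0 := fun h0 => hne (eq_bot_of_rk hX.fg h0)
  obtain ⟨w, hw, hw0, hmin⟩ := hX.exists_shortest hne
  refine ⟨w, hw, hw0, ?_⟩
  have hh := hermite (rk X) X hX rfl (‖w‖ ^ 2) (by positivity)
    (fun v hv hv0 => pow_le_pow_left₀ (norm_nonneg _) (hmin v hv hv0) 2)
  have hc2 : covol X ^ 2 < 1 := by nlinarith [covol_nonneg X]
  have ht := h1 w hw hw0
  generalize ‖w‖ ^ 2 = t at *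
  by_contra h2
  push Not at h2
  have hq : 2 ^ (rk X) * (3 / 4 : ℝ) ^ ((rk X).choose 2) ≤ t ^ (rk X) * (3 / 4 : ℝ) ^ ((rk X).choose 2) := by
    gcongr
  have hq2 := hq.trans_lt (hh.trans_lt hc2)
  obtain h | h | h | h : rk X = 1 ∨ rk X = 2 ∨ rk X = 3 ∨ rk X = 4 := by omega
  all_goals
    rw [h] at hq2
    norm_num [Nat.choose] at hq2

theorem short_arith3 {t b c : ℝ} (ht : 1 ≤ t) (hb : 3 / 4 * t ≤ b) (hc : 0 ≤ c)
    (h1 : t ^ 3 * (27 / 64) < 1) (h2 : t * (b ^ 2 * (3 / 4)) < 1) (h3 : t * (b * c) < 1) :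
    t < 8 / 5 ∧ b ≤ 4 / 3 ∧ c * t ≤ 4 / 3 := by
  refine ⟨?_, ?_, ?_⟩
  · by_contra h
    push Not at h
    have : (8 / 5 : ℝ) ^ 3 ≤ t ^ 3 := by gcongr
    norm_num at this
    linarith
  · by_contra h
    push Not at h
    have : (4 / 3 : ℝ) ^ 2 ≤ b ^ 2 := by gcongr
    norm_num at this
    nlinarith
  · have e1 : t * (3 / 4 * t * c) ≤ t * (b * c) := by gcongr
    have e2 : c * t ≤ c * t * t := le_mul_of_one_le_right (by positivity) ht
    nlinarith

theorem short_arith4 {t b c : ℝ} (ht : 1 ≤ t) (hb : 3 / 4 * t ≤ b) (hc : 0 ≤ c)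
    (h1 : t ^ 4 * (3 / 4) ^ 6 < 1) (h2 : t * (b ^ 3 * (27 / 64)) < 1)
    (h3 : t * (b * (c ^ 2 * (3 / 4))) < 1) :
    t < 8 / 5 ∧ b ≤ 4 / 3 ∧ c * t ≤ 4 / 3 := by
  refine ⟨?_, ?_, ?_⟩
  · by_contra h
    push Not at h
    have : (8 / 5 : ℝ) ^ 4 ≤ t ^ 4 := by gcongr
    norm_num at this h1
    linarith
  · by_contra h
    push Not at h
    have : (4 / 3 : ℝ) ^ 3 ≤ b ^ 3 := by gcongr
    norm_num at this
    nlinarith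
  · have e1 : t * (3 / 4 * t * (c ^ 2 * (3 / 4))) ≤ t * (b * (c ^ 2 * (3 / 4))) := by gcongr
    by_contra h
    push Not at h
    nlinarith

theorem three_short {X : Submodule ℤ V} (hX : Gap X) (h1 : ∀ v ∈ X, v ≠ 0 → 1 ≤ ‖v‖ ^ 2)
    (hr3 : 3 ≤ rk X) (hr4 : rk X ≤ 4) (hc : covol X < 1) :
    ∃ w1 ∈ X, ∃ w2 ∈ X, ∃ w3 ∈ X, w1 ≠ 0 ∧ w2 ≠ 0 ∧ w3 ≠ 0 ∧ ‖w1‖ ^ 2 < 2 ∧ ‖w2‖ ^ 2 < 2 ∧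
      ‖w3‖ ^ 2 < 2 ∧ pw w1 w2 ≠ 0 ∧ pw w1 w3 ≠ 0 ∧ pw w2 w3 ≠ 0 := by
  have hne : X ≠ ⊥ := by rintro rfl; rw [rk_bot] at hr3; omega
  obtain ⟨w1, hw1, hw10, hmin1⟩ := hX.exists_shortest hne
  have p1 := prim_of_shortest hw1 hw10 hmin1
  have hk1 := rk_prim hX.fg p1
  have hc1 := covol_ge_prim hX.fg p1
  have hg1 := pw_gap hw1 hw10 hmin1
  have hw1p : 0 < ‖w1‖ := norm_pos_iff.2 hw10
  have hX1 : Gap (mapZ (pw w1) X) := gap_of_sq (by positivity) hg1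
  have hher1 := hermite (rk X) X hX rfl (‖w1‖ ^ 2) (by positivity)
    (fun v hv hv0 => pow_le_pow_left₀ (norm_nonneg _) (hmin1 v hv hv0) 2)
  set X1 := mapZ (pw w1) X with hX1d
  have hne1 : X1 ≠ ⊥ := by intro h0; rw [h0, rk_bot] at hk1; omega
  obtain ⟨n2, hn2, hn20, hmin2⟩ := hX1.exists_shortest hne1
  have p2 := prim_of_shortest hn2 hn20 hmin2
  have hk2 := rk_prim hX1.fg p2
  have hc2 := covol_ge_prim hX1.fg p2
  have hg2 := pw_gap hn2 hn20 hmin2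
  have hn2p : 0 < ‖n2‖ := norm_pos_iff.2 hn20
  have hX2 : Gap (mapZ (pw n2) X1) := gap_of_sq (by positivity) hg2
  have hher2 := hermite (rk X1) X1 hX1 rfl (‖n2‖ ^ 2) (by positivity)
    (fun v hv hv0 => pow_le_pow_left₀ (norm_nonneg _) (hmin2 v hv hv0) 2)
  set X2 := mapZ (pw n2) X1 with hX2d
  have hne2 : X2 ≠ ⊥ := by intro h0; rw [h0, rk_bot] at hk2; omega
  obtain ⟨n3, hn3, hn30, hmin3⟩ := hX2.exists_shortest hne2
  have hher3 := hermite (rk X2) X2 hX2 rfl (‖n3‖ ^ 2) (by positivity)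
    (fun v hv hv0 => pow_le_pow_left₀ (norm_nonneg _) (hmin3 v hv hv0) 2)
  obtain ⟨w2, hw2, hw2e, hw2n⟩ := pw_lift hw1 hw10 hn2
  obtain ⟨m3, hm3, hm3e, hm3n⟩ := pw_lift hn2 hn20 hn3
  obtain ⟨w3, hw3, hw3e, hw3n⟩ := pw_lift hw1 hw10 hm3
  have hcc : covol X ^ 2 < 1 := by nlinarith [covol_nonneg X]
  have q1 : ‖w1‖ ^ 2 * covol X1 ^ 2 < 1 := by
    rw [← mul_pow]
    exact (pow_le_pow_left₀ (mul_nonneg hw1p.le (covol_nonneg _)) hc1 2).trans_lt hcc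
  have q2 : ‖n2‖ ^ 2 * covol X2 ^ 2 ≤ covol X1 ^ 2 := by
    rw [← mul_pow]
    exact (pow_le_pow_left₀ (mul_nonneg hn2p.le (covol_nonneg _)) hc2 2)
  have ht := h1 w1 hw1 hw10
  have hb := hg1 n2 hn2 hn20
  have key : ‖w1‖ ^ 2 < 8 / 5 ∧ ‖n2‖ ^ 2 ≤ 4 / 3 ∧ ‖n3‖ ^ 2 * ‖w1‖ ^ 2 ≤ 4 / 3 := by
    have a1 := hher1.trans_lt hcc
    have a2 := (mul_le_mul_of_nonneg_left hher2 (sq_nonneg ‖w1‖)).trans_lt q1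
    have a3 := (mul_le_mul_of_nonneg_left ((mul_le_mul_of_nonneg_left hher3
      (sq_nonneg ‖n2‖)).trans q2) (sq_nonneg ‖w1‖)).trans_lt q1
    obtain h | h : rk X = 3 ∨ rk X = 4 := by omega
    · have e1 : rk X1 = 2 := by omega
      have e2 : rk X2 = 1 := by omega
      rw [h] at a1
      rw [e1] at a2
      rw [e2] at a3
      norm_num [Nat.choose] at a1 a2 a3
      exact short_arith3 ht hb (sq_nonneg _) a1 a2 a3
    · have e1 : rk X1 = 3 := by omega
      have e2 : rk X2 = 2 := by omega
      rw [h] at a1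
      rw [e1] at a2
      rw [e2] at a3
      norm_num [Nat.choose] at a1 a2 a3
      refine short_arith4 ht hb (sq_nonneg _) (by norm_num; exact a1) a2 a3
  obtain ⟨k1, k2, k3⟩ := key
  have hw12 : pw w1 w2 ≠ 0 := by rw [hw2e]; exact hn20
  have hw13 : pw w1 w3 ≠ 0 := by
    rw [hw3e]; rintro rfl
    rw [map_zero] at hm3e; exact hn30 hm3e.symm
  have hw20 : w2 ≠ 0 := by rintro rfl; exact hw12 (map_zero _)
  have hw30 : w3 ≠ 0 := by rintro rfl; exact hw13 (map_zero _)
  refine ⟨w1, hw1, w2, hw2, w3, hw3, hw10, hw20, hw30, by linarith, by linarith, ?_, hw12, hw13, ?_⟩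
  · generalize ‖n3‖ ^ 2 = c at *
    generalize ‖w1‖ ^ 2 = t at *
    have : c + t / 4 ≤ 19 / 12 := by
      by_contra h
      push Not at h
      nlinarith
    linarith
  · intro h0
    obtain ⟨c, rfl⟩ := pw_eq_zero h0
    rw [map_smul, hw2e] at hw3e
    rw [← hw3e, pw_smul hn20] at hm3e
    exact hn30 hm3e.symm

theorem Bad.false [FiniteDimensional ℝ G] {Λ : Submodule ℤ G} (B : Bad tp L M τ υ Λ) : False := by
  have hs := fun w (hw : w ∈ Λ) (h0 : w ≠ 0) =>
    tensor_short B.h B.hL.gap B.hM.gap B.pL B.pM (B.le hw) h0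
  have h1 : ∀ v ∈ Λ, v ≠ 0 → 1 ≤ ‖v‖ ^ 2 := fun v hv h0 => (hs v hv h0).1
  have hr3 : 3 ≤ rk Λ := by
    obtain ⟨w, hw, hw0, hw2⟩ := one_short B.gap h1 B.rk4 B.lt
    obtain ⟨x, y, hx, hy, rfl⟩ := (hs w hw hw0).2 hw2
    rcases B.form hw hw with h | h
    · exact (B.iso_le hx hy hw h).1
    · exact (B.flip.iso_le hy hx hw h).1
  obtain ⟨w1, m1, w2, m2, w3, m3, n1, n2, n3, s1, s2, s3, p12, p13, p23⟩ :=
    three_short B.gap h1 hr3 B.rk4 B.lt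
  obtain ⟨x1, y1, hx1, hy1, rfl⟩ := (hs w1 m1 n1).2 s1
  obtain ⟨x2, y2, hx2, hy2, rfl⟩ := (hs w2 m2 n2).2 s2
  obtain ⟨x3, y3, hx3, hy3, rfl⟩ := (hs w3 m3 n3).2 s3
  rcases B.form m1 m1 with i1 | i1 <;> rcases B.form m2 m2 with i2 | i2 <;>
    rcases B.form m3 m3 with i3 | i3
  · exact B.two hx1 hy1 hx2 hy2 m1 m2 i1 i2 p12
  · exact B.two hx1 hy1 hx2 hy2 m1 m2 i1 i2 p12
  · exact B.two hx1 hy1 hx3 hy3 m1 m3 i1 i3 p13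
  · exact B.flip.two hy2 hx2 hy3 hx3 m2 m3 i2 i3 p23
  · exact B.two hx2 hy2 hx3 hy3 m2 m3 i2 i3 p23
  · exact B.flip.two hy1 hx1 hy3 hx3 m1 m3 i1 i3 p13
  · exact B.flip.two hy1 hx1 hy2 hx2 m1 m2 i1 i2 p12
  · exact B.flip.two hy1 hx1 hy2 hx2 m1 m2 i1 i2 p12

/-! ### The case of two three-dimensional lattices -/

theorem iso_short (hM : OU M υ) (hd : finrank ℝ W = 3) (h : ¬ PP M 1) :
    ∃ u, Prim M u ∧ (inner ℝ (υ u) u : ℝ) = 0 ∧ ‖u‖ < 1 := by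
  unfold PP at h
  push Not at h
  obtain ⟨Y, hY, hlt⟩ := h
  rw [one_pow] at hlt
  have h1 := radical_covol υ hM.isom hM.symm Y (hM.gap.mono hY).fg
    (fun x hx y hy => hM.int x (hY hx) y (hY hy))
  set R := radical υ Y
  have hRM : R ≤ M := (radical_le υ Y).trans hY
  have hRg := hM.gap.mono hRM
  have h2 := iso_rank υ hM.isom hRg (radical_iso υ Y)
  rw [hd] at h2
  have h3 : covol R < 1 := h1.trans_lt hlt
  have h4 : rk R = 1 := by
    by_contra h4
    have h5 : R = ⊥ := eq_bot_of_rk hRg.fg (by omega)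
    rw [h5, covol_bot] at h3
    exact lt_irrefl _ h3
  obtain ⟨g, hg, hg0, hgc, -⟩ := rk_one_gen hRg h4
  obtain ⟨u, hu, n, hn, rfl⟩ := exists_prim hM.gap (hRM hg) hg0
  have hn' : (n : ℝ) ≠ 0 := by exact_mod_cast hn
  refine ⟨u, hu, ?_, ?_⟩
  · have := radical_iso υ Y _ hg _ hg
    rw [zsmul_eq, map_smul, real_inner_smul_left, real_inner_smul_right] at this
    simpa [hn'] using this
  · rw [hgc, zsmul_eq, norm_smul, Real.norm_eq_abs] at h3
    have : (1 : ℝ) ≤ |(n : ℝ)| := by exact_mod_cast Int.one_le_abs hn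
    nlinarith [norm_nonneg u]

theorem three_short_iso [FiniteDimensional ℝ G] (h : IsTensor tp) (hL : Gap L) (hM : OU M υ)
    (hd : finrank ℝ W = 3) {γ δ : ℝ} (hγ0 : 0 ≤ γ) (hδ0 : 0 ≤ δ) (hδ1 : δ ≤ 1) (hγ : PP L γ)
    (hδ : PP M δ) (hn : ¬ PP M 1) {R : Submodule ℤ G} (hR : R ≤ tensorLat tp L M) :
    (γ * δ) ^ rk R ≤ covol R := by
  obtain ⟨u, hu, huu, hu1⟩ := iso_short hM hd hn
  obtain ⟨f1, f2, X, hX, hr, hc⟩ := flag3 h hL hM hd hu hu huu hR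
  have hup : 0 < ‖u‖ := norm_pos_iff.2 hu.2.1
  have c1 := hγ _ f1
  have c2 := hγ _ hX
  have c3 := hγ _ f2
  have key : γ ^ rk R * ‖u‖ ^ rk (sec tp R u) ≤ ‖u‖ ^ rk (mapZ (con tp (υ u)) R) * covol R := by
    have e : γ ^ rk R ≤ covol (sec tp R u) * covol X * covol (mapZ (con tp (υ u)) R) := by
      rw [hr, pow_add, pow_add]
      exact mul_le_mul (mul_le_mul c1 c2 (by positivity) (covol_nonneg _)) c3 (by positivity)
        (mul_nonneg (covol_nonneg _) (covol_nonneg _))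
    have hp : 0 < ‖u‖ ^ rk X := by positivity
    have : ‖u‖ ^ rk X * (γ ^ rk R * ‖u‖ ^ rk (sec tp R u)) ≤
        ‖u‖ ^ rk X * (‖u‖ ^ rk (mapZ (con tp (υ u)) R) * covol R) := by
      calc _ = ‖u‖ ^ rk X * ‖u‖ ^ rk (sec tp R u) * γ ^ rk R := by ring
        _ ≤ _ := mul_le_mul_of_nonneg_left e (by positivity)
        _ ≤ _ := hc
        _ = _ := by ring
    exact le_of_mul_le_mul_left this hp
  rcases le_total (rk (mapZ (con tp (υ u)) R)) (rk (sec tp R u)) with hle | hle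
  · exact two_fin hγ0 hδ0 hδ1 hup (hδ.le_norm hu.1 hu.2.1) (by omega) hle key
  · have e1 : ‖u‖ ^ rk (mapZ (con tp (υ u)) R) ≤ ‖u‖ ^ rk (sec tp R u) :=
      pow_le_pow_of_le_one hup.le hu1.le hle
    have hp : 0 < ‖u‖ ^ rk (sec tp R u) := by positivity
    have e2 : γ ^ rk R ≤ covol R := by
      have := mul_le_mul_of_nonneg_right e1 (covol_nonneg R)
      refine le_of_mul_le_mul_left ?_ hp
      linarith
    refine le_trans (pow_le_pow_left₀ (by positivity) ?_ _) e2
    nlinarith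

theorem case_three (h : IsTensor tp) (hL : OU L τ) (hM : OU M υ)
    (hdV : finrank ℝ V = 3) (hdW : finrank ℝ W = 3) {γ δ : ℝ} (hγ0 : 0 ≤ γ) (hγ1 : γ ≤ 1)
    (hδ0 : 0 ≤ δ) (hδ1 : δ ≤ 1) (hγ : PP L γ) (hδ : PP M δ) :
    PP (tensorLat tp L M) (γ * δ) := by
  have := h.fd
  refine PP_tensor_iso h hL hM (by positivity) (by nlinarith) fun R hR hiso => ?_
  by_cases pM : PP M 1
  swap
  · exact three_short_iso h hL.gap hM hdW hγ0 hδ0 hδ1 hγ hδ pM hR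
  by_cases pL : PP L 1
  swap
  · rw [mul_comm]
    refine three_short_iso h.flip hM.gap hL hdV hδ0 hγ0 hγ1 hδ hγ pL ?_
    rw [tensorLat_flip]; exact hR
  have hg : Gap R := (tensor_gap h hL.gap hM.gap).mono hR
  refine le_trans (pow_le_one₀ (by positivity) (by nlinarith)) ?_
  by_contra hlt
  push Not at hlt
  have B : Bad tp L M τ υ R :=
    { h := h, hL := hL, hM := hM, dV := hdV, dW := hdW, pL := pL, pM := pM, le := hR
      iso := by
        intro x y hxy w hw
        have := hiso _ hxy _ hw
        rw [tmap_tp] at this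
        rw [real_inner_comm, con_inner, real_inner_comm]
        exact this
      rk4 := by
        have := iso_rank _ (tmap_isom h hL.isom hM.isom) hg hiso
        rw [h.finrank_eq, hdV, hdW] at this
        omega
      lt := hlt }
  exact B.false

end P11

section P12
variable {V W G : Type*} [NormedAddCommGroup V] [InnerProductSpace ℝ V]
  [NormedAddCommGroup W] [InnerProductSpace ℝ W] [NormedAddCommGroup G] [InnerProductSpace ℝ G]
  [FiniteDimensional ℝ V] [FiniteDimensional ℝ W]
  {tp : V →ₗ[ℝ] W →ₗ[ℝ] G} {L : Submodule ℤ V} {M : Submodule ℤ W}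
  {τ : V →ₗ[ℝ] V} {υ : W →ₗ[ℝ] W}

/-! ### Scaling -/

/-- Scaling of a lattice. -/
def scal (c : ℝ) (X : Submodule ℤ V) : Submodule ℤ V := mapZ (c • (LinearMap.id : V →ₗ[ℝ] V)) X

theorem mem_scal {c : ℝ} {X : Submodule ℤ V} {v : V} : v ∈ scal c X ↔ ∃ x ∈ X, c • x = v := Iff.rfl

theorem PP_of_scale {Z X : Submodule ℤ V} (hZ : Gap Z) {c γ : ℝ} (hc : 0 < c)
    (hsub : scal c Z ≤ X) (h : PP X (c * γ)) : PP Z γ := by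
  intro Y hY
  have hYg := hZ.mono hY
  have h1 : scal c Y ≤ X := by
    refine le_trans ?_ hsub
    rintro _ ⟨x, hx, rfl⟩
    exact ⟨x, hY hx, rfl⟩
  have h2 := h _ h1
  have h3 : rk (scal c Y) = rk Y := rk_map hYg.fg _ (by
    intro x _ h0
    have h0 : c • x = 0 := h0
    exact (smul_eq_zero.1 h0).resolve_left hc.ne')
  have h4 : covol (scal c Y) = c ^ rk Y * covol Y := covol_map hYg.fg _ c hc (by
    intro x _ y _
    simp only [LinearMap.smul_apply, LinearMap.id_apply, real_inner_smul_left,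
      real_inner_smul_right]
    ring)
  rw [h3, h4, mul_pow] at h2
  exact le_of_mul_le_mul_left h2 (by positivity)

theorem gap_scal {X : Submodule ℤ V} (hX : Gap X) {c : ℝ} (hc : 0 < c) : Gap (scal c X) := by
  obtain ⟨ε, hε, h⟩ := hX
  refine ⟨c * ε, by positivity, ?_⟩
  rintro _ ⟨x, hx, rfl⟩ h0
  change c * ε ≤ ‖c • x‖
  rw [norm_smul, Real.norm_eq_abs, abs_of_pos hc]
  have : x ≠ 0 := by rintro rfl; exact h0 (map_zero _)
  have := h x hx this
  gcongr

theorem scal_OU (hL : IsLat L) (hτ : IsIsodual L τ) (hs : ∀ x y, bform τ x y = bform τ y x) :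
    ∃ c : ℝ, 0 < c ∧ OU (scal c L) ((c ^ 2)⁻¹ • τ) := by
  obtain ⟨⟨α, hα, hi⟩, hd⟩ := hτ
  set c := Real.sqrt (Real.sqrt α) with hcd
  have hc : 0 < c := Real.sqrt_pos.2 (Real.sqrt_pos.2 hα)
  have hc4 : c ^ 4 = α := by
    have : c ^ 4 = (c ^ 2) ^ 2 := by ring
    rw [this, hcd, Real.sq_sqrt (Real.sqrt_nonneg _), Real.sq_sqrt hα.le]
  refine ⟨c, hc, ?_⟩
  constructor
  · exact gap_scal (gap_of_disc hL.1) hc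
  · rw [eq_top_iff, ← hL.2, Submodule.span_le]
    intro x hx
    have : x = c⁻¹ • (c • x) := by rw [smul_smul, inv_mul_cancel₀ hc.ne', one_smul]
    rw [this]
    exact Submodule.smul_mem _ _ (Submodule.subset_span ⟨x, hx, rfl⟩)
  · intro x y
    simp only [LinearMap.smul_apply, real_inner_smul_left, real_inner_smul_right, hi]
    rw [← hc4]; field_simp
  · intro x y
    simp only [LinearMap.smul_apply, real_inner_smul_left]
    have := hs x y
    unfold bform at this
    rw [this]
  · have hmem : ∀ y, y ∈ dualLat L ↔ ∃ x ∈ L, τ x = y := by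
      intro y; rw [← hd]; rfl
    ext y
    constructor
    · rintro ⟨_, ⟨x, hx, rfl⟩, rfl⟩
      rintro _ ⟨z, hz, rfl⟩
      obtain ⟨n, hn⟩ := (hmem (τ x)).2 ⟨x, hx, rfl⟩ z hz
      refine ⟨n, ?_⟩
      rw [← hn]
      change inner ℝ (c • z) ((c ^ 2)⁻¹ • τ (c • x)) = _
      rw [map_smul, real_inner_smul_left, real_inner_smul_right, real_inner_smul_right]
      field_simp
    · intro hy
      have h1 : c • y ∈ dualLat L := by
        intro z hz
        obtain ⟨n, hn⟩ := hy (c • z) ⟨z, hz, rfl⟩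
        exact ⟨n, by rw [← hn, real_inner_smul_left, real_inner_smul_right]⟩
      obtain ⟨x, hx, hxy⟩ := (hmem _).1 h1
      refine ⟨c • x, ⟨x, hx, rfl⟩, ?_⟩
      change (c ^ 2)⁻¹ • τ (c • x) = y
      rw [map_smul, hxy, smul_smul, smul_smul]
      have : (c ^ 2)⁻¹ * c * c = 1 := by field_simp
      rw [this, one_smul]

theorem tensor_scal {c d : ℝ} : scal (c * d) (tensorLat tp L M) ≤ tensorLat tp (scal c L) (scal d M) := by
  rintro _ ⟨w, hw, rfl⟩
  change (c * d) • w ∈ _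
  induction hw using Submodule.span_induction with
  | mem w hw =>
    obtain ⟨x, hx, y, hy, rfl⟩ := hw
    have : (c * d) • tp x y = tp (c • x) (d • y) := by
      rw [map_smul, map_smul, LinearMap.smul_apply, smul_smul, mul_comm]
    change (c * d) • tp x y ∈ _
    rw [this]
    exact tp_mem ⟨x, hx, rfl⟩ ⟨y, hy, rfl⟩
  | zero => rw [smul_zero]; exact Submodule.zero_mem _
  | add u v _ _ hu hv => rw [smul_add]; exact Submodule.add_mem _ hu hv
  | smul a u _ hu => rw [smul_comm]; exact Submodule.smul_mem _ _ hu

/-! ### Signatures -/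

theorem sig_le {b : V → V → ℝ} {s : ℤ} (h : HasSignature b s) : |s| ≤ (finrank ℝ V : ℤ) := by
  obtain ⟨n, v, ho, rfl⟩ := h
  rw [finrank_eq_card_basis v, Fintype.card_fin]
  have h1 := Finset.card_filter_le (Finset.univ : Finset (Fin n)) (fun i => 0 < b (v i) (v i))
  have h2 := Finset.card_filter_le (Finset.univ : Finset (Fin n)) (fun i => b (v i) (v i) < 0)
  rw [Finset.card_univ, Fintype.card_fin] at h1 h2
  rw [abs_le]
  constructor <;> omega

theorem bform_diag {n : ℕ} (v : Basis (Fin n) ℝ V)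
    (ho : ∀ i j, i ≠ j → bform τ (v i) (v j) = 0) (x : V) :
    bform τ x x = ∑ i, (v.repr x i) ^ 2 * bform τ (v i) (v i) := by
  conv_lhs => rw [← v.sum_repr x]
  unfold bform at *
  rw [map_sum, sum_inner]
  refine Finset.sum_congr rfl fun i _ => ?_
  rw [inner_sum, Finset.sum_eq_single i]
  · rw [map_smul, real_inner_smul_left, real_inner_smul_right]; ring
  · intro j _ hj
    rw [map_smul, real_inner_smul_left, real_inner_smul_right, ho i j hj.symm]; ring
  · simp

theorem sig_indef {s : ℤ} (h : HasSignature (bform τ) s) (hp : ∃ x, 0 < bform τ x x)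
    (hn : ∃ x, bform τ x x < 0) : |s| ≤ (finrank ℝ V : ℤ) - 2 := by
  obtain ⟨n, v, ho, rfl⟩ := h
  rw [finrank_eq_card_basis v, Fintype.card_fin]
  have h1 : 0 < (Finset.univ.filter fun i => 0 < bform τ (v i) (v i)).card := by
    rw [Finset.card_pos]
    by_contra he
    rw [Finset.not_nonempty_iff_eq_empty, Finset.filter_eq_empty_iff] at he
    obtain ⟨x, hx⟩ := hp
    rw [bform_diag v ho] at hx
    refine absurd hx (not_lt.2 (Finset.sum_nonpos fun i _ => ?_))
    exact mul_nonpos_of_nonneg_of_nonpos (sq_nonneg _) (not_lt.1 (he (Finset.mem_univ i)))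
  have h2 : 0 < (Finset.univ.filter fun i => bform τ (v i) (v i) < 0).card := by
    rw [Finset.card_pos]
    by_contra he
    rw [Finset.not_nonempty_iff_eq_empty, Finset.filter_eq_empty_iff] at he
    obtain ⟨x, hx⟩ := hn
    rw [bform_diag v ho] at hx
    refine absurd hx (not_lt.2 (Finset.sum_nonneg fun i _ => ?_))
    exact mul_nonneg (sq_nonneg _) (not_lt.1 (he (Finset.mem_univ i)))
  have h3 : (Finset.univ.filter fun i => 0 < bform τ (v i) (v i)).card +
      (Finset.univ.filter fun i => bform τ (v i) (v i) < 0).card ≤ n := by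
    rw [← Finset.card_union_of_disjoint]
    · exact (Finset.card_le_univ _).trans (by simp)
    · rw [Finset.disjoint_filter]
      intro i _ hi
      exact not_lt.2 hi.le
  rw [abs_le]
  constructor <;> omega

theorem indef_sig {s : ℤ} (h : HasSignature (bform τ) s) {c : ℝ} (hc : 0 < c)
    (hI : Indef ((c ^ 2)⁻¹ • τ)) : |s| ≤ (finrank ℝ V : ℤ) - 2 := by
  obtain ⟨⟨p, hp0, hp⟩, q, hq0, hq⟩ := hI
  have key : ∀ x, bform τ x x = c ^ 2 * inner ℝ (((c ^ 2)⁻¹ • τ) x) x := by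
    intro x
    unfold bform
    rw [LinearMap.smul_apply, real_inner_smul_left]
    field_simp
  refine sig_indef h ⟨p, ?_⟩ ⟨q, ?_⟩
  · rw [key, hp, real_inner_self_eq_norm_sq]
    have := norm_pos_iff.2 hp0
    positivity
  · rw [key, hq, inner_neg_left, real_inner_self_eq_norm_sq]
    have := norm_pos_iff.2 hq0
    have : 0 < c ^ 2 * ‖q‖ ^ 2 := by positivity
    linarith

theorem PP.le_one (h : OU L τ) {γ : ℝ} (hγ : PP L γ) (hn : finrank ℝ V ≠ 0) : γ ≤ 1 := by
  have := hγ L le_rfl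
  rw [h.covol_one, h.rk_eq] at this
  by_contra h1
  push Not at h1
  exact absurd (one_lt_pow₀ h1 hn) (not_lt.2 this)

/-- The main estimate for unimodular lattices. -/
theorem main_PP (h : IsTensor tp) (hL : OU L τ) (hM : OU M υ) (hn : finrank ℝ V ≠ 0)
    (hm : finrank ℝ W ≠ 0) {s s' : ℤ} (hs : |s| ≤ (finrank ℝ V : ℤ)) (hs' : |s'| ≤ (finrank ℝ W : ℤ))
    (hI : Indef τ → |s| ≤ (finrank ℝ V : ℤ) - 2) (hI' : Indef υ → |s'| ≤ (finrank ℝ W : ℤ) - 2)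
    (hbig : (finrank ℝ V : ℤ) * (finrank ℝ W : ℤ) - 8 ≤ |s * s'|) {γ δ : ℝ} (hγ0 : 0 ≤ γ)
    (hδ0 : 0 ≤ δ) (hγ : PP L γ) (hδ : PP M δ) : PP (tensorLat tp L M) (γ * δ) := by
  have hγ1 := hγ.le_one hL hn
  have hδ1 := hδ.le_one hM hm
  rw [abs_mul] at hbig
  have a0 := abs_nonneg s
  have b0 := abs_nonneg s'
  generalize |s| = a at *
  generalize |s'| = b at *
  rcases def_or_indef hL with ⟨ε, hε, h1⟩ | iL <;> rcases def_or_indef hM with ⟨ε', hε', h2⟩ | iM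
  · refine case_def h hL hM ?_ ?_ h1 h2 (by positivity) (by nlinarith)
    · rcases hε with rfl | rfl <;> norm_num
    · rcases hε' with rfl | rfl <;> norm_num
  · have hb := hI' iM
    have : a * b ≤ (finrank ℝ V : ℤ) * ((finrank ℝ W : ℤ) - 2) :=
      mul_le_mul hs hb b0 (by positivity)
    have hd : (finrank ℝ V : ℤ) ≤ 4 := by linarith
    rw [← tensorLat_flip, mul_comm γ δ]
    exact case_semidef h.flip hM.gap hL hε h1 (by exact_mod_cast hd) hδ0 hγ0 hγ1 hδ
  · have hb := hI iL
    have : a * b ≤ ((finrank ℝ V : ℤ) - 2) * (finrank ℝ W : ℤ) :=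
      mul_le_mul hb hs' b0 (by linarith)
    have hd : (finrank ℝ W : ℤ) ≤ 4 := by linarith
    exact case_semidef h hL.gap hM hε' h2 (by exact_mod_cast hd) hγ0 hδ0 hδ1 hγ
  · have hb := hI iL
    have hb' := hI' iM
    have : a * b ≤ ((finrank ℝ V : ℤ) - 2) * ((finrank ℝ W : ℤ) - 2) :=
      mul_le_mul hb hb' b0 (by linarith)
    have hd : (finrank ℝ V : ℤ) + finrank ℝ W ≤ 6 := by linarith
    by_cases e1 : finrank ℝ W = 2
    · exact case_two h hL.gap hM e1 iM hγ0 hδ0 hδ1 hγ hδ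
    by_cases e2 : finrank ℝ V = 2
    · rw [← tensorLat_flip, mul_comm γ δ]
      exact case_two h.flip hM.gap hL e2 iL hδ0 hγ0 hγ1 hδ hγ
    exact case_three h hL hM (by omega) (by omega) hγ0 hγ1 hδ0 hδ1 hγ hδ

theorem PP_scal {X : Submodule ℤ V} (hX : Gap X) {c γ : ℝ} (hc : 0 < c) (h : PP X γ) :
    PP (scal c X) (c * γ) := by
  refine PP_of_scale (gap_scal hX hc) (inv_pos.2 hc) (X := X) ?_ ?_
  · rintro _ ⟨_, ⟨x, hx, rfl⟩, rfl⟩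
    change c⁻¹ • (c • x) ∈ X
    rw [smul_smul, inv_mul_cancel₀ hc.ne', one_smul]
    exact hx
  · rw [inv_mul_cancel_left₀ hc.ne']
    exact h

end P12
/-- If `(E, L, τ)` and `(F, M, υ)` are orthogonal isodual with
`|s(b_τ)·s(b_υ)| ≥ dim E · dim F − 8`, then `H_min((E,L)⊗(F,M)) = H_min(E,L)·H_min(F,M)`. -/


theorem statement9 {E F : Type*} [NormedAddCommGroup E] [InnerProductSpace ℝ E]
    [FiniteDimensional ℝ E] [NormedAddCommGroup F] [InnerProductSpace ℝ F]
    [FiniteDimensional ℝ F] (L : Submodule ℤ E) (M : Submodule ℤ F)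
    (hL : IsLat L) (hM : IsLat M)
    (τ : E →ₗ[ℝ] E) (υ : F →ₗ[ℝ] F)
    (hτ : IsIsodual L τ) (hυ : IsIsodual M υ)
    (hτs : ∀ x y, bform τ x y = bform τ y x) (hυs : ∀ x y, bform υ x y = bform υ y x)
    (s s' : ℤ) (hs : HasSignature (bform τ) s) (hs' : HasSignature (bform υ) s')
    (hbig : (finrank ℝ E : ℤ) * (finrank ℝ F : ℤ) - 8 ≤ |s * s'|) :
    ∀ (G : Type*) [NormedAddCommGroup G] [InnerProductSpace ℝ G]
      (tp : E →ₗ[ℝ] F →ₗ[ℝ] G), IsTensor tp →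
      Hmin (tensorLat tp L M) = Hmin L * Hmin M := by
  intro G _ _ tp h
  have := h.fd
  by_cases hn : finrank ℝ E = 0
  · rw [Hmin_zero L hn, Hmin_zero (tensorLat tp L M) (by rw [h.finrank_eq, hn, zero_mul]), zero_mul]
  by_cases hm : finrank ℝ F = 0
  · rw [Hmin_zero M hm, Hmin_zero (tensorLat tp L M) (by rw [h.finrank_eq, hm, mul_zero]), mul_zero]
  have gL := gap_of_disc hL.1
  have gM := gap_of_disc hM.1
  have gT := tensor_gap h gL gM
  apply le_antisymm
  · exact Hmin_upper h gL gM hL.2 hM.2 hn hm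
  obtain ⟨c, hc, oL⟩ := scal_OU hL hτ hτs
  obtain ⟨d, hd, oM⟩ := scal_OU hM hυ hυs
  have n1 := Hmin_nonneg L
  have n2 := Hmin_nonneg M
  refine le_Hmin gT (tensor_span h hL.2 hM.2) (by rw [h.finrank_eq]; exact mul_ne_zero hn hm)
    (mul_nonneg n1 n2) ?_
  refine PP_of_scale gT (mul_pos hc hd) tensor_scal ?_
  have e : c * d * (Hmin L * Hmin M) = (c * Hmin L) * (d * Hmin M) := by ring
  rw [e]
  exact main_PP h oL oM hn hm (sig_le hs) (sig_le hs') (indef_sig hs hc) (indef_sig hs' hd) hbig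
    (mul_nonneg hc.le n1) (mul_nonneg hd.le n2) (PP_scal gL hc (PP_Hmin gL))
    (PP_scal gM hd (PP_Hmin gM))


end EucLat
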